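/- arXiv:0904.3847 — 3 statements merged into one kernel-verified Lean document; each statement's English description precedes it below -/
import Mathlib

section
/- For the scalar moment space M_n = { (s₁,…,s_n) : s_j = ∫₀¹ x^j dμ(x) for some probability measure μ on [0,1] }, the n-dimensional Lebesgue volume equals ∏_{k=1}^n B(k, k), where B is the Euler Beta function. -/
open MeasureTheory

/-- The `n`-th moment space of probability measures on `[0,1]`. -/
def momentSpace (n : ℕ) : Set (Fin n → ℝ) :=
  { s | ∃ μ : Measure ℝ, IsProbabilityMeasure μ ∧ μ (Set.Icc (0:ℝ) 1)ᶜ = 0 ∧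
      ∀ j : Fin n, s j = ∫ x, x ^ ((j : ℕ) + 1) ∂μ }

/-- `s` is the sequence of moments of a finitely supported probability measure on `[0,1]`. -/
def IsMomentSeq (s : ℕ → ℝ) : Prop :=
  ∃ (ι : Type) (_ : Fintype ι) (w x : ι → ℝ), (∀ i, 0 ≤ w i) ∧ ∑ i, w i = 1 ∧
    (∀ i, x i ∈ Set.Icc (0 : ℝ) 1) ∧ ∀ k, s k = ∑ i, w i * x i ^ k

/-- The relation between the moments `s` of a probability measure on `[0,1]` with mean `p` and the
moments `t` of the probability measure whose canonical moments are those of `s`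
with the first one removed. -/
def IsCanonicalShift (p : ℝ) (s t : ℕ → ℝ) : Prop :=
  s 0 = 1 ∧ ∀ k, s (k + 1) = p * (s k + ∑ i ∈ Finset.range k, (s i - s (i + 1)) * t (k - i))

section Operators

variable {V : Type*} [NormedAddCommGroup V] [InnerProductSpace ℝ V]

open scoped InnerProductSpace

theorem inner_pow_of_eigenbasis {ι : Type} [Fintype ι] (T : V →ₗ[ℝ] V)
    (e : OrthonormalBasis ι ℝ V) (x : ι → ℝ) (hT : ∀ i, T (e i) = x i • e i) (u v : V) (k : ℕ) :
    ⟪u, (T ^ k) v⟫_ℝ = ∑ i, ⟪u, e i⟫_ℝ * ⟪e i, v⟫_ℝ * x i ^ k := by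
  have hpow : ∀ i, (T ^ k) (e i) = x i ^ k • e i := by
    intro i
    induction k with
    | zero => simp
    | succ k ih => rw [pow_succ', Module.End.mul_apply, ih, map_smul, hT, smul_smul, pow_succ]
  conv_lhs => rw [← e.sum_repr v]
  simp only [map_sum, map_smul, hpow, inner_sum, inner_smul_right, e.repr_apply_apply]
  exact Finset.sum_congr rfl fun i _ => by ring

theorem exists_eigenbasis [FiniteDimensional ℝ V] (T : V →ₗ[ℝ] V) (hT : T.IsSymmetric)
    (h0 : ∀ y, 0 ≤ ⟪T y, y⟫_ℝ) (h1 : ∀ y, ⟪T y, y⟫_ℝ ≤ ⟪y, y⟫_ℝ) :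
    ∃ (ι : Type) (_ : Fintype ι) (e : OrthonormalBasis ι ℝ V) (x : ι → ℝ),
      (∀ i, T (e i) = x i • e i) ∧ ∀ i, x i ∈ Set.Icc (0 : ℝ) 1 := by
  refine ⟨_, inferInstance, hT.eigenvectorBasis rfl, hT.eigenvalues rfl,
    fun i => hT.apply_eigenvectorBasis rfl i, fun i => ?_⟩
  have hi := hT.apply_eigenvectorBasis rfl i
  have h0 := h0 (hT.eigenvectorBasis rfl i)
  have h1 := h1 (hT.eigenvectorBasis rfl i)
  rw [hi, inner_smul_left, real_inner_self_eq_norm_sq] at h0 h1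
  simp only [OrthonormalBasis.norm_eq_one] at h0 h1
  constructor
  · simpa using h0
  · simpa using h1

theorem isMomentSeq_inner_pow [FiniteDimensional ℝ V] (T : V →ₗ[ℝ] V) (hT : T.IsSymmetric)
    (h0 : ∀ y, 0 ≤ ⟪T y, y⟫_ℝ) (h1 : ∀ y, ⟪T y, y⟫_ℝ ≤ ⟪y, y⟫_ℝ) (v : V) (hv : ⟪v, v⟫_ℝ = 1) :
    IsMomentSeq fun k => ⟪v, (T ^ k) v⟫_ℝ := by
  obtain ⟨ι, _, e, x, hx, hx01⟩ := exists_eigenbasis T hT h0 h1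
  refine ⟨ι, inferInstance, fun i => ⟪v, e i⟫_ℝ * ⟪e i, v⟫_ℝ, x, fun i => ?_, ?_, hx01,
    inner_pow_of_eigenbasis T e x hx v v⟩
  · simp only [real_inner_comm v (e i)]
    exact mul_self_nonneg _
  · rw [e.sum_inner_mul_inner, hv]

/-- Cauchy–Schwarz for the form of a positive symmetric operator. -/
theorem inner_sq_le_of_positive (T : V →ₗ[ℝ] V) (hT : T.IsSymmetric)
    (h0 : ∀ y, 0 ≤ ⟪T y, y⟫_ℝ) (u y : V) :
    ⟪T u, y⟫_ℝ ^ 2 ≤ ⟪T u, u⟫_ℝ * ⟪T y, y⟫_ℝ := by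
  have h : ∀ r : ℝ, 0 ≤ ⟪T y, y⟫_ℝ * (r * r) + (2 * ⟪T u, y⟫_ℝ) * r + ⟪T u, u⟫_ℝ := by
    intro r
    have := h0 (u + r • y)
    have hs : ⟪T y, u⟫_ℝ = ⟪T u, y⟫_ℝ := by rw [hT y u, real_inner_comm]
    simp only [map_add, map_smul, inner_add_left, inner_add_right, inner_smul_left,
      inner_smul_right, hs, RCLike.conj_to_real] at this
    linarith
  have := discrim_le_zero h
  rw [discrim] at this
  linarith

theorem isCanonicalShift_inner_pow (T A : V →ₗ[ℝ] V) (hA : A.IsSymmetric) (v b : V) (p : ℝ)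
    (hp : p ≠ 1) (hv : ⟪v, v⟫_ℝ = 1) (hbv : ⟪b, v⟫_ℝ = 0) (hTv : T v = v)
    (hTA : ∀ y, A y = T y - (⟪(1 - p) • v - b, y⟫_ℝ / (1 - p)) • ((1 - p) • v - b))
    (t : ℕ → ℝ) (ht : ∀ k, ⟪b, (T ^ k) b⟫_ℝ = p * (1 - p) * t (k + 1)) :
    IsCanonicalShift p (fun k => ⟪v, (A ^ k) v⟫_ℝ) t := by
  have hq : 1 - p ≠ 0 := sub_ne_zero.mpr hp.symm
  have hvb : ⟪v, b⟫_ℝ = 0 := by rw [real_inner_comm, hbv]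
  set s : ℕ → ℝ := fun k => ⟪v, (A ^ k) v⟫_ℝ with hs
  have hs0 : s 0 = 1 := hv
  have hAv : A v = p • v + b := by
    rw [hTA, hTv, inner_sub_left, inner_smul_left, hv, hbv]
    simp only [RCLike.conj_to_real, mul_one, sub_zero, div_self hq, one_smul, sub_smul]
    abel
  have hsucc : ∀ k, s (k + 1) = p * s k + ⟪b, (A ^ k) v⟫_ℝ := by
    intro k
    simp only [hs]
    rw [pow_succ', Module.End.mul_apply, ← hA, hAv, inner_add_left, inner_smul_left]
    simp
  have hstep : ∀ k, (A ^ (k + 1)) v - s (k + 1) • v =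
      T ((A ^ k) v - s k • v) + ((s k - s (k + 1)) / (1 - p)) • b := by
    intro k
    have hc : ⟪(1 - p) • v - b, (A ^ k) v⟫_ℝ = s k - s (k + 1) := by
      rw [hsucc, inner_sub_left, inner_smul_left]
      simp only [hs, RCLike.conj_to_real]
      ring
    rw [pow_succ', Module.End.mul_apply, hTA, hc, map_sub, map_smul, hTv, smul_sub, smul_smul,
      div_mul_cancel₀ _ hq, sub_smul]
    abel
  have hinner : ∀ k m, ⟪b, (T ^ m) ((A ^ k) v - s k • v)⟫_ℝ =
      ∑ i ∈ Finset.range k, p * ((s i - s (i + 1)) * t (k - i + m)) := by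
    intro k
    induction k with
    | zero => intro m; simp [hs0]
    | succ k ih =>
      intro m
      rw [hstep, map_add, ← Module.End.mul_apply, ← pow_succ, inner_add_right, ih, map_smul,
        inner_smul_right, ht, Finset.sum_range_succ]
      congr 1
      · refine Finset.sum_congr rfl fun i hi => ?_
        have : k - i + (m + 1) = k + 1 - i + m := by
          have := Finset.mem_range.mp hi
          omega
        rw [this]
      · rw [show k + 1 - k + m = m + 1 by omega]
        field_simp
  refine ⟨hs0, fun k => ?_⟩
  have := hinner k 0
  simp only [pow_zero, Module.End.one_apply, inner_sub_right, inner_smul_right, hbv, mul_zero,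
    sub_zero, add_zero, ← Finset.mul_sum] at this
  rw [hsucc, this]
  ring

theorem inner_sq_le_of_compl (A T : V →ₗ[ℝ] V) (hA : A.IsSymmetric)
    (h0 : ∀ y, 0 ≤ ⟪A y, y⟫_ℝ) (v : V) (p : ℝ) (hp : p ∈ Set.Ioo (0 : ℝ) 1)
    (hAv : ⟪A v, v⟫_ℝ = p)
    (hT : ∀ y, T y = A y + (⟪v - A v, y⟫_ℝ / (1 - p)) • (v - A v)) (y : V) :
    ⟪A v - p • v, y⟫_ℝ ^ 2 ≤ p * (1 - p) * ⟪T y, y⟫_ℝ := by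
  have hq : 1 - p ≠ 0 := sub_ne_zero.mpr hp.2.ne'
  have h := inner_sq_le_of_positive A hA h0 v y
  rw [hAv] at h
  have hTy : (1 - p) * ⟪T y, y⟫_ℝ = (1 - p) * ⟪A y, y⟫_ℝ + (⟪v, y⟫_ℝ - ⟪A v, y⟫_ℝ) ^ 2 := by
    rw [hT, inner_add_left, inner_smul_left, inner_sub_left, RCLike.conj_to_real]
    field_simp
  rw [mul_assoc, hTy, inner_sub_left, inner_smul_left, RCLike.conj_to_real]
  have h2 := mul_le_mul_of_nonneg_left h (sub_nonneg.mpr hp.2.le)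
  nlinarith [mul_nonneg (mul_nonneg hp.1.le (sub_nonneg.mpr hp.2.le)) (sq_nonneg ⟪v, y⟫_ℝ)]

/-- A vector dominated by a positive contraction `T` yields a moment sequence. -/
theorem exists_isMomentSeq_of_inner_sq_le [FiniteDimensional ℝ V] (T : V →ₗ[ℝ] V)
    (hT : T.IsSymmetric) (h0 : ∀ y, 0 ≤ ⟪T y, y⟫_ℝ) (h1 : ∀ y, ⟪T y, y⟫_ℝ ≤ ⟪y, y⟫_ℝ)
    (b : V) (r : ℝ) (hr : 0 < r) (hb : ∀ y, ⟪b, y⟫_ℝ ^ 2 ≤ r * ⟪T y, y⟫_ℝ) :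
    ∃ t, IsMomentSeq t ∧ ∀ k, ⟪b, (T ^ k) b⟫_ℝ = r * t (k + 1) := by
  obtain ⟨ι, _, e, x, hx, hx01⟩ := exists_eigenbasis T hT h0 h1
  set w : ι → ℝ := fun i => ⟪b, e i⟫_ℝ ^ 2 / (r * x i) with hw
  have hβ : ∀ i, x i = 0 → ⟪b, e i⟫_ℝ = 0 := by
    intro i hi
    have := hb (e i)
    rw [hx, hi, zero_smul, inner_zero_left, mul_zero] at this
    exact pow_eq_zero_iff two_ne_zero |>.mp (le_antisymm this (sq_nonneg _))
  have hsum : ∑ i, w i ≤ 1 := by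
    have hy := hb (∑ i, (⟪b, e i⟫_ℝ / (r * x i)) • e i)
    have e1 : ⟪b, ∑ i, (⟪b, e i⟫_ℝ / (r * x i)) • e i⟫_ℝ = ∑ i, w i := by
      simp only [inner_sum, inner_smul_right, hw]
      exact Finset.sum_congr rfl fun i _ => by ring
    have e2 : r * ⟪T (∑ i, (⟪b, e i⟫_ℝ / (r * x i)) • e i),
        ∑ i, (⟪b, e i⟫_ℝ / (r * x i)) • e i⟫_ℝ = ∑ i, w i := by
      simp only [map_sum, map_smul, hx, smul_smul]
      rw [e.orthonormal.inner_sum, Finset.mul_sum]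
      refine Finset.sum_congr rfl fun i _ => ?_
      simp only [hw, RCLike.conj_to_real]
      rcases eq_or_ne (x i) 0 with hi | hi
      · simp [hi]
      · field_simp
    rw [e1, e2] at hy
    nlinarith
  refine ⟨fun k => ∑ i : Option ι, (i.elim (1 - ∑ i, w i) w) * (i.elim 0 x) ^ k,
    ⟨Option ι, inferInstance, fun i => i.elim (1 - ∑ i, w i) w, fun i => i.elim 0 x,
      ?_, ?_, ?_, fun k => rfl⟩, fun k => ?_⟩
  · rintro (_ | i)
    · simpa using hsum
    · exact div_nonneg (sq_nonneg _) (mul_nonneg hr.le (hx01 i).1)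
  · simp [Fintype.sum_option]
  · rintro (_ | i)
    · simp
    · exact hx01 i
  · rw [inner_pow_of_eigenbasis T e x hx]
    simp only [Fintype.sum_option, Option.elim, ne_eq, Nat.add_eq_zero_iff, one_ne_zero, and_false,
      not_false_eq_true, zero_pow, mul_zero, zero_add, Finset.mul_sum]
    refine Finset.sum_congr rfl fun i _ => ?_
    rw [real_inner_comm b (e i)]
    rcases eq_or_ne (x i) 0 with hi | hi
    · simp [hi, hβ i hi]
    · simp only [hw]
      field_simp
      ring

/-- Multiplication by `x`, coordinatewise. -/
def diagOp {ι : Type} (x : ι → ℝ) : EuclideanSpace ℝ ι →ₗ[ℝ] EuclideanSpace ℝ ι where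
  toFun y := WithLp.toLp 2 fun i => x i * y i
  map_add' y z := by ext i; simp [mul_add]
  map_smul' c y := by ext i; simp [mul_left_comm]

theorem diagOp_pow_apply {ι : Type} (x : ι → ℝ) (k : ℕ) (y : EuclideanSpace ℝ ι) (i : ι) :
    (diagOp x ^ k) y i = x i ^ k * y i := by
  induction k with
  | zero => simp
  | succ k ih => rw [pow_succ', Module.End.mul_apply, pow_succ', mul_assoc, ← ih]; rfl

theorem inner_diagOp_pow {ι : Type} [Fintype ι] (x : ι → ℝ) (k : ℕ) (y z : EuclideanSpace ℝ ι) :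
    ⟪z, (diagOp x ^ k) y⟫_ℝ = ∑ i, z i * y i * x i ^ k := by
  simp only [PiLp.inner_apply, diagOp_pow_apply]
  exact Finset.sum_congr rfl fun i _ => by simp; ring

theorem inner_diagOp {ι : Type} [Fintype ι] (x : ι → ℝ) (y z : EuclideanSpace ℝ ι) :
    ⟪diagOp x y, z⟫_ℝ = ∑ i, y i * z i * x i := by
  rw [real_inner_comm, ← pow_one (diagOp x), inner_diagOp_pow]
  exact Finset.sum_congr rfl fun i _ => by ring

theorem diagOp_isSymmetric {ι : Type} [Fintype ι] (x : ι → ℝ) : (diagOp x).IsSymmetric := by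
  intro y z
  rw [real_inner_comm (diagOp x z), inner_diagOp, inner_diagOp]
  exact Finset.sum_congr rfl fun i _ => by ring

theorem inner_diagOp_self_nonneg {ι : Type} [Fintype ι] (x : ι → ℝ) (hx : ∀ i, 0 ≤ x i)
    (y : EuclideanSpace ℝ ι) : 0 ≤ ⟪diagOp x y, y⟫_ℝ := by
  rw [inner_diagOp]
  exact Finset.sum_nonneg fun i _ => mul_nonneg (mul_self_nonneg _) (hx i)

theorem inner_diagOp_self_le {ι : Type} [Fintype ι] (x : ι → ℝ) (hx : ∀ i, x i ≤ 1)
    (y : EuclideanSpace ℝ ι) : ⟪diagOp x y, y⟫_ℝ ≤ ⟪y, y⟫_ℝ := by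
  rw [inner_diagOp, PiLp.inner_apply]
  exact Finset.sum_le_sum fun i _ => by
    simpa [pow_two] using mul_le_of_le_one_right (mul_self_nonneg (y i)) (hx i)

theorem isSymmetric_smulRight (c : V) :
    ((innerₛₗ ℝ c).smulRight c : V →ₗ[ℝ] V).IsSymmetric := by
  intro y z
  simp only [LinearMap.smulRight_apply, innerₛₗ_apply_apply, inner_smul_left, inner_smul_right,
    RCLike.conj_to_real]
  rw [real_inner_comm c y]
  ring

theorem exists_isCanonicalShift_inner_pow [FiniteDimensional ℝ V] (A : V →ₗ[ℝ] V)
    (hA : A.IsSymmetric) (h0 : ∀ y, 0 ≤ ⟪A y, y⟫_ℝ) (h1 : ∀ y, ⟪A y, y⟫_ℝ ≤ ⟪y, y⟫_ℝ)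
    (v : V) (hv : ⟪v, v⟫_ℝ = 1) (p : ℝ) (hp : p ∈ Set.Ioo (0 : ℝ) 1) (hAv : ⟪A v, v⟫_ℝ = p) :
    ∃ t, IsMomentSeq t ∧ IsCanonicalShift p (fun k => ⟪v, (A ^ k) v⟫_ℝ) t := by
  have hq : 0 < 1 - p := sub_pos.mpr hp.2
  set T : V →ₗ[ℝ] V := A + (1 - p)⁻¹ • (innerₛₗ ℝ (v - A v)).smulRight (v - A v) with hTdef
  have hT : ∀ y, T y = A y + (⟪v - A v, y⟫_ℝ / (1 - p)) • (v - A v) := by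
    intro y
    simp [hTdef, smul_smul, div_eq_inv_mul, inner_sub_left]
  have hTs : T.IsSymmetric := hA.add ((isSymmetric_smulRight _).smul (by simp))
  have hTi : ∀ y, ⟪T y, y⟫_ℝ = ⟪A y, y⟫_ℝ + ⟪v - A v, y⟫_ℝ ^ 2 / (1 - p) := by
    intro y
    rw [hT, inner_add_left, inner_smul_left, RCLike.conj_to_real]
    ring
  have hcv : ⟪v - A v, v⟫_ℝ = 1 - p := by rw [inner_sub_left, hv, hAv]
  have hbc : (1 - p) • v - (A v - p • v) = v - A v := by rw [sub_smul, one_smul]; abel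
  obtain ⟨t, ht, htb⟩ := exists_isMomentSeq_of_inner_sq_le T hTs
    (fun y => by rw [hTi]; exact add_nonneg (h0 y) (div_nonneg (sq_nonneg _) hq.le))
    (fun y => by
      have := inner_sq_le_of_positive (LinearMap.id - A) (LinearMap.IsSymmetric.id.sub hA)
        (fun y => by simpa [inner_sub_left] using h1 y) v y
      simp only [LinearMap.sub_apply, LinearMap.id_apply, hcv] at this
      rw [inner_sub_left y] at this
      rw [hTi, ← le_sub_iff_add_le', div_le_iff₀' hq]
      exact this)
    (A v - p • v) (p * (1 - p)) (mul_pos hp.1 hq) (inner_sq_le_of_compl A T hA h0 v p hp hAv hT)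
  refine ⟨t, ht, isCanonicalShift_inner_pow T A hA v (A v - p • v) p hp.2.ne hv ?_ ?_ ?_ t htb⟩
  · rw [inner_sub_left, inner_smul_left, hAv, hv]
    simp
  · rw [hT, hcv, div_self hq.ne', one_smul]
    abel
  · intro y
    rw [hbc, hT]
    abel

theorem exists_isMomentSeq_isCanonicalShift [FiniteDimensional ℝ V] (T : V →ₗ[ℝ] V)
    (hT : T.IsSymmetric) (h1 : ∀ y, ⟪T y, y⟫_ℝ ≤ ⟪y, y⟫_ℝ)
    (v b : V) (hv : ⟪v, v⟫_ℝ = 1) (hbv : ⟪b, v⟫_ℝ = 0) (hTv : T v = v)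
    (p : ℝ) (hp : p ∈ Set.Ioo (0 : ℝ) 1)
    (hb : ∀ y, ⟪b, y⟫_ℝ ^ 2 ≤ p * (1 - p) * ⟪T y, y⟫_ℝ)
    (t : ℕ → ℝ) (ht : ∀ k, ⟪b, (T ^ k) b⟫_ℝ = p * (1 - p) * t (k + 1)) :
    ∃ s, IsMomentSeq s ∧ IsCanonicalShift p s t := by
  have hq : 0 < 1 - p := sub_pos.mpr hp.2
  set c := (1 - p) • v - b with hc
  set A : V →ₗ[ℝ] V := T - (1 - p)⁻¹ • (innerₛₗ ℝ c).smulRight c with hAdef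
  have hA : ∀ y, A y = T y - (⟪c, y⟫_ℝ / (1 - p)) • c := by
    intro y
    simp [hAdef, smul_smul, div_eq_inv_mul]
  have hAs : A.IsSymmetric := hT.sub ((isSymmetric_smulRight _).smul (by simp))
  have hAi : ∀ y, ⟪A y, y⟫_ℝ = ⟪T y, y⟫_ℝ - ⟪c, y⟫_ℝ ^ 2 / (1 - p) := by
    intro y
    rw [hA, inner_sub_left, inner_smul_left, RCLike.conj_to_real]
    ring
  refine ⟨_, isMomentSeq_inner_pow A hAs (fun y => ?_) (fun y => ?_) v hv,
    isCanonicalShift_inner_pow T A hAs v b p hp.2.ne hv hbv hTv hA t ht⟩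
  · rw [hAi, sub_nonneg, div_le_iff₀' hq, hc, inner_sub_left, inner_smul_left,
      RCLike.conj_to_real]
    have h := hb (y - ⟪v, y⟫_ℝ • v)
    have hvT : ⟪T y, v⟫_ℝ = ⟪v, y⟫_ℝ := by rw [hT, hTv, real_inner_comm]
    simp only [map_sub, map_smul, inner_sub_left, inner_sub_right, inner_smul_left,
      inner_smul_right, hbv, hvT, hTv, hv, RCLike.conj_to_real] at h
    set d := ⟪v, y⟫_ℝ
    set β := ⟪b, y⟫_ℝ
    set τ := ⟪T y, y⟫_ℝ
    have h2 : 0 ≤ (1 - p) * (p * d + β) ^ 2 := mul_nonneg hq.le (sq_nonneg _)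
    have h3 : 0 ≤ p * ((1 - p) * τ - ((1 - p) * d - β) ^ 2) := by linarith
    have := (mul_nonneg_iff_of_pos_left hp.1).mp h3
    linarith
  · rw [hAi]
    have := div_nonneg (sq_nonneg ⟪c, y⟫_ℝ) hq.le
    linarith [h1 y]

end Operators

theorem IsMomentSeq.exists_isCanonicalShift {s : ℕ → ℝ} (hs : IsMomentSeq s)
    (hp : s 1 ∈ Set.Ioo (0 : ℝ) 1) : ∃ t, IsMomentSeq t ∧ IsCanonicalShift (s 1) s t := by
  obtain ⟨ι, _, w, x, hw, hw1, hx, hs⟩ := hs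
  have hsk : ∀ k, inner ℝ (WithLp.toLp 2 fun i => √(w i) : EuclideanSpace ℝ ι)
      ((diagOp x ^ k) (WithLp.toLp 2 fun i => √(w i))) = s k := by
    intro k
    simp only [inner_diagOp_pow, hs, Real.mul_self_sqrt (hw _)]
  obtain ⟨t, ht, hst⟩ := exists_isCanonicalShift_inner_pow (diagOp x) (diagOp_isSymmetric x)
    (inner_diagOp_self_nonneg x fun i => (hx i).1) (inner_diagOp_self_le x fun i => (hx i).2)
    (WithLp.toLp 2 fun i => √(w i)) (by rw [← hw1]; simpa [hs] using hsk 0) (s 1) hp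
    (by rw [← hsk 1, pow_one, real_inner_comm])
  simp only [hsk] at hst
  exact ⟨t, ht, hst⟩

theorem IsMomentSeq.exists_isCanonicalShift_of_mean {t : ℕ → ℝ} (ht : IsMomentSeq t) {p : ℝ}
    (hp : p ∈ Set.Ioo (0 : ℝ) 1) : ∃ s, IsMomentSeq s ∧ IsCanonicalShift p s t := by
  obtain ⟨ι, _, w, x, hw, hw1, hx, ht⟩ := ht
  have hr : 0 < p * (1 - p) := mul_pos hp.1 (sub_pos.mpr hp.2)
  have hnn : ∀ i, 0 ≤ p * (1 - p) * w i * x i := fun i =>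
    mul_nonneg (mul_nonneg hr.le (hw i)) (hx i).1
  refine exists_isMomentSeq_isCanonicalShift (V := EuclideanSpace ℝ (Option ι))
    (diagOp fun i => i.elim 1 x) (diagOp_isSymmetric _)
    (inner_diagOp_self_le _ ?_) (WithLp.toLp 2 fun i => i.elim 1 fun _ => 0)
    (WithLp.toLp 2 fun i => i.elim 0 fun i => √(p * (1 - p) * w i * x i))
    ?_ ?_ ?_ p hp (fun y => ?_) t fun k => ?_
  · rintro (_ | i)
    · simp
    · exact (hx i).2
  · rw [PiLp.inner_apply, Fintype.sum_option]
    simp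
  · simp [PiLp.inner_apply, Fintype.sum_option]
  · ext i
    rcases i with _ | i <;> simp [diagOp]
  · rw [inner_diagOp, PiLp.inner_apply, Fintype.sum_option, Fintype.sum_option]
    have h := Finset.sum_mul_sq_le_sq_mul_sq Finset.univ (fun i => √(p * (1 - p) * w i))
      (fun i => √(x i) * y (some i))
    simp only [mul_pow, Real.sq_sqrt (mul_nonneg hr.le (hw _)), Real.sq_sqrt (hx _).1,
      ← Finset.mul_sum, hw1, mul_one] at h
    have e1 : ∀ i, √(p * (1 - p) * w i) * (√(x i) * y (some i)) =
        √(p * (1 - p) * w i * x i) * y (some i) := fun i => by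
      rw [← mul_assoc, ← Real.sqrt_mul (mul_nonneg hr.le (hw i))]
    simp only [e1] at h
    have e2 : (∑ i, √(p * (1 - p) * w i * x i) * y (some i)) =
        ∑ i, inner ℝ (√(p * (1 - p) * w i * x i)) (y (some i)) :=
      Finset.sum_congr rfl fun i _ => by simp [mul_comm]
    rw [e2] at h
    simp only [Option.elim, inner_zero_left, zero_add, mul_one]
    refine h.trans (mul_le_mul_of_nonneg_left ?_ hr.le)
    refine le_add_of_nonneg_of_le (mul_self_nonneg _) (Finset.sum_le_sum fun i _ => ?_)
    rw [pow_two, mul_comm]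
  · rw [inner_diagOp_pow, Fintype.sum_option, ht, Finset.mul_sum]
    simp only [Option.elim, mul_zero, zero_mul, zero_add, Real.mul_self_sqrt (hnn _)]
    exact Finset.sum_congr rfl fun i _ => by ring

theorem IsCompact.convexHull_of_finiteDimensional {E : Type*} [NormedAddCommGroup E]
    [NormedSpace ℝ E] [FiniteDimensional ℝ E] {s : Set E} (hs : IsCompact s) :
    IsCompact (convexHull ℝ s) := by
  rcases s.eq_empty_or_nonempty with rfl | ⟨x₀, hx₀⟩
  · simp
  set N := Module.finrank ℝ E + 1
  have hK : convexHull ℝ s = (fun wz : (Fin N → ℝ) × (Fin N → E) => ∑ i, wz.1 i • wz.2 i) ''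
      (stdSimplex ℝ (Fin N) ×ˢ Set.univ.pi fun _ => s) := by
    ext y
    constructor
    · intro hy
      obtain ⟨ι, _, z, w, hz, hzi, hw, hw1, rfl⟩ := eq_pos_convex_span_of_mem_convexHull hy
      have hcard : Fintype.card ι ≤ Fintype.card (Fin N) := by
        rw [Fintype.card_fin]
        exact hzi.card_le_finrank_succ.trans
          (Nat.add_le_add_right (Submodule.finrank_le _) 1)
      obtain ⟨f⟩ := Function.Embedding.nonempty_of_card_le hcard
      refine ⟨(Function.extend f w 0, Function.extend f z fun _ => x₀), ⟨⟨fun j => ?_, ?_⟩,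
        fun j _ => ?_⟩, ?_⟩
      · by_cases hj : ∃ i, f i = j
        · obtain ⟨i, rfl⟩ := hj
          simpa [f.injective.extend_apply] using (hw i).le
        · simp [Function.extend_apply' _ _ _ hj]
      · rw [← hw1]
        symm
        refine Fintype.sum_of_injective f f.injective _ _ (fun j hj => ?_) fun i => ?_
        · exact Function.extend_apply' _ _ _ hj
        · exact (f.injective.extend_apply w 0 i).symm
      · by_cases hj : ∃ i, f i = j
        · obtain ⟨i, rfl⟩ := hj
          simpa [f.injective.extend_apply] using hz ⟨i, rfl⟩
        · simpa [Function.extend_apply' _ _ _ hj] using hx₀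
      · symm
        refine Fintype.sum_of_injective f f.injective _ _ (fun j hj => ?_) fun i => ?_
        · simp [Function.extend_apply' w (0 : Fin N → ℝ) j hj]
        · simp [f.injective.extend_apply]
    · rintro ⟨⟨w, z⟩, ⟨hw, hz⟩, rfl⟩
      exact mem_convexHull_of_exists_fintype w z hw.1 hw.2 (fun i => hz i trivial) rfl
  rw [hK]
  exact ((isCompact_stdSimplex ℝ (Fin N)).prod (isCompact_univ_pi fun _ => hs)).image
    (by fun_prop)

theorem isCompact_convexHull_momentCurve (n : ℕ) :
    IsCompact (convexHull ℝ
      ((fun (x : ℝ) (j : Fin n) => x ^ ((j : ℕ) + 1)) '' Set.Icc (0 : ℝ) 1)) :=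
  (isCompact_Icc.image (by fun_prop)).convexHull_of_finiteDimensional

theorem momentSpace_eq_convexHull (n : ℕ) :
    momentSpace n = convexHull ℝ
      ((fun (x : ℝ) (j : Fin n) => x ^ ((j : ℕ) + 1)) '' Set.Icc (0 : ℝ) 1) := by
  ext s
  constructor
  · rintro ⟨μ, _, hμ, hs⟩
    have hmem : ∀ᵐ x ∂μ, x ∈ Set.Icc (0 : ℝ) 1 := hμ
    have hint : Integrable (fun (x : ℝ) (j : Fin n) => x ^ ((j : ℕ) + 1)) μ := by
      refine Integrable.of_bound (Continuous.aestronglyMeasurable (by fun_prop)) 1 ?_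
      filter_upwards [hmem] with x hx
      refine (pi_norm_le_iff_of_nonneg zero_le_one).mpr fun j => ?_
      rw [norm_pow, Real.norm_of_nonneg hx.1]
      exact pow_le_one₀ hx.1 hx.2
    have hs' : s = ∫ x, (fun (j : Fin n) => x ^ ((j : ℕ) + 1)) ∂μ := by
      ext j
      rw [hs, eval_integral fun i => hint.eval i]
    rw [hs']
    refine (convex_convexHull ℝ _).integral_mem (isCompact_convexHull_momentCurve n).isClosed
      ?_ hint
    filter_upwards [hmem] with x hx
    exact subset_convexHull ℝ _ ⟨x, hx, rfl⟩
  · intro hs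
    obtain ⟨ι, _, w, z, hw, hw1, hz, rfl⟩ := mem_convexHull_iff_exists_fintype.mp hs
    choose x hx hxz using hz
    refine ⟨∑ i, ENNReal.ofReal (w i) • Measure.dirac (x i), ⟨?_⟩, ?_, fun j => ?_⟩
    · simp [← ENNReal.ofReal_sum_of_nonneg fun i _ => hw i, hw1]
    · simp only [Measure.coe_finsetSum, Finset.sum_apply, Measure.smul_apply, smul_eq_mul]
      refine Finset.sum_eq_zero fun i _ => ?_
      rw [Measure.dirac_apply' _ measurableSet_Icc.compl]
      simp [Set.mem_Icc.mp (hx i)]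
    · rw [integral_finsetSum_measure fun i _ =>
        (integrable_dirac (by simp)).smul_measure (by simp)]
      simp [integral_smul_measure, ← hxz, ENNReal.toReal_ofReal, hw]

theorem measurableSet_momentSpace (n : ℕ) : MeasurableSet (momentSpace n) := by
  rw [momentSpace_eq_convexHull]
  exact (isCompact_convexHull_momentCurve n).measurableSet

theorem mem_momentSpace_iff {n : ℕ} {s : Fin n → ℝ} :
    s ∈ momentSpace n ↔ ∃ σ, IsMomentSeq σ ∧ ∀ j : Fin n, s j = σ (j + 1) := by
  rw [momentSpace_eq_convexHull, mem_convexHull_iff_exists_fintype]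
  constructor
  · rintro ⟨ι, _, w, z, hw, hw1, hz, rfl⟩
    choose x hx hxz using hz
    exact ⟨_, ⟨ι, inferInstance, w, x, hw, hw1, hx, fun k => rfl⟩, fun j => by simp [← hxz]⟩
  · rintro ⟨σ, ⟨ι, _, w, x, hw, hw1, hx, hσ⟩, hs⟩
    refine ⟨ι, inferInstance, w, _, hw, hw1, fun i => ⟨x i, hx i, rfl⟩, ?_⟩
    ext j
    simp [hs, hσ]

theorem IsMomentSeq.one_mem_Icc {s : ℕ → ℝ} (hs : IsMomentSeq s) : s 1 ∈ Set.Icc (0 : ℝ) 1 := by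
  obtain ⟨ι, _, w, x, hw, hw1, hx, hs⟩ := hs
  simp only [hs, pow_one]
  refine ⟨Finset.sum_nonneg fun i _ => mul_nonneg (hw i) (hx i).1, ?_⟩
  rw [← hw1]
  exact Finset.sum_le_sum fun i _ => mul_le_of_le_one_right (hw i) (hx i).2

/-- The solution `s` of `IsCanonicalShift p s t`. -/
noncomputable def canonicalUnshift (p : ℝ) (t : ℕ → ℝ) : ℕ → ℝ
  | 0 => 1
  | k + 1 => p * (canonicalUnshift p t k +
      ∑ i : Fin k, (canonicalUnshift p t i - canonicalUnshift p t (i + 1)) * t (k - i))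

theorem canonicalUnshift_zero (p : ℝ) (t : ℕ → ℝ) : canonicalUnshift p t 0 = 1 := by
  rw [canonicalUnshift]

theorem canonicalUnshift_succ (p : ℝ) (t : ℕ → ℝ) (k : ℕ) :
    canonicalUnshift p t (k + 1) = p * (canonicalUnshift p t k + ∑ i ∈ Finset.range k,
      (canonicalUnshift p t i - canonicalUnshift p t (i + 1)) * t (k - i)) := by
  rw [canonicalUnshift, Finset.sum_range]

theorem IsCanonicalShift.eq_canonicalUnshift {p : ℝ} {s t : ℕ → ℝ} (h : IsCanonicalShift p s t)
    (k : ℕ) : s k = canonicalUnshift p t k := by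
  induction k using Nat.strong_induction_on with
  | _ k ih =>
    rcases k with _ | k
    · rw [h.1, canonicalUnshift_zero]
    · rw [h.2, canonicalUnshift_succ, ih k (by omega)]
      congr 2
      refine Finset.sum_congr rfl fun i hi => ?_
      have := Finset.mem_range.mp hi
      rw [ih i (by omega), ih (i + 1) (by omega)]

theorem canonicalUnshift_congr (p : ℝ) {t t' : ℕ → ℝ} {k : ℕ}
    (h : ∀ j, 1 ≤ j → j < k → t j = t' j) : canonicalUnshift p t k = canonicalUnshift p t' k := by
  induction k using Nat.strong_induction_on with
  | _ k ih =>
    rcases k with _ | k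
    · rw [canonicalUnshift_zero, canonicalUnshift_zero]
    · have ih' : ∀ i ≤ k, canonicalUnshift p t i = canonicalUnshift p t' i := fun i hi =>
        ih i (by omega) fun j hj hji => h j hj (by omega)
      rw [canonicalUnshift_succ, canonicalUnshift_succ, ih' k le_rfl]
      congr 2
      refine Finset.sum_congr rfl fun i hi => ?_
      have := Finset.mem_range.mp hi
      rw [ih' i (by omega), ih' (i + 1) (by omega), h (k - i) (by omega) (by omega)]

theorem canonicalUnshift_sub (p : ℝ) {t t' : ℕ → ℝ} {k : ℕ}
    (h : ∀ j, 1 ≤ j → j < k + 1 → t j = t' j) :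
    canonicalUnshift p t (k + 2) - canonicalUnshift p t' (k + 2) =
      p * (1 - p) * (t (k + 1) - t' (k + 1)) := by
  have h' : ∀ i ≤ k + 1, canonicalUnshift p t i = canonicalUnshift p t' i := fun i hi =>
    canonicalUnshift_congr p fun j hj hji => h j hj (by omega)
  have hsum : ∀ i ∈ Finset.range k,
      (canonicalUnshift p t (i + 1) - canonicalUnshift p t (i + 1 + 1)) * t (k + 1 - (i + 1)) =
      (canonicalUnshift p t' (i + 1) - canonicalUnshift p t' (i + 1 + 1)) *
        t' (k + 1 - (i + 1)) := by
    intro i hi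
    have := Finset.mem_range.mp hi
    rw [h' (i + 1) (by omega), h' (i + 1 + 1) (by omega), h (k + 1 - (i + 1)) (by omega) (by omega)]
  rw [canonicalUnshift_succ, canonicalUnshift_succ p t', Finset.sum_range_succ',
    Finset.sum_range_succ' _ k, Finset.sum_congr rfl hsum, h' (k + 1) le_rfl]
  have h1 : ∀ t, canonicalUnshift p t (0 + 1) = p := fun t => by
    rw [canonicalUnshift_succ]
    simp [canonicalUnshift_zero]
  simp only [h1, canonicalUnshift_zero, Nat.sub_zero]
  ring

/-- Extension of a vector of moments by zeros, the first coordinate having index `1`. -/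
def momentExtend {n : ℕ} (y : Fin n → ℝ) (k : ℕ) : ℝ :=
  if h : k - 1 < n then y ⟨k - 1, h⟩ else 0

theorem momentExtend_succ {n : ℕ} (y : Fin n → ℝ) (j : Fin n) :
    momentExtend y (j + 1) = y j := by
  simp [momentExtend]

/-- The parametrization by `momentSpace n` of the moment vectors in `momentSpace (n + 1)` with first
coordinate `p`, the first coordinate being dropped. -/
noncomputable def momentSlice (p : ℝ) {n : ℕ} (y : Fin n → ℝ) (j : Fin n) : ℝ :=
  canonicalUnshift p (momentExtend y) (j + 2)

theorem momentSlice_eq (p : ℝ) {n : ℕ} {y : Fin n → ℝ} {t : ℕ → ℝ}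
    (h : ∀ j : Fin n, y j = t (j + 1)) (j : Fin n) :
    momentSlice p y j = canonicalUnshift p t (j + 2) := by
  refine canonicalUnshift_congr p fun i hi hij => ?_
  obtain ⟨i, rfl⟩ := Nat.exists_eq_add_of_le' hi
  exact (momentExtend_succ y ⟨i, by omega⟩).trans (h ⟨i, by omega⟩)

theorem cons_mem_momentSpace_iff {n : ℕ} {p : ℝ} (hp : p ∈ Set.Ioo (0 : ℝ) 1) (y : Fin n → ℝ) :
    (Fin.cons p y : Fin (n + 1) → ℝ) ∈ momentSpace (n + 1) ↔
      y ∈ momentSlice p '' momentSpace n := by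
  simp only [Set.mem_image, mem_momentSpace_iff]
  constructor
  · rintro ⟨σ, hσ, hy⟩
    have h1 : p = σ 1 := by simpa using hy 0
    rw [h1] at hp ⊢
    obtain ⟨t, ht, hst⟩ := hσ.exists_isCanonicalShift hp
    refine ⟨fun j => t (j + 1), ⟨t, ht, fun j => rfl⟩, funext fun j => ?_⟩
    rw [momentSlice_eq _ fun j => rfl, ← hst.eq_canonicalUnshift]
    simpa using (hy j.succ).symm
  · rintro ⟨z, ⟨t, ht, hz⟩, rfl⟩
    obtain ⟨s, hs, hst⟩ := ht.exists_isCanonicalShift_of_mean hp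
    refine ⟨s, hs, fun j => ?_⟩
    refine Fin.cases ?_ (fun j => ?_) j
    · simpa [hst.1] using (hst.2 0).symm
    · rw [Fin.cons_succ, momentSlice_eq p hz, ← hst.eq_canonicalUnshift]
      simp

theorem momentSlice_sub (p : ℝ) {n : ℕ} {y z : Fin n → ℝ} {k : Fin n} (h : ∀ j < k, y j = z j) :
    momentSlice p y k - momentSlice p z k = p * (1 - p) * (y k - z k) := by
  rw [← momentExtend_succ y, ← momentExtend_succ z]
  refine canonicalUnshift_sub p fun i hi hik => ?_
  obtain ⟨i, rfl⟩ := Nat.exists_eq_add_of_le' hi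
  exact (momentExtend_succ y ⟨i, by omega⟩).trans
    ((h ⟨i, by omega⟩ (Fin.lt_def.mpr (by simpa using hik))).trans
      (momentExtend_succ z ⟨i, by omega⟩).symm)

theorem momentSlice_injective {p : ℝ} (hp : p ∈ Set.Ioo (0 : ℝ) 1) (n : ℕ) :
    Function.Injective (momentSlice p (n := n)) := by
  intro y z h
  ext k
  induction k using WellFoundedLT.induction with
  | _ k ih =>
    have hk := momentSlice_sub p ih
    rw [h, sub_self, zero_eq_mul] at hk
    exact sub_eq_zero.mp (hk.resolve_left (mul_pos hp.1 (sub_pos.mpr hp.2)).ne')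

theorem differentiable_momentSlice (p : ℝ) (n : ℕ) :
    Differentiable ℝ (momentSlice p (n := n)) := by
  have h : ∀ k, Differentiable ℝ fun y : Fin n → ℝ => canonicalUnshift p (momentExtend y) k := by
    intro k
    induction k using Nat.strong_induction_on with
    | _ k ih =>
      rcases k with _ | k
      · simp only [canonicalUnshift_zero]
        fun_prop
      · rw [funext fun y : Fin n → ℝ => canonicalUnshift_succ p (momentExtend y) k]
        refine ((ih k (by omega)).add (Differentiable.fun_sum fun i hi => ?_)).const_mul p
        have := Finset.mem_range.mp hi
        refine ((ih i (by omega)).sub (ih (i + 1) (by omega))).mul ?_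
        unfold momentExtend
        split_ifs <;> fun_prop
  exact differentiable_pi.mpr fun j => h _

/-- The Jacobian of a triangular map which is affine with slope `a` along the diagonal. -/
theorem det_fderiv_of_triangular {n : ℕ} {f : (Fin n → ℝ) → Fin n → ℝ} (hf : Differentiable ℝ f)
    {a : ℝ} (h : ∀ y z k, (∀ j < k, y j = z j) → f y k - f z k = a * (y k - z k))
    (y : Fin n → ℝ) : (fderiv ℝ f y).det = a ^ n := by
  have hentry : ∀ k j, k ≤ j →
      fderiv ℝ f y (Pi.single j 1) k = a * (Pi.single j 1 : Fin n → ℝ) k := by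
    intro k j hkj
    have h1 := hasDerivAt_pi.mp ((hf y).hasFDerivAt.hasLineDerivAt (Pi.single j 1)) k
    have h2 : HasDerivAt (fun r : ℝ => f (y + r • Pi.single j 1) k)
        (a * (Pi.single j 1 : Fin n → ℝ) k) 0 := by
      have h3 : (fun r : ℝ => f (y + r • Pi.single j 1) k) =
          fun r => f y k + r * (a * (Pi.single j 1 : Fin n → ℝ) k) := by
        funext r
        have := h (y + r • Pi.single j 1) y k fun i hi => by
          simp [Pi.single_eq_of_ne (hi.trans_le hkj).ne]
        rw [← sub_eq_iff_eq_add', this]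
        simp only [Pi.add_apply, Pi.smul_apply, smul_eq_mul]
        ring
      rw [h3]
      exact (hasDerivAt_mul_const _).const_add _
    exact h1.unique h2
  rw [ContinuousLinearMap.det, ← LinearMap.det_toMatrix', Matrix.det_of_isLowerTriangular]
  · simp [LinearMap.toMatrix'_apply, hentry]
  · intro i j hij
    have hij : i < j := by simpa using hij
    simp [LinearMap.toMatrix'_apply, hentry i j hij.le, Pi.single_eq_of_ne hij.ne]

theorem volume_momentSlice_image {p : ℝ} (hp : p ∈ Set.Ioo (0 : ℝ) 1) (n : ℕ) :
    volume (momentSlice p '' momentSpace n) =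
      ENNReal.ofReal ((p * (1 - p)) ^ n) * volume (momentSpace n) := by
  have hr : 0 ≤ (p * (1 - p)) ^ n := pow_nonneg (mul_nonneg hp.1.le (sub_nonneg.mpr hp.2.le)) n
  rw [← lintegral_abs_det_fderiv_eq_addHaar_image volume (measurableSet_momentSpace n)
    (fun y _ => (differentiable_momentSlice p n y).hasFDerivAt.hasFDerivWithinAt)
    (momentSlice_injective hp n).injOn]
  simp only [det_fderiv_of_triangular (differentiable_momentSlice p n)
    fun y z k => momentSlice_sub p, abs_of_nonneg hr]
  rw [setLIntegral_const]

theorem volume_momentSpace_succ (n : ℕ) :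
    volume (momentSpace (n + 1)) =
      ENNReal.ofReal (ProbabilityTheory.beta (n + 1) (n + 1)) * volume (momentSpace n) := by
  have hpos : (0 : ℝ) < n + 1 := by positivity
  have hβ := ProbabilityTheory.beta_pos hpos hpos
  have hmp := (volume_preserving_piFinSuccAbove (fun _ : Fin (n + 1) => ℝ) 0).symm
  have hcons : ∀ p y, (MeasurableEquiv.piFinSuccAbove (fun _ : Fin (n + 1) => ℝ) 0).symm (p, y) =
      (Fin.cons p y : Fin (n + 1) → ℝ) := fun p y => by
    simp [MeasurableEquiv.piFinSuccAbove, Fin.insertNthEquiv]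
  rw [← hmp.measure_preimage_equiv, Measure.volume_eq_prod,
    Measure.prod_apply ((MeasurableEquiv.measurable _) (measurableSet_momentSpace (n + 1)))]
  have hslice : ∀ᵐ p : ℝ, volume (Prod.mk p ⁻¹'
      ((MeasurableEquiv.piFinSuccAbove (fun _ : Fin (n + 1) => ℝ) 0).symm ⁻¹'
        momentSpace (n + 1))) = ProbabilityTheory.betaPDF (n + 1) (n + 1) p *
          (ENNReal.ofReal (ProbabilityTheory.beta (n + 1) (n + 1)) * volume (momentSpace n)) := by
    filter_upwards [Measure.ae_ne volume (0 : ℝ), Measure.ae_ne volume (1 : ℝ)] with p hp0 hp1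
    by_cases hp : p ∈ Set.Ioo (0 : ℝ) 1
    · have : Prod.mk p ⁻¹' ((MeasurableEquiv.piFinSuccAbove (fun _ : Fin (n + 1) => ℝ) 0).symm ⁻¹'
          momentSpace (n + 1)) = momentSlice p '' momentSpace n := by
        ext y
        rw [Set.mem_preimage, Set.mem_preimage, hcons, cons_mem_momentSpace_iff hp]
      rw [this, volume_momentSlice_image hp, ProbabilityTheory.betaPDF_of_pos_lt_one hp.1 hp.2,
        ← mul_assoc, ← ENNReal.ofReal_mul' hβ.le]
      congr 2
      rw [add_sub_cancel_right, Real.rpow_natCast, Real.rpow_natCast, mul_pow]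
      field_simp
    · have hempty : Prod.mk p ⁻¹' ((MeasurableEquiv.piFinSuccAbove
          (fun _ : Fin (n + 1) => ℝ) 0).symm ⁻¹' momentSpace (n + 1)) = ∅ := by
        refine Set.eq_empty_of_forall_notMem fun y hy => hp ?_
        rw [Set.mem_preimage, Set.mem_preimage, hcons, mem_momentSpace_iff] at hy
        obtain ⟨σ, hσ, hy⟩ := hy
        have h1 : p = σ 1 := by simpa using hy 0
        have h := hσ.one_mem_Icc
        rw [← h1] at h
        exact ⟨lt_of_le_of_ne h.1 hp0.symm, lt_of_le_of_ne h.2 hp1⟩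
      rw [hempty, measure_empty, ProbabilityTheory.betaPDF, ProbabilityTheory.betaPDFReal,
        if_neg (show ¬(0 < p ∧ p < 1) from hp)]
      simp
  rw [lintegral_congr_ae hslice, lintegral_mul_const _
    (show Measurable (ProbabilityTheory.betaPDF (n + 1) (n + 1)) from
      (ProbabilityTheory.measurable_betaPDFReal _ _).ennreal_ofReal),
    ProbabilityTheory.lintegral_betaPDF_eq_one hpos hpos, one_mul]

/-- The Lebesgue volume of the scalar `n`-th moment space equals `∏_{k=1}^n B(k,k)`,
where `B(a,b) = Γ(a)Γ(b)/Γ(a+b)` is the Euler Beta function. -/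
theorem volume_momentSpace (n : ℕ) :
    volume (momentSpace n) =
      ENNReal.ofReal (∏ k ∈ Finset.Icc 1 n,
        Real.Gamma k * Real.Gamma k / Real.Gamma (2 * k)) := by
  induction n with
  | zero =>
    have h : momentSpace 0 = Set.univ := by
      refine Set.eq_univ_of_forall fun s => ⟨Measure.dirac 0, inferInstance, ?_, finZeroElim⟩
      rw [Measure.dirac_apply' _ measurableSet_Icc.compl]
      simp
    rw [h, volume_pi, Measure.pi_of_empty]
    simp
  | succ n ih =>
    have hpos : (0 : ℝ) < n + 1 := by positivity
    rw [volume_momentSpace_succ, ih, Finset.prod_Icc_succ_top (by omega), mul_comm,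
      ENNReal.ofReal_mul' ?_]
    · rw [ProbabilityTheory.beta]
      push_cast
      rw [two_mul]
    · push_cast
      rw [two_mul]
      exact (ProbabilityTheory.beta_pos hpos hpos).le
end

section
/- In the scalar case (p=1), the map φ from ordinary moments (s₁,…,s_n) in the interior of the moment space of probability measures on [0,1] to canonical moments (u₁,…,u_n) ∈ (0,1)^n has Jacobian determinant ∏_{k=1}^{n-1} (u_k(1-u_k))^{-(n-k)}, where u_k = (s_k - s_k⁻)/(s_k⁺ - s_k⁻). -/
open MeasureTheory

/-- The set of possible `k`-th moments of a probability measure on `[0,1]`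
whose moments of order `1,…,k-1` are prescribed by `s`. -/
def kthMomentSet (k : ℕ) (s : ℕ → ℝ) : Set ℝ :=
  { t | ∃ μ : Measure ℝ, IsProbabilityMeasure μ ∧ μ (Set.Icc (0:ℝ) 1)ᶜ = 0 ∧
      (∀ j, 1 ≤ j → j < k → (∫ x, x ^ j ∂μ) = s j) ∧ (∫ x, x ^ k ∂μ) = t }

/-- The minimal possible `k`-th moment `s_k⁻` given the previous moments. -/
noncomputable def sMin (k : ℕ) (s : ℕ → ℝ) : ℝ := sInf (kthMomentSet k s)

/-- The maximal possible `k`-th moment `s_k⁺` given the previous moments. -/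
noncomputable def sMax (k : ℕ) (s : ℕ → ℝ) : ℝ := sSup (kthMomentSet k s)

/-- A vector `(s₁,…,s_n)` regarded as a sequence indexed by `ℕ` (with `s_j` in
position `j`). -/
def toSeq (n : ℕ) (s : Fin n → ℝ) : ℕ → ℝ :=
  fun j => if h : 1 ≤ j ∧ j ≤ n then s ⟨j - 1, by omega⟩ else 0

/-- The map `φ` from ordinary moments to canonical moments
`u_k = (s_k - s_k⁻)/(s_k⁺ - s_k⁻)`. -/
noncomputable def canMap (n : ℕ) (s : Fin n → ℝ) : Fin n → ℝ :=
  fun k => (s k - sMin ((k : ℕ) + 1) (toSeq n s)) /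
    (sMax ((k : ℕ) + 1) (toSeq n s) - sMin ((k : ℕ) + 1) (toSeq n s))

namespace CanonicalMoment

open Polynomial Set

/-- A linear functional on polynomials is positive up to degree `n` on `[0,1]`. -/
def PositiveUpTo (L : ℝ[X] →ₗ[ℝ] ℝ) (n : ℕ) : Prop :=
  ∀ P : ℝ[X], P ≠ 0 → P.natDegree ≤ n → (∀ x ∈ Icc (0:ℝ) 1, 0 ≤ P.eval x) → 0 < L P

theorem nonneg_or_nonpos_of_no_root {f : ℝ[X]} (hf : ∀ x ∈ Icc (0:ℝ) 1, f.eval x ≠ 0) :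
    (∀ x ∈ Icc (0:ℝ) 1, 0 ≤ f.eval x) ∨ (∀ x ∈ Icc (0:ℝ) 1, f.eval x ≤ 0) := by
  by_contra! h
  obtain ⟨⟨x, hx, hx0⟩, y, hy, hy0⟩ := h
  have hsub := (convex_Icc (0:ℝ) 1).isPreconnected.intermediate_value hx hy
    f.continuous.continuousOn
  obtain ⟨z, hz, hz0⟩ := hsub ⟨hx0.le, hy0.le⟩
  exact hf z hz hz0

section Orthogonal

variable {L : ℝ[X] →ₗ[ℝ] ℝ} {n : ℕ} {w g : ℝ[X]}

/-- An orthogonal polynomial for a positive functional has no factor of constant sign. -/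
theorem not_dvd_of_nonneg (hL : PositiveUpTo L n) (hw : w ≠ 0)
    (hw0 : ∀ x ∈ Icc (0:ℝ) 1, 0 ≤ w.eval x) (hg : g.Monic)
    (hn : w.natDegree + 2 * g.natDegree ≤ n)
    (horth : ∀ q : ℝ[X], q.degree < g.degree → L (w * g * q) = 0) {f : ℝ[X]}
    (hf : 0 < f.natDegree) (hf0 : ∀ x ∈ Icc (0:ℝ) 1, 0 ≤ f.eval x) : ¬ f ∣ g := by
  rintro ⟨h, rfl⟩
  have hne := hg.ne_zero
  have hf1 : f ≠ 0 := left_ne_zero_of_mul hne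
  have hh1 : h ≠ 0 := right_ne_zero_of_mul hne
  have hdeg : (f * h).natDegree = f.natDegree + h.natDegree := natDegree_mul hf1 hh1
  have h0 := horth h (by
    rw [degree_eq_natDegree hh1, degree_eq_natDegree hne, hdeg]
    exact_mod_cast (by omega))
  refine (hL (w * (f * h) * h) ?_ ?_ ?_).ne' h0
  · exact mul_ne_zero (mul_ne_zero hw hne) hh1
  · rw [natDegree_mul (mul_ne_zero hw hne) hh1, natDegree_mul hw hne]
    omega
  · intro x hx
    have := mul_nonneg (mul_nonneg (hw0 x hx) (hf0 x hx)) (mul_self_nonneg (h.eval x))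
    simp only [eval_mul]
    linarith

theorem not_dvd_of_nonpos (hL : PositiveUpTo L n) (hw : w ≠ 0)
    (hw0 : ∀ x ∈ Icc (0:ℝ) 1, 0 ≤ w.eval x) (hg : g.Monic)
    (hn : w.natDegree + 2 * g.natDegree ≤ n)
    (horth : ∀ q : ℝ[X], q.degree < g.degree → L (w * g * q) = 0) {f : ℝ[X]}
    (hf : 0 < f.natDegree) (hf0 : ∀ x ∈ Icc (0:ℝ) 1, f.eval x ≤ 0) : ¬ f ∣ g := by
  rw [← neg_dvd]
  refine not_dvd_of_nonneg hL hw hw0 hg hn horth (by rwa [natDegree_neg]) fun x hx => ?_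
  simpa using hf0 x hx

theorem splits_of_orthogonal (hL : PositiveUpTo L n) (hw : w ≠ 0)
    (hw0 : ∀ x ∈ Icc (0:ℝ) 1, 0 ≤ w.eval x) (hg : g.Monic)
    (hn : w.natDegree + 2 * g.natDegree ≤ n)
    (horth : ∀ q : ℝ[X], q.degree < g.degree → L (w * g * q) = 0) : g.Splits := by
  obtain ⟨v, hv⟩ := UniqueFactorizationMonoid.factors_prod hg.ne_zero
  suffices h : ∀ f : ℝ[X], Irreducible f → f ∣ g → f.degree = 1 by
    rw [← hv]
    refine (Splits.multisetProd fun f hf => ?_).mul v.isUnit.splits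
    exact Splits.of_degree_eq_one (h f (UniqueFactorizationMonoid.irreducible_of_factor f hf)
      (UniqueFactorizationMonoid.dvd_of_mem_factors hf))
  intro f hf hfg
  by_contra hdeg
  have hroot : ∀ x ∈ Icc (0:ℝ) 1, f.eval x ≠ 0 := fun x _ hx =>
    hdeg (degree_eq_one_of_irreducible_of_root hf hx)
  rcases nonneg_or_nonpos_of_no_root hroot with h | h
  · exact not_dvd_of_nonneg hL hw hw0 hg hn horth hf.natDegree_pos h hfg
  · exact not_dvd_of_nonpos hL hw hw0 hg hn horth hf.natDegree_pos h hfg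

theorem roots_nodup_of_orthogonal (hL : PositiveUpTo L n) (hw : w ≠ 0)
    (hw0 : ∀ x ∈ Icc (0:ℝ) 1, 0 ≤ w.eval x) (hg : g.Monic)
    (hn : w.natDegree + 2 * g.natDegree ≤ n)
    (horth : ∀ q : ℝ[X], q.degree < g.degree → L (w * g * q) = 0) : g.roots.Nodup := by
  classical
  rw [Multiset.nodup_iff_count_le_one]
  intro z
  rw [count_roots]
  by_contra! h
  refine not_dvd_of_nonneg hL hw hw0 hg hn horth (f := (X - C z) ^ 2) ?_ (fun x _ => ?_)
    ((le_rootMultiplicity_iff hg.ne_zero).1 h)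
  · rw [natDegree_pow, natDegree_X_sub_C]; norm_num
  · simpa using sq_nonneg (x - z)

theorem root_mem_Ioo_of_orthogonal (hL : PositiveUpTo L n) (hw : w ≠ 0)
    (hw0 : ∀ x ∈ Icc (0:ℝ) 1, 0 ≤ w.eval x) (hg : g.Monic)
    (hn : w.natDegree + 2 * g.natDegree ≤ n)
    (horth : ∀ q : ℝ[X], q.degree < g.degree → L (w * g * q) = 0) {z : ℝ}
    (hz : g.eval z = 0) : z ∈ Ioo (0:ℝ) 1 := by
  have hdvd : (X - C z) ∣ g := dvd_iff_isRoot.2 hz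
  have hdeg : 0 < (X - C z).natDegree := by rw [natDegree_X_sub_C]; norm_num
  constructor <;> by_contra! h
  · refine not_dvd_of_nonneg hL hw hw0 hg hn horth hdeg (fun x hx => ?_) hdvd
    have := hx.1
    simp only [eval_sub, eval_X, eval_C]; linarith
  · refine not_dvd_of_nonpos hL hw hw0 hg hn horth hdeg (fun x hx => ?_) hdvd
    have := hx.2
    simp only [eval_sub, eval_X, eval_C]; linarith

end Orthogonal

/-- The weight `x ^ a * (1 - x) ^ b`. -/
noncomputable def weight (a b : ℕ) : ℝ[X] := X ^ a * (1 - X) ^ b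

theorem one_sub_X_eq : (1 - X : ℝ[X]) = -(X - C 1) := by simp

theorem natDegree_one_sub_X : (1 - X : ℝ[X]).natDegree = 1 := by
  rw [one_sub_X_eq, natDegree_neg, natDegree_X_sub_C]

theorem one_sub_X_ne_zero : (1 - X : ℝ[X]) ≠ 0 := by
  rw [one_sub_X_eq]
  exact neg_ne_zero.2 (X_sub_C_ne_zero 1)

theorem weight_ne_zero (a b : ℕ) : weight a b ≠ 0 :=
  mul_ne_zero (pow_ne_zero _ X_ne_zero) (pow_ne_zero _ one_sub_X_ne_zero)

theorem natDegree_weight (a b : ℕ) : (weight a b).natDegree = a + b := by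
  rw [weight, natDegree_mul (pow_ne_zero _ X_ne_zero) (pow_ne_zero _ one_sub_X_ne_zero),
    natDegree_pow, natDegree_pow, natDegree_X, natDegree_one_sub_X, mul_one, mul_one]

theorem eval_weight (a b : ℕ) (x : ℝ) : (weight a b).eval x = x ^ a * (1 - x) ^ b := by
  simp [weight]

theorem weight_nonneg (a b : ℕ) {x : ℝ} (hx : x ∈ Icc (0:ℝ) 1) : 0 ≤ (weight a b).eval x := by
  rw [eval_weight]
  exact mul_nonneg (pow_nonneg hx.1 _) (pow_nonneg (by linarith [hx.2]) _)

theorem weight_pos (a b : ℕ) {x : ℝ} (hx : x ∈ Ioo (0:ℝ) 1) : 0 < (weight a b).eval x := by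
  rw [eval_weight]
  exact mul_pos (pow_pos hx.1 _) (pow_pos (by linarith [hx.2]) _)

theorem splits_weight (a b : ℕ) : (weight a b).Splits := by
  rw [weight, one_sub_X_eq]
  exact (Splits.X.pow _).mul ((Splits.X_sub_C 1).neg.pow _)

theorem roots_weight (a b : ℕ) :
    (weight a b).roots = Multiset.replicate a 0 + Multiset.replicate b 1 := by
  rw [weight, roots_mul (weight_ne_zero a b), roots_pow, roots_pow, roots_X, one_sub_X_eq,
    roots_neg, roots_X_sub_C, Multiset.nsmul_singleton, Multiset.nsmul_singleton]

theorem nodup_roots_weight {a b : ℕ} (ha : a ≤ 1) (hb : b ≤ 1) : (weight a b).roots.Nodup := by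
  rw [roots_weight]
  interval_cases a <;> interval_cases b <;> simp

section Quadrature

variable {L : ℝ[X] →ₗ[ℝ] ℝ} {n a b : ℕ} {g : ℝ[X]}

/-- For each node there is a nonnegative test polynomial of low degree vanishing exactly at the
other nodes. -/
theorem exists_test_polynomial (ha : a ≤ 1) (hb : b ≤ 1) (hg : g.Monic)
    (hgroots : ∀ z, g.eval z = 0 → z ∈ Ioo (0:ℝ) 1) (hnodup : g.roots.Nodup) {z : ℝ}
    (hz : (weight a b * g).eval z = 0) :
    ∃ P : ℝ[X], P.natDegree < a + b + 2 * g.natDegree ∧ (∀ x ∈ Icc (0:ℝ) 1, 0 ≤ P.eval x) ∧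
      0 < P.eval z ∧ ∀ y, (weight a b * g).eval y = 0 → y ≠ z → P.eval y = 0 := by
  classical
  rw [eval_mul, mul_eq_zero] at hz
  by_cases hgz : g.eval z = 0
  · obtain ⟨h, hh⟩ := dvd_iff_isRoot.2 hgz
    have hh0 : h ≠ 0 := by rintro rfl; exact hg.ne_zero (by simpa using hh)
    have hdeg : g.natDegree = 1 + h.natDegree := by
      rw [hh, natDegree_mul (X_sub_C_ne_zero z) hh0, natDegree_X_sub_C]
    have hhz : h.eval z ≠ 0 := by
      intro h0
      obtain ⟨k, hk⟩ := dvd_iff_isRoot.2 h0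
      have h2 : (X - C z) ^ 2 ∣ g := ⟨k, by rw [hh, hk]; ring⟩
      have h3 := (le_rootMultiplicity_iff hg.ne_zero).2 h2
      have h4 := Multiset.nodup_iff_count_le_one.1 hnodup z
      rw [count_roots] at h4
      omega
    refine ⟨weight a b * h ^ 2, ?_, fun x hx => ?_, ?_, fun y hy hyz => ?_⟩
    · rw [natDegree_mul (weight_ne_zero a b) (pow_ne_zero 2 hh0), natDegree_weight, natDegree_pow]
      omega
    · rw [eval_mul, eval_pow]
      exact mul_nonneg (weight_nonneg a b hx) (sq_nonneg _)
    · rw [eval_mul, eval_pow]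
      exact mul_pos (weight_pos a b (hgroots z hgz)) (by positivity)
    · rw [hh] at hy
      simp only [eval_mul, eval_sub, eval_X, eval_C, mul_eq_zero, sub_eq_zero] at hy
      rw [eval_mul, eval_pow]
      rcases hy with hy | hy | hy
      · rw [hy, zero_mul]
      · exact absurd hy hyz
      · rw [hy]; ring
  · have hwz := hz.resolve_right hgz
    suffices H : ∃ a' b', a' + b' < a + b ∧ 0 < (weight a' b').eval z ∧
        ∀ y, (weight a b).eval y = 0 → y ≠ z → (weight a' b').eval y = 0 by
      obtain ⟨a', b', hlt, hpos, hv⟩ := H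
      refine ⟨weight a' b' * g ^ 2, ?_, fun x hx => ?_, ?_, fun y hy hyz => ?_⟩
      · rw [natDegree_mul (weight_ne_zero _ _) (pow_ne_zero 2 hg.ne_zero), natDegree_weight,
          natDegree_pow]
        omega
      · rw [eval_mul, eval_pow]
        exact mul_nonneg (weight_nonneg _ _ hx) (sq_nonneg _)
      · rw [eval_mul, eval_pow]
        exact mul_pos hpos (by positivity)
      · rw [eval_mul, mul_eq_zero] at hy
        rw [eval_mul, eval_pow]
        rcases hy with hy | hy
        · rw [hv y hy hyz, zero_mul]
        · rw [hy]; ring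
    simp only [eval_weight] at hwz ⊢
    rcases mul_eq_zero.1 hwz with h | h
    · obtain ⟨rfl, ha0⟩ := pow_eq_zero_iff'.1 h
      refine ⟨0, b, by omega, by simp, fun y hy hy0 => ?_⟩
      have := (mul_eq_zero.1 hy).resolve_left (pow_ne_zero _ hy0)
      rw [this, mul_zero]
    · obtain ⟨h1, hb0⟩ := pow_eq_zero_iff'.1 h
      obtain rfl : z = 1 := by linarith
      refine ⟨a, 0, by omega, by simp, fun y hy hy0 => ?_⟩
      have := (mul_eq_zero.1 hy).resolve_right (pow_ne_zero _ (sub_ne_zero.2 (Ne.symm hy0)))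
      rw [this, zero_mul]

/-- Gauss-type quadrature: the functional is represented, up to degree one less than that of
`weight a b * g ^ 2`, by a measure supported on the zeros of that polynomial. -/
theorem exists_quadrature (hL1 : L 1 = 1) (hL : PositiveUpTo L n) (ha : a ≤ 1) (hb : b ≤ 1)
    (hg : g.Monic) (hn : a + b + 2 * g.natDegree ≤ n) (hpos : 0 < a + b + 2 * g.natDegree)
    (horth : ∀ q : ℝ[X], q.degree < g.degree → L (weight a b * g * q) = 0) :
    ∃ μ : Measure ℝ, IsProbabilityMeasure μ ∧ μ (Icc (0:ℝ) 1)ᶜ = 0 ∧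
      (∀ q : ℝ[X], q.natDegree < a + b + 2 * g.natDegree → ∫ x, q.eval x ∂μ = L q) ∧
      ∫ x, (weight a b * g ^ 2).eval x ∂μ = 0 := by
  classical
  have hw := weight_ne_zero a b
  have hw0 : ∀ x ∈ Icc (0:ℝ) 1, 0 ≤ (weight a b).eval x := fun x => weight_nonneg a b
  have hn' : (weight a b).natDegree + 2 * g.natDegree ≤ n := by rwa [natDegree_weight]
  have hroots : ∀ z, g.eval z = 0 → z ∈ Ioo (0:ℝ) 1 := fun z =>
    root_mem_Ioo_of_orthogonal hL hw hw0 hg hn' horth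
  have hgnodup := roots_nodup_of_orthogonal hL hw hw0 hg hn' horth
  set N := weight a b * g with hN
  have hN0 : N ≠ 0 := mul_ne_zero hw hg.ne_zero
  have hNnodup : N.roots.Nodup := by
    rw [hN, roots_mul hN0, Multiset.nodup_add]
    refine ⟨nodup_roots_weight ha hb, hgnodup, Multiset.disjoint_left.2 fun {z} hz hz' => ?_⟩
    exact (weight_pos a b (hroots z (isRoot_of_mem_roots hz'))).ne' (isRoot_of_mem_roots hz)
  set Z := N.roots.toFinset with hZ
  have hmemZ : ∀ z, z ∈ Z ↔ N.eval z = 0 := fun z => by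
    rw [hZ, Multiset.mem_toFinset, mem_roots hN0, IsRoot]
  have hcard : N.natDegree = Z.card := by
    rw [((splits_weight a b).mul (splits_of_orthogonal hL hw hw0 hg hn' horth)
      ).natDegree_eq_card_roots, hZ, Multiset.toFinset_card_of_nodup hNnodup]
  have hNdeg : N.natDegree = a + b + g.natDegree := by
    rw [hN, natDegree_mul hw hg.ne_zero, natDegree_weight]
  have hZIcc : ∀ z ∈ Z, z ∈ Icc (0:ℝ) 1 := by
    intro z hz
    have h := (hmemZ z).1 hz
    rw [hN, eval_mul, mul_eq_zero] at h
    rcases h with h | h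
    · rw [eval_weight, mul_eq_zero] at h
      rcases h with h | h
      · rw [(pow_eq_zero_iff'.1 h).1]; simp
      · have := (pow_eq_zero_iff'.1 h).1
        have : z = 1 := by linarith
        rw [this]; simp
    · exact Ioo_subset_Icc_self (hroots z h)
  set lam : ℝ → ℝ := fun z => L (Lagrange.basis Z id z) with hlam
  have hexact : ∀ q : ℝ[X], q.natDegree < a + b + 2 * g.natDegree →
      L q = ∑ z ∈ Z, lam z * q.eval z := by
    intro q hq
    have hdiv : q = N * (q / N) + q % N := (EuclideanDomain.div_add_mod q N).symm
    have h1 : L (N * (q / N)) = 0 := by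
      by_cases hzero : q / N = 0
      · rw [hzero, mul_zero, map_zero]
      apply horth
      have hlt : N.degree ≤ q.degree := by
        by_contra! hlt
        exact hzero ((Polynomial.div_eq_zero_iff hN0).2 hlt)
      have hadd := degree_add_div hN0 hlt
      have hq0 : q ≠ 0 := by rintro rfl; simp at hzero
      rw [degree_eq_natDegree hN0, degree_eq_natDegree hq0, degree_eq_natDegree hzero] at hadd
      rw [degree_eq_natDegree hzero, degree_eq_natDegree hg.ne_zero]
      norm_cast at hadd ⊢
      omega
    have h2 : q % N = Lagrange.interpolate Z id fun z => q.eval z := by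
      refine Lagrange.eq_interpolate_of_eval_eq _ Function.injective_id.injOn ?_ fun z hz => ?_
      · rw [← hcard, ← degree_eq_natDegree hN0]
        exact degree_mod_lt q hN0
      · conv_rhs => rw [hdiv]
        rw [eval_add, eval_mul, (hmemZ z).1 hz, zero_mul, zero_add, id]
    conv_lhs => rw [hdiv]
    rw [map_add, h1, zero_add, h2, Lagrange.interpolate_apply, map_sum]
    refine Finset.sum_congr rfl fun z _ => ?_
    rw [← smul_eq_C_mul, map_smul, smul_eq_mul, mul_comm]
  have hlam0 : ∀ z ∈ Z, 0 ≤ lam z := by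
    intro z hz
    obtain ⟨P, hPdeg, hP0, hPz, hPy⟩ :=
      exists_test_polynomial ha hb hg hroots hgnodup ((hmemZ z).1 hz)
    have h1 := hexact P hPdeg
    rw [Finset.sum_eq_single_of_mem z hz fun y hy hyz => by
      rw [hPy y ((hmemZ y).1 hy) hyz, mul_zero]] at h1
    have hPne : P ≠ 0 := by rintro rfl; simp at hPz
    have h2 := hL P hPne (by omega) hP0
    rw [h1] at h2
    exact (pos_of_mul_pos_left h2 hPz.le).le
  set μ : Measure ℝ := ∑ z ∈ Z, ENNReal.ofReal (lam z) • Measure.dirac z with hμ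
  have h_integral : ∀ f : ℝ → ℝ, ∫ x, f x ∂μ = ∑ z ∈ Z, lam z * f z := by
    intro f
    rw [hμ, integral_finsetSum_measure]
    · refine Finset.sum_congr rfl fun z hz => ?_
      rw [integral_smul_measure, integral_dirac, ENNReal.toReal_ofReal (hlam0 z hz), smul_eq_mul]
    · intro z _
      exact (integrable_dirac (by simp)).smul_measure ENNReal.ofReal_ne_top
  refine ⟨μ, ⟨?_⟩, ?_, fun q hq => ?_, ?_⟩
  · have h1 := hexact 1 (by simpa using hpos)
    rw [hL1] at h1
    simp only [eval_one, mul_one] at h1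
    rw [hμ, Measure.coe_finsetSum, Finset.sum_apply]
    simp only [Measure.smul_apply, measure_univ, smul_eq_mul, mul_one]
    rw [← ENNReal.ofReal_sum_of_nonneg hlam0, ← h1, ENNReal.ofReal_one]
  · rw [hμ, Measure.coe_finsetSum, Finset.sum_apply]
    refine Finset.sum_eq_zero fun z hz => ?_
    rw [Measure.smul_apply, Measure.dirac_apply' _ measurableSet_Icc.compl,
      Set.indicator_of_notMem (by simpa using hZIcc z hz), smul_zero]
  · rw [h_integral, hexact q hq]
  · rw [h_integral]
    refine Finset.sum_eq_zero fun z hz => ?_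
    have : weight a b * g ^ 2 = N * g := by rw [hN]; ring
    rw [this, eval_mul, (hmemZ z).1 hz, zero_mul, mul_zero]

end Quadrature

/-- The monic orthogonal polynomials for the weights `weight ((i + 1) % 2) 0` and
`weight (i % 2) 1`, together with the mixing coefficient used to pass to the next pair. -/
noncomputable def orthoPair (L : ℝ[X] →ₗ[ℝ] ℝ) : ℕ → ℝ[X] × ℝ[X]
  | 0 => (1, 1)
  | i + 1 =>
    let g := (orthoPair L i).1
    let h := (orthoPair L i).2
    let u := L (weight ((i + 1) % 2) 0 * g ^ 2) /
      (L (weight ((i + 1) % 2) 0 * g ^ 2) + L (weight (i % 2) 1 * h ^ 2))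
    (C (1 - u) * (X ^ ((i + 1) % 2) * g) + C u * ((X - 1) * h),
      C (1 - u) * g + C u * (X ^ (i % 2) * h))

section OrthoPair

variable (L : ℝ[X] →ₗ[ℝ] ℝ)

/-- The squared norm of the first member of the pair: the excess over the minimal moment. -/
noncomputable def lowerGap (i : ℕ) : ℝ := L (weight ((i + 1) % 2) 0 * (orthoPair L i).1 ^ 2)

/-- The squared norm of the second member of the pair: the deficit to the maximal moment. -/
noncomputable def upperGap (i : ℕ) : ℝ := L (weight (i % 2) 1 * (orthoPair L i).2 ^ 2)

/-- The canonical moment expressed through the two gaps. -/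
noncomputable def canCoeff (i : ℕ) : ℝ := lowerGap L i / (lowerGap L i + upperGap L i)

theorem orthoPair_succ_fst (i : ℕ) : (orthoPair L (i + 1)).1 =
    C (1 - canCoeff L i) * (X ^ ((i + 1) % 2) * (orthoPair L i).1) +
      C (canCoeff L i) * ((X - 1) * (orthoPair L i).2) := rfl

theorem orthoPair_succ_snd (i : ℕ) : (orthoPair L (i + 1)).2 =
    C (1 - canCoeff L i) * (orthoPair L i).1 +
      C (canCoeff L i) * (X ^ (i % 2) * (orthoPair L i).2) := rfl

theorem monic_affine_comb {p q : ℝ[X]} {d : ℕ} (hp : p.Monic) (hq : q.Monic)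
    (hpd : p.natDegree = d) (hqd : q.natDegree = d) (u : ℝ) :
    (C (1 - u) * p + C u * q).Monic ∧ (C (1 - u) * p + C u * q).natDegree = d := by
  have hcoeff : (C (1 - u) * p + C u * q).coeff d = 1 := by
    have h1 : p.coeff d = 1 := by rw [← hpd]; exact hp
    have h2 : q.coeff d = 1 := by rw [← hqd]; exact hq
    rw [coeff_add, coeff_C_mul, coeff_C_mul, h1, h2]
    ring
  have hle : (C (1 - u) * p + C u * q).natDegree ≤ d :=
    natDegree_add_le_of_degree_le ((natDegree_C_mul_le _ _).trans hpd.le)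
      ((natDegree_C_mul_le _ _).trans hqd.le)
  exact ⟨monic_of_natDegree_le_of_coeff_eq_one d hle hcoeff,
    le_antisymm hle (le_natDegree_of_ne_zero (by rw [hcoeff]; exact one_ne_zero))⟩

theorem monic_X_sub_one : (X - 1 : ℝ[X]).Monic := by
  simpa using monic_X_sub_C (1 : ℝ)

theorem natDegree_X_sub_one : (X - 1 : ℝ[X]).natDegree = 1 := by
  simpa using natDegree_X_sub_C (1 : ℝ)

theorem orthoPair_monic (i : ℕ) :
    ((orthoPair L i).1.Monic ∧ (orthoPair L i).1.natDegree = (i + 1) / 2) ∧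
      (orthoPair L i).2.Monic ∧ (orthoPair L i).2.natDegree = i / 2 := by
  induction i with
  | zero => simp [orthoPair, monic_one]
  | succ i ih =>
    obtain ⟨⟨hg, hgd⟩, hh, hhd⟩ := ih
    refine ⟨monic_affine_comb ((monic_X_pow _).mul hg) (monic_X_sub_one.mul hh) ?_ ?_ _,
      monic_affine_comb hg ((monic_X_pow _).mul hh) ?_ ?_ _⟩
    · rw [(monic_X_pow _).natDegree_mul hg, natDegree_X_pow, hgd]; omega
    · rw [monic_X_sub_one.natDegree_mul hh, natDegree_X_sub_one, hhd]; omega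
    · rw [hgd]
    · rw [(monic_X_pow _).natDegree_mul hh, natDegree_X_pow, hhd]; omega

variable {L}

/-- Orthogonality determines the functional on polynomials of the critical degree. -/
theorem apply_of_orthogonal {w g : ℝ[X]} {d : ℕ} (hg : g.Monic) (hd : g.natDegree = d)
    (horth : ∀ q : ℝ[X], q.degree < g.degree → L (w * g * q) = 0) {q : ℝ[X]}
    (hq : q.natDegree ≤ d) : L (w * g * q) = q.coeff d * L (w * g ^ 2) := by
  have hgd : g.coeff d = 1 := by rw [← hd]; exact hg
  have h1 : (q - C (q.coeff d) * g).degree < g.degree := by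
    rw [degree_eq_natDegree hg.ne_zero, hd, degree_lt_iff_coeff_zero]
    intro m hm
    rcases hm.eq_or_lt with rfl | hm
    · simp [hgd]
    · simp [coeff_eq_zero_of_natDegree_lt (hq.trans_lt hm),
        coeff_eq_zero_of_natDegree_lt (hd.le.trans_lt hm)]
  have h2 := horth _ h1
  have h3 : w * g * q = w * g * (q - C (q.coeff d) * g) + q.coeff d • (w * g ^ 2) := by
    rw [smul_eq_C_mul]; ring
  rw [h3, map_add, h2, map_smul, zero_add, smul_eq_mul]

theorem X_pow_mul_X_pow (i : ℕ) : (X ^ ((i + 1) % 2) * X ^ (i % 2) : ℝ[X]) = X := by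
  rw [← pow_add, show (i + 1) % 2 + i % 2 = 1 by omega, pow_one]

theorem weight_zero_right (a : ℕ) : weight a 0 = X ^ a := by simp [weight]

theorem weight_one_right (a : ℕ) : weight a 1 = X ^ a * (1 - X) := by simp [weight]

theorem mod_two_add_two (i : ℕ) : (i + 1 + 1) % 2 = i % 2 := by omega

theorem orthoPair_orthogonal (i : ℕ) (hne : ∀ j < i, lowerGap L j + upperGap L j ≠ 0) :
    (∀ q : ℝ[X], q.degree < (orthoPair L i).1.degree →
      L (weight ((i + 1) % 2) 0 * (orthoPair L i).1 * q) = 0) ∧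
    (∀ q : ℝ[X], q.degree < (orthoPair L i).2.degree →
      L (weight (i % 2) 1 * (orthoPair L i).2 * q) = 0) := by
  induction i with
  | zero =>
    simp only [orthoPair, degree_one]
    constructor <;> intro q hq <;> rw [degree_eq_bot.1 (Nat.WithBot.lt_zero_iff.1 hq)] <;> simp
  | succ i ih =>
    obtain ⟨ihg, ihh⟩ := ih fun j hj => hne j (by omega)
    obtain ⟨⟨hg, hgd⟩, hh, hhd⟩ := orthoPair_monic L i
    obtain ⟨⟨hg', hgd'⟩, hh', hhd'⟩ := orthoPair_monic L (i + 1)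
    have hA := fun q => apply_of_orthogonal (q := q) hg hgd ihg
    have hB := fun q => apply_of_orthogonal (q := q) hh hhd ihh
    have hu : (1 - canCoeff L i) * lowerGap L i = canCoeff L i * upperGap L i := by
      have := hne i (by omega)
      rw [canCoeff]; field_simp; ring
    have hX := X_pow_mul_X_pow i
    rw [degree_eq_natDegree hg'.ne_zero, degree_eq_natDegree hh'.ne_zero, hgd', hhd',
      orthoPair_succ_fst, orthoPair_succ_snd, mod_two_add_two]
    change (1 - canCoeff L i) * L (_ * _) = canCoeff L i * L (_ * _) at hu
    rw [weight_zero_right, weight_one_right] at *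
    generalize (orthoPair L i).1 = g at *
    generalize (orthoPair L i).2 = h at *
    generalize canCoeff L i = u at *
    constructor <;> intro q hq
    · have hqd : q.natDegree ≤ i / 2 := by
        rw [natDegree_le_iff_coeff_eq_zero]
        exact fun m hm => (degree_lt_iff_coeff_zero _ _).1 hq m (by omega)
      have e : X ^ (i % 2) * (C (1 - u) * (X ^ ((i + 1) % 2) * g) + C u * ((X - 1) * h)) * q =
          (1 - u) • (X ^ ((i + 1) % 2) * g * (X ^ (i % 2) * q)) -
            u • (X ^ (i % 2) * (1 - X) * h * q) := by
        rw [smul_eq_C_mul, smul_eq_C_mul]; ring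
      have hc : (X ^ (i % 2) * q).coeff ((i + 1) / 2) = q.coeff (i / 2) := by
        rw [show (i + 1) / 2 = i / 2 + i % 2 by omega, coeff_X_pow_mul]
      rw [e, map_sub, map_smul, map_smul, hA _ ?_, hB _ hqd, hc]
      · simp only [smul_eq_mul]; linear_combination q.coeff (i / 2) * hu
      · refine natDegree_mul_le.trans ?_
        rw [natDegree_X_pow]; omega
    · by_cases hi : i = 0
      · subst hi
        have : q = 0 := degree_eq_bot.1 (Nat.WithBot.lt_zero_iff.1 (by simpa using hq))
        rw [this]; simp
      obtain ⟨k, hk⟩ : ∃ k, (i + 1) / 2 = k + 1 := ⟨(i + 1) / 2 - 1, by omega⟩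
      have hqd : q.natDegree ≤ k := by
        rw [natDegree_le_iff_coeff_eq_zero]
        exact fun m hm => (degree_lt_iff_coeff_zero _ _).1 hq m (by omega)
      have e : X ^ ((i + 1) % 2) * (1 - X) * (C (1 - u) * g + C u * (X ^ (i % 2) * h)) * q =
          (1 - u) • (X ^ ((i + 1) % 2) * g * ((1 - X) * q)) +
            u • (X ^ (i % 2) * (1 - X) * h * (X ^ ((i + 1) % 2) * q)) := by
        rw [smul_eq_C_mul, smul_eq_C_mul]; ring
      have hc : (X ^ ((i + 1) % 2) * q).coeff (i / 2) = q.coeff k := by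
        rw [show i / 2 = k + (i + 1) % 2 by omega, coeff_X_pow_mul]
      have hc' : ((1 - X) * q).coeff ((i + 1) / 2) = -q.coeff k := by
        rw [hk, sub_mul, one_mul, coeff_sub, coeff_X_mul,
          coeff_eq_zero_of_natDegree_lt (hqd.trans_lt (Nat.lt_succ_self k)), zero_sub]
      rw [e, map_add, map_smul, map_smul, hA _ ?_, hB _ ?_, hc, hc']
      · simp only [smul_eq_mul]; linear_combination -q.coeff k * hu
      · refine natDegree_mul_le.trans ?_
        rw [natDegree_X_pow]; omega
      · refine natDegree_mul_le.trans ?_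
        rw [natDegree_one_sub_X]; omega

/-- The recursion for the width of the range of the next moment. -/
theorem lowerGap_add_upperGap_succ (i : ℕ) (hne : ∀ j ≤ i, lowerGap L j + upperGap L j ≠ 0) :
    lowerGap L (i + 1) + upperGap L (i + 1) = (1 - canCoeff L i) * lowerGap L i := by
  obtain ⟨og, -⟩ := orthoPair_orthogonal (L := L) i fun j hj => hne j hj.le
  obtain ⟨og', oh'⟩ := orthoPair_orthogonal (L := L) (i + 1) fun j hj => hne j (by omega)
  obtain ⟨⟨hg, hgd⟩, hh, hhd⟩ := orthoPair_monic L i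
  obtain ⟨⟨hg', hgd'⟩, hh', hhd'⟩ := orthoPair_monic L (i + 1)
  have hXh := (monic_X_pow (R := ℝ) ((i + 1) % 2)).mul hh'
  have hXhd : (X ^ ((i + 1) % 2) * (orthoPair L (i + 1)).2).natDegree = (i + 1 + 1) / 2 := by
    rw [(monic_X_pow _).natDegree_mul hh', natDegree_X_pow, hhd']; omega
  have h1 := apply_of_orthogonal hg' hgd' og' hXhd.le
  have h2 := apply_of_orthogonal hg hgd og (q := (orthoPair L (i + 1)).2) hhd'.le
  have c1 : (X ^ ((i + 1) % 2) * (orthoPair L (i + 1)).2).coeff ((i + 1 + 1) / 2) = 1 := by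
    rw [← hXhd]; exact hXh
  have c2 : (orthoPair L (i + 1)).2.coeff ((i + 1) / 2) = 1 := by
    rw [← hhd']; exact hh'
  rw [c1, one_mul] at h1
  rw [c2, one_mul] at h2
  have hX := X_pow_mul_X_pow i
  have key : X ^ (i % 2) * (orthoPair L (i + 1)).1 + (1 - X) * (orthoPair L (i + 1)).2 =
      C (1 - canCoeff L i) * (orthoPair L i).1 := by
    rw [orthoPair_succ_fst, orthoPair_succ_snd]
    linear_combination (C (1 - canCoeff L i) * (orthoPair L i).1) * hX
  have hC : ∀ p : ℝ[X], (1 - canCoeff L i) * L p = L (C (1 - canCoeff L i) * p) := fun p => by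
    rw [← smul_eq_C_mul, map_smul, smul_eq_mul]
  rw [lowerGap, upperGap, lowerGap, ← h1, ← h2, ← map_add, hC, mod_two_add_two,
    weight_zero_right, weight_zero_right, weight_one_right]
  congr 1
  linear_combination (X ^ ((i + 1) % 2) * (orthoPair L (i + 1)).2) * key

theorem lowerGap_add_upperGap_zero (hL1 : L 1 = 1) : lowerGap L 0 + upperGap L 0 = 1 := by
  rw [lowerGap, upperGap, ← map_add, ← hL1]
  congr 1
  simp [orthoPair, weight]

/-- The width of the range of a moment is the product of `u * (1 - u)` over lower orders. -/
theorem lowerGap_add_upperGap (hL1 : L 1 = 1) (i : ℕ)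
    (hne : ∀ j < i, lowerGap L j + upperGap L j ≠ 0) :
    lowerGap L i + upperGap L i = ∏ j ∈ Finset.range i, canCoeff L j * (1 - canCoeff L j) := by
  induction i with
  | zero => rw [lowerGap_add_upperGap_zero hL1, Finset.prod_range_zero]
  | succ i ih =>
    rw [Finset.prod_range_succ, ← ih fun j hj => hne j (by omega),
      lowerGap_add_upperGap_succ i fun j hj => hne j (by omega)]
    have h := hne i (by omega)
    have : lowerGap L i = (lowerGap L i + upperGap L i) * canCoeff L i := by
      rw [canCoeff]; field_simp
    linear_combination (1 - canCoeff L i) * this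

theorem gaps_pos {n : ℕ} (hL : PositiveUpTo L n) (i : ℕ) (hi : i < n) :
    0 < lowerGap L i ∧ 0 < upperGap L i := by
  obtain ⟨⟨hg, hgd⟩, hh, hhd⟩ := orthoPair_monic L i
  constructor
  · refine hL _ (mul_ne_zero (weight_ne_zero _ _) (pow_ne_zero _ hg.ne_zero)) ?_ fun x hx => ?_
    · rw [natDegree_mul (weight_ne_zero _ _) (pow_ne_zero _ hg.ne_zero), natDegree_weight,
        natDegree_pow, hgd]
      omega
    · rw [eval_mul, eval_pow]
      exact mul_nonneg (weight_nonneg _ _ hx) (sq_nonneg _)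
  · refine hL _ (mul_ne_zero (weight_ne_zero _ _) (pow_ne_zero _ hh.ne_zero)) ?_ fun x hx => ?_
    · rw [natDegree_mul (weight_ne_zero _ _) (pow_ne_zero _ hh.ne_zero), natDegree_weight,
        natDegree_pow, hhd]
      omega
    · rw [eval_mul, eval_pow]
      exact mul_nonneg (weight_nonneg _ _ hx) (sq_nonneg _)

end OrthoPair

/-- The linear functional on polynomials with prescribed moments `c`. -/
noncomputable def momentFunctional (c : ℕ → ℝ) : ℝ[X] →ₗ[ℝ] ℝ :=
  lsum fun i => c i • LinearMap.id

theorem momentFunctional_eq_sum (c : ℕ → ℝ) {p : ℝ[X]} {d : ℕ} (hd : p.natDegree < d) :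
    momentFunctional c p = ∑ i ∈ Finset.range d, p.coeff i * c i := by
  rw [momentFunctional, lsum_apply, sum_over_range' p _ d hd]
  · refine Finset.sum_congr rfl fun i _ => ?_
    simp [mul_comm]
  · simp

theorem momentFunctional_X_pow (c : ℕ → ℝ) (j : ℕ) : momentFunctional c (X ^ j) = c j := by
  rw [momentFunctional_eq_sum c (d := j + 1) (by simp),
    Finset.sum_eq_single_of_mem j (by simp) fun i _ hi => by simp [coeff_X_pow, hi]]
  simp

theorem momentFunctional_one {c : ℕ → ℝ} (hc : c 0 = 1) : momentFunctional c 1 = 1 := by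
  rw [← pow_zero X, momentFunctional_X_pow, hc]

theorem momentFunctional_update (c : ℕ → ℝ) (k : ℕ) (t : ℝ) (p : ℝ[X]) :
    momentFunctional (Function.update c k t) p =
      momentFunctional c p + p.coeff k * (t - c k) := by
  have hd : p.natDegree < p.natDegree + k + 1 := by omega
  have hk : k ∈ Finset.range (p.natDegree + k + 1) := Finset.mem_range.2 (by omega)
  rw [momentFunctional_eq_sum _ hd, momentFunctional_eq_sum _ hd,
    ← Finset.add_sum_erase _ _ hk, ← Finset.add_sum_erase _ _ hk, Function.update_self]
  rw [Finset.sum_congr rfl fun i hi => by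
    rw [Function.update_of_ne (Finset.ne_of_mem_erase hi)]]
  ring

section Integral

variable {μ : Measure ℝ}

theorem ae_mem_Icc (hμ : μ (Icc (0:ℝ) 1)ᶜ = 0) : ∀ᵐ x ∂μ, x ∈ Icc (0:ℝ) 1 :=
  mem_ae_iff.2 hμ

theorem integral_eval_eq [IsProbabilityMeasure μ] (hμ : μ (Icc (0:ℝ) 1)ᶜ = 0)
    {c : ℕ → ℝ} (hc0 : c 0 = 1) {p : ℝ[X]}
    (hc : ∀ j, 1 ≤ j → j ≤ p.natDegree → ∫ x, x ^ j ∂μ = c j) :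
    ∫ x, p.eval x ∂μ = momentFunctional c p := by
  have h_integrable : ∀ j : ℕ, Integrable (fun x : ℝ => x ^ j) μ := fun j => by
    refine Integrable.of_bound (continuous_pow j).aestronglyMeasurable 1 ?_
    filter_upwards [ae_mem_Icc hμ] with x hx
    rw [Real.norm_eq_abs, abs_of_nonneg (pow_nonneg hx.1 j)]
    exact pow_le_one₀ hx.1 hx.2
  simp_rw [eval_eq_sum_range]
  rw [integral_finsetSum _ fun j _ => (h_integrable j).const_mul _,
    momentFunctional_eq_sum c (Nat.lt_succ_self _)]
  refine Finset.sum_congr rfl fun j hj => ?_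
  rw [integral_const_mul]
  rcases Nat.eq_zero_or_pos j with rfl | hj0
  · simp [hc0]
  · rw [hc j hj0 (by simpa [Nat.lt_succ_iff] using hj)]

theorem integral_eval_nonneg (hμ : μ (Icc (0:ℝ) 1)ᶜ = 0) {p : ℝ[X]}
    (hp : ∀ x ∈ Icc (0:ℝ) 1, 0 ≤ p.eval x) : 0 ≤ ∫ x, p.eval x ∂μ := by
  refine integral_nonneg_of_ae ?_
  filter_upwards [ae_mem_Icc hμ] with x hx using hp x hx

end Integral

/-- The moment sequence `1, s₁, …, s_n` (continued by zero). -/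
noncomputable def momentSeq (n : ℕ) (s : Fin n → ℝ) : ℕ → ℝ := Function.update (toSeq n s) 0 1

section MomentSeq

variable {n : ℕ} (s : Fin n → ℝ)

theorem momentSeq_zero : momentSeq n s 0 = 1 := by simp [momentSeq]

theorem momentSeq_of_pos {j : ℕ} (hj : 1 ≤ j) : momentSeq n s j = toSeq n s j := by
  rw [momentSeq, Function.update_of_ne (by omega)]

theorem momentSeq_succ (i : Fin n) : momentSeq n s (i + 1) = s i := by
  rw [momentSeq_of_pos s (by omega), toSeq, dif_pos ⟨by omega, by omega⟩]
  rfl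

theorem momentSeq_update (i : Fin n) (t : ℝ) :
    momentSeq n (Function.update s i t) = Function.update (momentSeq n s) (i + 1) t := by
  funext j
  rcases Nat.eq_zero_or_pos j with rfl | hj
  · rw [Function.update_of_ne (by omega), momentSeq_zero, momentSeq_zero]
  by_cases hjn : j ≤ n
  · obtain ⟨k, rfl⟩ : ∃ k : Fin n, j = k + 1 := ⟨⟨j - 1, by omega⟩, by simp; omega⟩
    rw [momentSeq_succ]
    by_cases hk : k = i
    · subst hk; simp
    · rw [Function.update_of_ne hk, Function.update_of_ne (by
        simpa [Fin.val_inj] using hk), momentSeq_succ]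
  · rw [Function.update_of_ne (by omega), momentSeq_of_pos _ hj, momentSeq_of_pos _ hj, toSeq,
      toSeq, dif_neg (by omega), dif_neg (by omega)]

variable {s}

theorem momentFunctional_nonneg (hs : s ∈ momentSpace n) {p : ℝ[X]} (hpn : p.natDegree ≤ n)
    (hp : ∀ x ∈ Icc (0:ℝ) 1, 0 ≤ p.eval x) : 0 ≤ momentFunctional (momentSeq n s) p := by
  obtain ⟨μ, hμp, hμ, hm⟩ := hs
  rw [← integral_eval_eq hμ (momentSeq_zero s) fun j hj hjp => ?_]
  · exact integral_eval_nonneg hμ hp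
  · obtain ⟨k, rfl⟩ : ∃ k : Fin n, j = k + 1 := ⟨⟨j - 1, by omega⟩, by simp; omega⟩
    rw [momentSeq_succ, hm]

theorem positiveUpTo_of_mem_interior (hs : s ∈ interior (momentSpace n)) :
    PositiveUpTo (momentFunctional (momentSeq n s)) n := by
  intro p hp0 hpn hp
  rcases Nat.eq_zero_or_pos p.natDegree with hd | hd
  · rw [eq_C_of_natDegree_eq_zero hd] at hp hp0 ⊢
    have h0 : p.coeff 0 ≠ 0 := fun h => hp0 (by rw [h, C_0])
    rw [← mul_one (C _), ← smul_eq_C_mul, map_smul, momentFunctional_one (momentSeq_zero s),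
      smul_eq_mul, mul_one]
    have := hp 0 (by simp)
    rw [eval_C] at this
    exact lt_of_le_of_ne this h0.symm
  obtain ⟨k, hk⟩ : ∃ k : Fin n, p.natDegree = k + 1 :=
    ⟨⟨p.natDegree - 1, by omega⟩, by simp; omega⟩
  have hlc : p.coeff (k + 1) ≠ 0 := by
    rw [← hk]; exact leadingCoeff_ne_zero.2 hp0
  have hcont : Continuous fun t : ℝ => Function.update s k (s k - t * p.coeff (k + 1)) := by
    fun_prop
  have hev : ∀ᶠ t in nhds (0:ℝ),
      Function.update s k (s k - t * p.coeff (k + 1)) ∈ momentSpace n := by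
    refine hcont.continuousAt (mem_interior_iff_mem_nhds.1 ?_)
    simpa using hs
  obtain ⟨t, ht, ht0⟩ :=
    ((hev.filter_mono nhdsWithin_le_nhds).and (self_mem_nhdsWithin (s := Ioi (0:ℝ)))).exists
  have h := momentFunctional_nonneg ht hpn hp
  rw [momentSeq_update, momentFunctional_update, momentSeq_succ] at h
  have : 0 < t * (p.coeff (k + 1)) ^ 2 := mul_pos ht0 (by positivity)
  linarith

theorem integral_eval_of_kthMoment {k : Fin n} {μ : Measure ℝ} [IsProbabilityMeasure μ]
    (hμ : μ (Icc (0:ℝ) 1)ᶜ = 0)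
    (hm : ∀ j, 1 ≤ j → j < (k : ℕ) + 1 → ∫ x, x ^ j ∂μ = toSeq n s j) {p : ℝ[X]}
    (hp : p.natDegree ≤ k + 1) :
    ∫ x, p.eval x ∂μ = momentFunctional (momentSeq n s) p +
      p.coeff (k + 1) * ((∫ x, x ^ ((k : ℕ) + 1) ∂μ) - s k) := by
  rw [integral_eval_eq hμ (c := Function.update (momentSeq n s) (k + 1)
    (∫ x, x ^ ((k : ℕ) + 1) ∂μ)), momentFunctional_update, momentSeq_succ]
  · rw [Function.update_of_ne (by omega), momentSeq_zero]
  · intro j hj hjp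
    rcases (hjp.trans hp).eq_or_lt with rfl | hlt
    · rw [Function.update_self]
    · rw [Function.update_of_ne hlt.ne, momentSeq_of_pos s hj, hm j hj hlt]

theorem leadingCoeff_weight_mul_sq (a b : ℕ) {g : ℝ[X]} (hg : g.Monic) :
    (weight a b * g ^ 2).leadingCoeff = (-1) ^ b := by
  rw [leadingCoeff_mul, (hg.pow 2).leadingCoeff, weight, leadingCoeff_mul, leadingCoeff_pow,
    leadingCoeff_pow, leadingCoeff_X, one_sub_X_eq, leadingCoeff_neg, leadingCoeff_X_sub_C]
  simp

theorem kthMoment_constraint (hL : PositiveUpTo (momentFunctional (momentSeq n s)) n)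
    {k : Fin n} {a b : ℕ} {g : ℝ[X]} (ha : a ≤ 1) (hb : b ≤ 1) (hg : g.Monic)
    (hk : a + b + 2 * g.natDegree = k + 1)
    (horth : ∀ q : ℝ[X], q.degree < g.degree →
      momentFunctional (momentSeq n s) (weight a b * g * q) = 0) :
    (∀ t ∈ kthMomentSet (k + 1) (toSeq n s),
      0 ≤ momentFunctional (momentSeq n s) (weight a b * g ^ 2) + (-1) ^ b * (t - s k)) ∧
    ∃ t ∈ kthMomentSet (k + 1) (toSeq n s),
      momentFunctional (momentSeq n s) (weight a b * g ^ 2) + (-1) ^ b * (t - s k) = 0 := by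
  have hdeg : (weight a b * g ^ 2).natDegree = k + 1 := by
    rw [natDegree_mul (weight_ne_zero a b) (pow_ne_zero 2 hg.ne_zero), natDegree_weight,
      natDegree_pow, hk]
  have hcoeff : (weight a b * g ^ 2).coeff (k + 1) = (-1) ^ b := by
    rw [← leadingCoeff_weight_mul_sq a b hg, leadingCoeff, hdeg]
  constructor
  · rintro _ ⟨μ, hμp, hμ, hm, rfl⟩
    rw [← hcoeff, ← integral_eval_of_kthMoment hμ hm hdeg.le]
    refine integral_eval_nonneg hμ fun x hx => ?_
    rw [eval_mul, eval_pow]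
    exact mul_nonneg (weight_nonneg a b hx) (sq_nonneg _)
  · obtain ⟨μ, hμp, hμ, hq, h0⟩ := exists_quadrature (momentFunctional_one (momentSeq_zero s)) hL
      ha hb hg (by omega) (by omega) horth
    have hm : ∀ j, 1 ≤ j → j < (k : ℕ) + 1 → ∫ x, x ^ j ∂μ = toSeq n s j := by
      intro j hj hjk
      have := hq (X ^ j) (by rw [natDegree_X_pow]; omega)
      rw [momentFunctional_X_pow, momentSeq_of_pos s hj] at this
      simpa using this
    refine ⟨_, ⟨μ, hμp, hμ, hm, rfl⟩, ?_⟩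
    rw [← hcoeff, ← integral_eval_of_kthMoment hμ hm hdeg.le, h0]


theorem sMin_eq (hL : PositiveUpTo (momentFunctional (momentSeq n s)) n) (k : Fin n) :
    sMin (k + 1) (toSeq n s) = s k - lowerGap (momentFunctional (momentSeq n s)) k := by
  obtain ⟨⟨hg, hgd⟩, -⟩ := orthoPair_monic (momentFunctional (momentSeq n s)) k
  obtain ⟨og, -⟩ := orthoPair_orthogonal (L := momentFunctional (momentSeq n s)) k fun j hj =>
    (add_pos (gaps_pos hL j (by omega)).1 (gaps_pos hL j (by omega)).2).ne'
  obtain ⟨h1, t, ht, h2⟩ := kthMoment_constraint hL (k := k) (by omega) (by omega) hg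
    (by rw [hgd]; omega) og
  have hleast : IsLeast (kthMomentSet (k + 1) (toSeq n s)) t := by
    refine ⟨ht, fun t' ht' => ?_⟩
    have := h1 t' ht'
    simp only [pow_zero, one_mul] at this h2
    linarith
  rw [sMin, hleast.csInf_eq, lowerGap]
  simp only [pow_zero, one_mul] at h2
  linarith

theorem sMax_eq (hL : PositiveUpTo (momentFunctional (momentSeq n s)) n) (k : Fin n) :
    sMax (k + 1) (toSeq n s) = s k + upperGap (momentFunctional (momentSeq n s)) k := by
  obtain ⟨-, hg, hgd⟩ := orthoPair_monic (momentFunctional (momentSeq n s)) k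
  obtain ⟨-, og⟩ := orthoPair_orthogonal (L := momentFunctional (momentSeq n s)) k fun j hj =>
    (add_pos (gaps_pos hL j (by omega)).1 (gaps_pos hL j (by omega)).2).ne'
  obtain ⟨h1, t, ht, h2⟩ := kthMoment_constraint hL (k := k) (by omega) (by omega) hg
    (by rw [hgd]; omega) og
  have hgreatest : IsGreatest (kthMomentSet (k + 1) (toSeq n s)) t := by
    refine ⟨ht, fun t' ht' => ?_⟩
    have := h1 t' ht'
    simp only [pow_one] at this h2
    linarith
  rw [sMax, hgreatest.csSup_eq, upperGap]
  simp only [pow_one] at h2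
  linarith

theorem canMap_eq (hL : PositiveUpTo (momentFunctional (momentSeq n s)) n) (k : Fin n) :
    canMap n s k = canCoeff (momentFunctional (momentSeq n s)) k := by
  rw [canMap, sMin_eq hL, sMax_eq hL, canCoeff]
  congr 1 <;> ring

theorem sMax_sub_sMin_eq (hL : PositiveUpTo (momentFunctional (momentSeq n s)) n) (k : Fin n) :
    sMax (k + 1) (toSeq n s) - sMin (k + 1) (toSeq n s) =
      ∏ j ∈ Finset.range k, canCoeff (momentFunctional (momentSeq n s)) j *
        (1 - canCoeff (momentFunctional (momentSeq n s)) j) := by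
  rw [sMin_eq hL, sMax_eq hL,
    ← lowerGap_add_upperGap (momentFunctional_one (momentSeq_zero s)) k fun j hj =>
      (add_pos (gaps_pos hL j (by omega)).1 (gaps_pos hL j (by omega)).2).ne']
  ring

end MomentSeq

section Differentiability

variable {E : Type*} [NormedAddCommGroup E] [NormedSpace ℝ E]

/-- A family of polynomials of bounded degree whose coefficients are differentiable at `x`. -/
def PolyDifferentiableAt (G : E → ℝ[X]) (x : E) : Prop :=
  (∃ d, ∀ y, (G y).natDegree ≤ d) ∧ ∀ i, DifferentiableAt ℝ (fun y => (G y).coeff i) x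

variable {G H : E → ℝ[X]} {x : E}

theorem PolyDifferentiableAt.const (p : ℝ[X]) : PolyDifferentiableAt (fun _ : E => p) x :=
  ⟨⟨p.natDegree, fun _ => le_rfl⟩, fun _ => differentiableAt_const _⟩

theorem PolyDifferentiableAt.C {f : E → ℝ} (hf : DifferentiableAt ℝ f x) :
    PolyDifferentiableAt (fun y => C (f y)) x := by
  refine ⟨⟨0, fun y => (natDegree_C _).le⟩, fun i => ?_⟩
  simp_rw [coeff_C]
  split_ifs
  · exact hf
  · exact differentiableAt_const _

theorem PolyDifferentiableAt.add (hG : PolyDifferentiableAt G x)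
    (hH : PolyDifferentiableAt H x) : PolyDifferentiableAt (fun y => G y + H y) x := by
  obtain ⟨⟨d, hd⟩, hG⟩ := hG
  obtain ⟨⟨e, he⟩, hH⟩ := hH
  refine ⟨⟨max d e, fun y => (natDegree_add_le _ _).trans (max_le_max (hd y) (he y))⟩,
    fun i => ?_⟩
  simp_rw [coeff_add]
  exact (hG i).add (hH i)

theorem PolyDifferentiableAt.mul (hG : PolyDifferentiableAt G x)
    (hH : PolyDifferentiableAt H x) : PolyDifferentiableAt (fun y => G y * H y) x := by
  obtain ⟨⟨d, hd⟩, hG⟩ := hG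
  obtain ⟨⟨e, he⟩, hH⟩ := hH
  refine ⟨⟨d + e, fun y => natDegree_mul_le.trans (add_le_add (hd y) (he y))⟩, fun i => ?_⟩
  simp_rw [coeff_mul]
  exact DifferentiableAt.fun_sum fun j _ => (hG j.1).mul (hH j.2)

variable {n : ℕ}

theorem differentiable_momentSeq (i : ℕ) :
    Differentiable ℝ fun s : Fin n → ℝ => momentSeq n s i := by
  rcases Nat.eq_zero_or_pos i with rfl | hi
  · simp_rw [momentSeq_zero]
    exact differentiable_const _
  · simp_rw [momentSeq_of_pos _ hi, toSeq]
    split_ifs with h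
    · fun_prop
    · exact differentiable_const _

theorem PolyDifferentiableAt.momentFunctional {G : (Fin n → ℝ) → ℝ[X]} {s : Fin n → ℝ}
    (hG : PolyDifferentiableAt G s) :
    DifferentiableAt ℝ (fun y => momentFunctional (momentSeq n y) (G y)) s := by
  obtain ⟨⟨d, hd⟩, hG⟩ := hG
  simp_rw [fun y => momentFunctional_eq_sum (momentSeq n y) (Nat.lt_succ_of_le (hd y))]
  exact DifferentiableAt.fun_sum fun i _ => (hG i).mul (differentiable_momentSeq i s)

section Gaps

variable {s : Fin n → ℝ} {i : ℕ}

theorem differentiableAt_lowerGap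
    (h : PolyDifferentiableAt (fun y => (orthoPair (momentFunctional (momentSeq n y)) i).1) s) :
    DifferentiableAt ℝ (fun y => lowerGap (momentFunctional (momentSeq n y)) i) s := by
  simp_rw [lowerGap, sq]
  exact ((PolyDifferentiableAt.const _).mul (h.mul h)).momentFunctional

theorem differentiableAt_upperGap
    (h : PolyDifferentiableAt (fun y => (orthoPair (momentFunctional (momentSeq n y)) i).2) s) :
    DifferentiableAt ℝ (fun y => upperGap (momentFunctional (momentSeq n y)) i) s := by
  simp_rw [upperGap, sq]
  exact ((PolyDifferentiableAt.const _).mul (h.mul h)).momentFunctional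

theorem differentiableAt_canCoeff
    (hg : PolyDifferentiableAt (fun y => (orthoPair (momentFunctional (momentSeq n y)) i).1) s)
    (hh : PolyDifferentiableAt (fun y => (orthoPair (momentFunctional (momentSeq n y)) i).2) s)
    (hne : lowerGap (momentFunctional (momentSeq n s)) i +
      upperGap (momentFunctional (momentSeq n s)) i ≠ 0) :
    DifferentiableAt ℝ (fun y => canCoeff (momentFunctional (momentSeq n y)) i) s := by
  simp_rw [canCoeff, div_eq_mul_inv]
  have hl := differentiableAt_lowerGap hg
  exact hl.mul ((hl.fun_add (differentiableAt_upperGap hh)).inv hne)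

end Gaps

theorem polyDifferentiableAt_orthoPair {s : Fin n → ℝ} (i : ℕ)
    (hne : ∀ j < i, lowerGap (momentFunctional (momentSeq n s)) j +
      upperGap (momentFunctional (momentSeq n s)) j ≠ 0) :
    PolyDifferentiableAt (fun y => (orthoPair (momentFunctional (momentSeq n y)) i).1) s ∧
      PolyDifferentiableAt (fun y => (orthoPair (momentFunctional (momentSeq n y)) i).2) s := by
  induction i with
  | zero => exact ⟨.const _, .const _⟩
  | succ i ih =>
    obtain ⟨hg, hh⟩ := ih fun j hj => hne j (by omega)
    have hc := differentiableAt_canCoeff hg hh (hne i (by omega))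
    simp_rw [orthoPair_succ_fst, orthoPair_succ_snd]
    have h1 := PolyDifferentiableAt.C ((differentiableAt_const (1:ℝ)).sub hc)
    have h2 := PolyDifferentiableAt.C hc
    exact ⟨(h1.mul ((PolyDifferentiableAt.const _).mul hg)).add
        (h2.mul ((PolyDifferentiableAt.const _).mul hh)),
      (h1.mul hg).add (h2.mul ((PolyDifferentiableAt.const _).mul hh))⟩

theorem differentiableAt_canMap {s : Fin n → ℝ} (hs : s ∈ interior (momentSpace n)) :
    DifferentiableAt ℝ (canMap n) s := by
  refine differentiableAt_pi.2 fun k => ?_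
  have hpos := gaps_pos (positiveUpTo_of_mem_interior hs)
  obtain ⟨hg, hh⟩ := polyDifferentiableAt_orthoPair (s := s) k fun j hj =>
    (add_pos (hpos j (by omega)).1 (hpos j (by omega)).2).ne'
  refine (differentiableAt_canCoeff hg hh
    (add_pos (hpos k k.2).1 (hpos k k.2).2).ne').congr_of_eventuallyEq ?_
  filter_upwards [isOpen_interior.mem_nhds hs] with y hy
  exact canMap_eq (positiveUpTo_of_mem_interior hy) k

end Differentiability

section Triangular

theorem kthMomentSet_congr {k : ℕ} {s t : ℕ → ℝ} (h : ∀ j, 1 ≤ j → j < k → s j = t j) :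
    kthMomentSet k s = kthMomentSet k t := by
  ext x
  refine exists_congr fun μ => and_congr_right fun _ => and_congr_right fun _ =>
    and_congr_left fun _ => forall_congr' fun j => forall_congr' fun h1 => forall_congr' fun h2 => ?_
  rw [h j h1 h2]

variable {n : ℕ} (s : Fin n → ℝ) {j k : Fin n}

theorem canMap_add_smul_single (hkj : k ≤ j) (t : ℝ) :
    canMap n (s + t • Pi.single j 1) k = canMap n s k + t * ((Pi.single j 1 : Fin n → ℝ) k /
      (sMax (k + 1) (toSeq n s) - sMin (k + 1) (toSeq n s))) := by
  have h : kthMomentSet (k + 1) (toSeq n (s + t • Pi.single j 1)) =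
      kthMomentSet (k + 1) (toSeq n s) := by
    refine kthMomentSet_congr fun i hi hik => ?_
    have hin : 1 ≤ i ∧ i ≤ n := ⟨hi, by omega⟩
    have hne : (⟨i - 1, by omega⟩ : Fin n) ≠ j := fun h => by
      have := congrArg Fin.val h
      have : (k : ℕ) ≤ j := hkj
      simp only at *
      omega
    rw [toSeq, toSeq, dif_pos hin, dif_pos hin]
    simp [Pi.single_eq_of_ne hne]
  simp only [canMap, sMin, sMax, h, Pi.add_apply, Pi.smul_apply, smul_eq_mul]
  ring

theorem fderiv_canMap_single (hd : DifferentiableAt ℝ (canMap n) s) (hkj : k ≤ j) :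
    fderiv ℝ (canMap n) s (Pi.single j 1) k = (Pi.single j 1 : Fin n → ℝ) k /
      (sMax (k + 1) (toSeq n s) - sMin (k + 1) (toSeq n s)) := by
  have h1 : HasDerivAt (fun t : ℝ => canMap n (s + t • Pi.single j 1) k)
      (fderiv ℝ (canMap n) s (Pi.single j 1) k) 0 :=
    hasDerivAt_pi.1 (hd.hasFDerivAt.hasLineDerivAt (Pi.single j 1)) k
  simp_rw [canMap_add_smul_single s hkj] at h1
  refine h1.unique ?_
  exact (hasDerivAt_mul_const _).const_add _

end Triangular

theorem prod_range_prod_range {M : Type*} [CommMonoid M] (f : ℕ → M) (n : ℕ) :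
    ∏ k ∈ Finset.range n, ∏ j ∈ Finset.range k, f j =
      ∏ k ∈ Finset.range n, f k ^ (n - 1 - k) := by
  induction n with
  | zero => simp
  | succ n ih =>
    rw [Finset.prod_range_succ, ih, ← Finset.prod_mul_distrib, Finset.prod_range_succ]
    simp only [Nat.add_sub_cancel, Nat.sub_self, pow_zero, mul_one]
    refine Finset.prod_congr rfl fun k hk => ?_
    have := Finset.mem_range.1 hk
    rw [← pow_succ]
    congr 1
    omega

end CanonicalMoment

/-- In the scalar case, the map `φ` from ordinary to canonical moments is
differentiable on the interior of the moment space with Jacobian determinant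
`∏_{k=1}^{n-1} (u_k(1-u_k))^{-(n-k)}` (written below as a product over all
`k = 1,…,n`, the factor for `k = n` being `1`). -/
theorem jacobian_canMap (n : ℕ) (s : Fin n → ℝ) (hs : s ∈ interior (momentSpace n)) :
    ∃ L : (Fin n → ℝ) →L[ℝ] (Fin n → ℝ), HasFDerivAt (canMap n) L s ∧
      LinearMap.det (L : (Fin n → ℝ) →ₗ[ℝ] (Fin n → ℝ)) =
        ∏ k : Fin n, (canMap n s k * (1 - canMap n s k)) ^ (-((n - 1 - (k : ℕ) : ℕ) : ℤ)) := by
  have hL := CanonicalMoment.positiveUpTo_of_mem_interior hs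
  have hd := CanonicalMoment.differentiableAt_canMap hs
  refine ⟨fderiv ℝ (canMap n) s, hd.hasFDerivAt, ?_⟩
  rw [← LinearMap.det_toMatrix', Matrix.det_of_isLowerTriangular]
  · set f : ℕ → ℝ := fun j =>
      CanonicalMoment.canCoeff (CanonicalMoment.momentFunctional
        (CanonicalMoment.momentSeq n s)) j *
      (1 - CanonicalMoment.canCoeff (CanonicalMoment.momentFunctional
        (CanonicalMoment.momentSeq n s)) j) with hf
    have hdiag : ∀ k : Fin n, LinearMap.toMatrix'
        (fderiv ℝ (canMap n) s : (Fin n → ℝ) →ₗ[ℝ] (Fin n → ℝ)) k k =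
        (∏ j ∈ Finset.range k, f j)⁻¹ := fun k => by
      rw [LinearMap.toMatrix'_apply, hf, ← CanonicalMoment.sMax_sub_sMin_eq hL]
      refine (CanonicalMoment.fderiv_canMap_single s hd le_rfl).trans ?_
      rw [Pi.single_eq_same, one_div]
    simp_rw [hdiag, CanonicalMoment.canMap_eq hL, zpow_neg, zpow_natCast, Finset.prod_inv_distrib]
    rw [Fin.prod_univ_eq_prod_range (fun k => ∏ j ∈ Finset.range k, f j),
      Fin.prod_univ_eq_prod_range (fun k => f k ^ (n - 1 - k)),
      CanonicalMoment.prod_range_prod_range]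
  · intro k j hkj
    have hkj : k < j := OrderDual.toDual_lt_toDual.1 hkj
    rw [LinearMap.toMatrix'_apply]
    refine (CanonicalMoment.fderiv_canMap_single s hd hkj.le).trans ?_
    rw [Pi.single_eq_of_ne hkj.ne, zero_div]
end

section
/- If (s₁,…,s_n) is uniformly distributed on the scalar moment space M_n of probability measures on [0,1], then the corresponding canonical moments u₁,…,u_n are independent, with u_k ~ Beta(n-k+1, n-k+1). -/
open MeasureTheory

/-- The Beta distribution on `(0,1)` with parameters `a`, `b`, as a measure
on `ℝ`. -/
noncomputable def betaMeas (a b : ℝ) : Measure ℝ :=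
  volume.withDensity fun x =>
    ENNReal.ofReal ((Set.Ioo (0:ℝ) 1).indicator
      (fun x => x ^ (a - 1) * (1 - x) ^ (b - 1) *
        (Real.Gamma (a + b) / (Real.Gamma a * Real.Gamma b))) x)

section PolynomialTools

open Polynomial

/-- A linear functional on polynomials is strictly positive up to degree `k` if it is positive on
nonzero polynomials of degree at most `k` that are nonnegative on `[0,1]`. -/
def PosUpTo (L : ℝ[X] →ₗ[ℝ] ℝ) (k : ℕ) : Prop :=
  ∀ p : ℝ[X], p ≠ 0 → (∀ x ∈ Set.Icc (0:ℝ) 1, 0 ≤ p.eval x) → p.natDegree ≤ k → 0 < L p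

/-- `A` is the monic orthogonal polynomial of degree `m` for the functional `L (w * ·)`. -/
structure IsMonicOrth (L : ℝ[X] →ₗ[ℝ] ℝ) (w A : ℝ[X]) (m : ℕ) : Prop where
  monic : A.Monic
  natDegree_eq : A.natDegree = m
  orth : ∀ q : ℝ[X], q.degree < m → L (w * A * q) = 0

lemma IsMonicOrth.apply_eq {L : ℝ[X] →ₗ[ℝ] ℝ} {w A : ℝ[X]} {m : ℕ} (h : IsMonicOrth L w A m)
    {p : ℝ[X]} (hp : p.degree ≤ m) : L (w * A * p) = p.coeff m * L (w * A ^ 2) := by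
  have hA : A.degree = m := by
    rw [degree_eq_natDegree h.monic.ne_zero, h.natDegree_eq]
  have hAm : A.coeff m = 1 := by
    rw [← h.natDegree_eq]; exact h.monic.coeff_natDegree
  have hlt : (p - C (p.coeff m) * A).degree < m := by
    rw [degree_lt_iff_coeff_zero]
    intro j hj
    rcases hj.eq_or_lt with rfl | hj
    · simp [hAm]
    · have h1 : p.coeff j = 0 := coeff_eq_zero_of_degree_lt (hp.trans_lt (by exact_mod_cast hj))
      have h2 : A.coeff j = 0 := coeff_eq_zero_of_degree_lt (hA.trans_lt (by exact_mod_cast hj))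
      simp [h1, h2]
  have h0 := h.orth _ hlt
  have : w * A * p = w * A * (p - C (p.coeff m) * A) + (p.coeff m) • (w * A ^ 2) := by
    rw [smul_eq_C_mul]; ring
  rw [this, map_add, h0, map_smul, zero_add, smul_eq_mul]

lemma IsMonicOrth.degree_le {L : ℝ[X] →ₗ[ℝ] ℝ} {w A : ℝ[X]} {m : ℕ} (h : IsMonicOrth L w A m) :
    A.degree ≤ m := by
  rw [← h.natDegree_eq]; exact degree_le_natDegree

lemma IsMonicOrth.coeff_self {L : ℝ[X] →ₗ[ℝ] ℝ} {w A : ℝ[X]} {m : ℕ} (h : IsMonicOrth L w A m) :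
    A.coeff m = 1 := by
  rw [← h.natDegree_eq]; exact h.monic.coeff_natDegree

lemma exists_isMonicOrth {L : ℝ[X] →ₗ[ℝ] ℝ} {k : ℕ} (hL : PosUpTo L k) {w : ℝ[X]} (hw0 : w ≠ 0)
    (hw : ∀ x ∈ Set.Icc (0:ℝ) 1, 0 ≤ w.eval x) (m : ℕ) (hm : w.natDegree + 2 * m ≤ k + 2) :
    ∃ A, IsMonicOrth L w A m := by
  let V := degreeLT ℝ m
  let φ : V →ₗ[ℝ] Module.Dual ℝ V :=
    LinearMap.mk₂ ℝ (fun r q : V => L (w * r * q))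
      (by intro a b c; simp [mul_add, add_mul])
      (by intro a b c; simp)
      (by intro a b c; simp [mul_add])
      (by intro a b c; simp)
  have hfin : FiniteDimensional ℝ V :=
    Module.Finite.equiv (degreeLTEquiv ℝ m).symm
  have hinj : Function.Injective φ := by
    rw [injective_iff_map_eq_zero]
    rintro ⟨r, hr⟩ hφ
    by_contra hne
    have hr0 : r ≠ 0 := fun h => hne (by simpa using h)
    have h0 : L (w * r * r) = 0 := by
      have := congrArg (fun f => f ⟨r, hr⟩) hφ
      simpa [φ] using this
    have hrd : r.natDegree < m := by
      rw [mem_degreeLT] at hr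
      exact (natDegree_lt_iff_degree_lt hr0).2 hr
    have hpos := hL (w * r * r) (by simp [hw0, hr0])
      (fun x hx => by
        have := mul_nonneg (hw x hx) (mul_self_nonneg (r.eval x))
        simpa [mul_assoc] using this)
      (by
        have h1 := natDegree_mul_le (p := w * r) (q := r)
        have h2 := natDegree_mul_le (p := w) (q := r)
        omega)
    exact hpos.ne' h0
  have hsurj : Function.Surjective φ := by
    refine (LinearMap.injective_iff_surjective_of_finrank_eq_finrank ?_).1 hinj
    exact (Subspace.dual_finrank_eq (K := ℝ) (V := V)).symm
  let ψ : Module.Dual ℝ V :=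
    { toFun := fun q => - L (w * X ^ m * (q : ℝ[X]))
      map_add' := by intro a b; simp [mul_add]; ring
      map_smul' := by intro a b; simp }
  obtain ⟨⟨r, hr⟩, hrψ⟩ := hsurj ψ
  rw [mem_degreeLT] at hr
  refine ⟨X ^ m + r, monic_X_pow_add hr, ?_, ?_⟩
  · rcases Nat.eq_zero_or_pos m with rfl | hm0
    · have : r = 0 := by simpa using hr
      simp [this]
    · rw [natDegree_add_eq_left_of_degree_lt (by simpa using hr), natDegree_X_pow]
  · intro q hq
    have := congrArg (fun f => f ⟨q, mem_degreeLT.2 hq⟩) hrψ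
    simp only [φ, ψ, LinearMap.mk₂_apply, LinearMap.coe_mk, AddHom.coe_mk] at this
    rw [mul_add, add_mul, map_add, this]
    ring

/-- The weight of the squares extremal for the lower end of the range of the `k`-th moment. -/
noncomputable def loWeight (k : ℕ) : ℝ[X] := if Even k then 1 else X

/-- The weight of the squares extremal for the upper end of the range of the `k`-th moment. -/
noncomputable def hiWeight (k : ℕ) : ℝ[X] := if Even k then X * (1 - X) else 1 - X

lemma even_weight_identity {L : ℝ[X] →ₗ[ℝ] ℝ} {m : ℕ} {A B D E : ℝ[X]}
    (hA : IsMonicOrth L 1 A (m + 1)) (hD : IsMonicOrth L (X * (1 - X)) D m)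
    (hB : IsMonicOrth L X B (m + 1)) (hE : IsMonicOrth L (1 - X) E (m + 1)) :
    (L (X * B ^ 2) + L ((1 - X) * E ^ 2)) * (L (1 * A ^ 2) + L (X * (1 - X) * D ^ 2)) =
      L (1 * A ^ 2) * L (X * (1 - X) * D ^ 2) := by
  have hF : (E - B).degree ≤ (m : WithBot ℕ) := by
    rw [degree_le_iff_coeff_zero]
    intro j hj
    have hj : m + 1 ≤ j := by exact_mod_cast hj
    rcases hj.eq_or_lt with rfl | hj
    · simp [hB.coeff_self, hE.coeff_self]
    · have h1 : B.coeff j = 0 :=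
        coeff_eq_zero_of_degree_lt (hB.degree_le.trans_lt (by exact_mod_cast hj))
      have h2 : E.coeff j = 0 :=
        coeff_eq_zero_of_degree_lt (hE.degree_le.trans_lt (by exact_mod_cast hj))
      simp [h1, h2]
  have hXF : (X * (E - B)).degree ≤ ((m + 1 : ℕ) : WithBot ℕ) := by
    rw [degree_mul, degree_X, add_comm]
    push_cast
    gcongr
  have hG : (E - X * (E - B)).degree ≤ ((m + 1 : ℕ) : WithBot ℕ) :=
    (degree_sub_le _ _).trans (max_le hE.degree_le hXF)
  have e1 := hA.apply_eq hG
  have e2 := hD.apply_eq hF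
  have e3 : L (X * B * A) = _ := hB.apply_eq hA.degree_le
  have e4 : L ((1 - X) * E * A) = _ := hE.apply_eq hA.degree_le
  have hXD : (X * D).degree ≤ ((m + 1 : ℕ) : WithBot ℕ) := by
    rw [degree_mul, degree_X, add_comm]
    push_cast
    exact add_le_add hD.degree_le le_rfl
  have hXD' : ((1 - X) * D).degree ≤ ((m + 1 : ℕ) : WithBot ℕ) := by
    rw [sub_mul, one_mul]
    refine (degree_sub_le _ _).trans (max_le (hD.degree_le.trans ?_) hXD)
    exact_mod_cast Nat.le_succ m
  have hDm : D.coeff (m + 1) = 0 :=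
    coeff_eq_zero_of_degree_lt (hD.degree_le.trans_lt (by exact_mod_cast Nat.lt_succ_self m))
  have e5 := hE.apply_eq hXD
  have e6 := hB.apply_eq hXD'
  have c1 : (X * D).coeff (m + 1) = 1 := by rw [coeff_X_mul, hD.coeff_self]
  have c2 : ((1 - X) * D).coeff (m + 1) = -1 := by
    rw [sub_mul, one_mul, coeff_sub, c1, hDm]; ring
  have c3 : (E - X * (E - B)).coeff (m + 1) = 1 - (E - B).coeff m := by
    rw [coeff_sub, coeff_X_mul, hE.coeff_self]
  rw [hA.coeff_self, one_mul] at e3 e4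
  rw [c1, one_mul] at e5
  rw [c2] at e6
  rw [c3] at e1
  have f1 : 1 * A * (E - X * (E - B)) = X * B * A + (1 - X) * E * A := by ring
  have f2 : X * (1 - X) * D * (E - B) = (1 - X) * E * (X * D) - X * B * ((1 - X) * D) := by ring
  rw [f1, map_add, e3, e4] at e1
  rw [f2, map_sub, e5, e6] at e2
  linear_combination L (X * (1 - X) * D ^ 2) * e1 + L (1 * A ^ 2) * e2

lemma odd_weight_identity {L : ℝ[X] →ₗ[ℝ] ℝ} {m : ℕ} {A B D E : ℝ[X]}
    (hA : IsMonicOrth L 1 A (m + 1)) (hD : IsMonicOrth L (X * (1 - X)) D m)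
    (hB : IsMonicOrth L X B m) (hE : IsMonicOrth L (1 - X) E m) :
    (L (1 * A ^ 2) + L (X * (1 - X) * D ^ 2)) * (L (X * B ^ 2) + L ((1 - X) * E ^ 2)) =
      L (X * B ^ 2) * L ((1 - X) * E ^ 2) := by
  have hXD : (X * D).degree ≤ ((m + 1 : ℕ) : WithBot ℕ) := by
    rw [degree_mul, degree_X, add_comm]
    push_cast
    exact add_le_add hD.degree_le le_rfl
  have hDm : D.coeff (m + 1) = 0 :=
    coeff_eq_zero_of_degree_lt (hD.degree_le.trans_lt (by exact_mod_cast Nat.lt_succ_self m))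
  have c1 : (X * D).coeff (m + 1) = 1 := by rw [coeff_X_mul, hD.coeff_self]
  have hG : (X * D - A).degree ≤ (m : WithBot ℕ) := by
    rw [degree_le_iff_coeff_zero]
    intro j hj
    have hj : m + 1 ≤ j := by exact_mod_cast hj
    rcases hj.eq_or_lt with rfl | hj
    · rw [coeff_sub, c1, hA.coeff_self, sub_self]
    · have h1 : A.coeff j = 0 :=
        coeff_eq_zero_of_degree_lt (hA.degree_le.trans_lt (by exact_mod_cast hj))
      have h2 : (X * D).coeff j = 0 :=
        coeff_eq_zero_of_degree_lt (hXD.trans_lt (by exact_mod_cast hj))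
      rw [coeff_sub, h1, h2, sub_self]
  have hH : (D - (X * D - A)).degree ≤ (m : WithBot ℕ) :=
    (degree_sub_le _ _).trans (max_le hD.degree_le hG)
  have up : ∀ {F : ℝ[X]}, F.degree ≤ (m : WithBot ℕ) →
      ((1 - X) * F).degree ≤ ((m + 1 : ℕ) : WithBot ℕ) ∧
      (X * F).degree ≤ ((m + 1 : ℕ) : WithBot ℕ) := by
    intro F hF
    have h1 : (X * F).degree ≤ ((m + 1 : ℕ) : WithBot ℕ) := by
      rw [degree_mul, degree_X, add_comm]
      push_cast
      exact add_le_add hF le_rfl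
    refine ⟨?_, h1⟩
    rw [sub_mul, one_mul]
    refine (degree_sub_le _ _).trans (max_le (hF.trans ?_) h1)
    exact_mod_cast Nat.le_succ m
  have e1 := hE.apply_eq hG
  have e2 := hB.apply_eq hH
  have e3 := hD.apply_eq hE.degree_le
  have e4 := hD.apply_eq hB.degree_le
  have e5 := hA.apply_eq (up hE.degree_le).1
  have e6 := hA.apply_eq (up hB.degree_le).2
  have hEm : E.coeff (m + 1) = 0 :=
    coeff_eq_zero_of_degree_lt (hE.degree_le.trans_lt (by exact_mod_cast Nat.lt_succ_self m))
  have c5 : ((1 - X) * E).coeff (m + 1) = -1 := by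
    rw [sub_mul, one_mul, coeff_sub, coeff_X_mul, hE.coeff_self, hEm]; ring
  have c6 : (X * B).coeff (m + 1) = 1 := by rw [coeff_X_mul, hB.coeff_self]
  have c2 : (D - (X * D - A)).coeff m = 1 - (X * D - A).coeff m := by
    rw [coeff_sub, hD.coeff_self]
  rw [hE.coeff_self, one_mul] at e3
  rw [hB.coeff_self, one_mul] at e4
  rw [c5] at e5
  rw [c6] at e6
  rw [c2] at e2
  have f1 : (1 - X) * E * (X * D - A) = X * (1 - X) * D * E - 1 * A * ((1 - X) * E) := by ring
  have f2 : X * B * (D - (X * D - A)) = X * (1 - X) * D * B + 1 * A * (X * B) := by ring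
  rw [f1, map_sub, e3, e5] at e1
  rw [f2, map_add, e4, e6] at e2
  linear_combination L (X * B ^ 2) * e1 + L ((1 - X) * E ^ 2) * e2

/-- The reciprocal recursion for the widths of consecutive moment ranges. -/
lemma weight_identity {L : ℝ[X] →ₗ[ℝ] ℝ} {k : ℕ} {A B D E : ℝ[X]}
    (hA : IsMonicOrth L (loWeight (k + 1)) A ((k + 1) / 2))
    (hD : IsMonicOrth L (hiWeight (k + 1)) D (k / 2))
    (hB : IsMonicOrth L (loWeight (k + 2)) B ((k + 2) / 2))
    (hE : IsMonicOrth L (hiWeight (k + 2)) E ((k + 1) / 2)) :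
    (L (loWeight (k + 2) * B ^ 2) + L (hiWeight (k + 2) * E ^ 2)) *
        (L (loWeight (k + 1) * A ^ 2) + L (hiWeight (k + 1) * D ^ 2)) =
      L (loWeight (k + 1) * A ^ 2) * L (hiWeight (k + 1) * D ^ 2) := by
  rcases Nat.even_or_odd' k with ⟨m, rfl | rfl⟩
  · have h1 : ¬ Even (2 * m + 1) := by simp
    have h2 : Even (2 * m + 2) := ⟨m + 1, by ring⟩
    simp only [loWeight, hiWeight, if_neg h1, if_pos h2] at *
    rw [show (2 * m + 1) / 2 = m by omega] at hA hE
    rw [show (2 * m) / 2 = m by omega] at hD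
    rw [show (2 * m + 2) / 2 = m + 1 by omega] at hB
    exact odd_weight_identity hB hE hA hD
  · have h1 : Even (2 * m + 1 + 1) := ⟨m + 1, by ring⟩
    have h2 : ¬ Even (2 * m + 1 + 2) := by rw [Nat.not_even_iff_odd]; exact ⟨m + 1, by ring⟩
    simp only [loWeight, hiWeight, if_neg h2, if_pos h1] at *
    rw [show (2 * m + 1 + 1) / 2 = m + 1 by omega] at hA hE
    rw [show (2 * m + 1) / 2 = m by omega] at hD
    rw [show (2 * m + 1 + 2) / 2 = m + 1 by omega] at hB
    exact even_weight_identity hA hD hB hE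

lemma loWeight_nonneg (k : ℕ) : ∀ x ∈ Set.Icc (0:ℝ) 1, 0 ≤ (loWeight k).eval x := by
  intro x hx
  unfold loWeight
  split_ifs
  · simp
  · simpa using hx.1

lemma hiWeight_nonneg (k : ℕ) : ∀ x ∈ Set.Icc (0:ℝ) 1, 0 ≤ (hiWeight k).eval x := by
  intro x hx
  have := sub_nonneg.2 hx.2
  unfold hiWeight
  split_ifs
  · simpa using mul_nonneg hx.1 this
  · simpa using hx.2

lemma one_sub_X_eq : (1 - X : ℝ[X]) = - (X - C 1) := by simp

lemma loWeight_monic (k : ℕ) : (loWeight k).Monic := by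
  unfold loWeight
  split_ifs
  · exact monic_one
  · exact monic_X

lemma neg_hiWeight_monic (k : ℕ) : (-hiWeight k).Monic := by
  unfold hiWeight
  split_ifs
  · rw [one_sub_X_eq, mul_neg, neg_neg]; exact monic_X.mul (monic_X_sub_C 1)
  · rw [one_sub_X_eq, neg_neg]; exact monic_X_sub_C 1

lemma hiWeight_ne_zero (k : ℕ) : hiWeight k ≠ 0 :=
  neg_ne_zero.1 (neg_hiWeight_monic k).ne_zero

lemma natDegree_loWeight (k : ℕ) : (loWeight k).natDegree + 2 * (k / 2) = k := by
  unfold loWeight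
  split_ifs with h
  · obtain ⟨m, rfl⟩ := h; simp; omega
  · obtain ⟨m, rfl⟩ := Nat.not_even_iff_odd.1 h; simp; omega

lemma natDegree_hiWeight (k : ℕ) : (hiWeight (k + 1)).natDegree + 2 * (k / 2) = k + 1 := by
  rw [← natDegree_neg]
  unfold hiWeight
  split_ifs with h
  · rw [one_sub_X_eq, mul_neg, neg_neg, monic_X.natDegree_mul (monic_X_sub_C 1), natDegree_X,
      natDegree_X_sub_C]
    obtain ⟨m, hm⟩ := h; omega
  · rw [one_sub_X_eq, neg_neg, natDegree_X_sub_C]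
    obtain ⟨m, hm⟩ := Nat.not_even_iff_odd.1 h; omega

/-- The zeros on `[0,1]` of a polynomial of degree at most `k + 1` that is nonnegative there are
zeros of one of the two extremal weighted squares. -/
lemma exists_weighted_square_of_nonneg {R : ℝ[X]} (hR0 : R ≠ 0)
    (hR : ∀ x ∈ Set.Icc (0:ℝ) 1, 0 ≤ R.eval x) {k : ℕ} (hk : R.natDegree ≤ k + 1) :
    (∃ q : ℝ[X], q.Monic ∧ q.natDegree = (k + 1) / 2 ∧
      ∀ x ∈ Set.Icc (0:ℝ) 1, R.eval x = 0 → (loWeight (k + 1) * q ^ 2).eval x = 0) ∨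
    (∃ q : ℝ[X], q.Monic ∧ q.natDegree = k / 2 ∧
      ∀ x ∈ Set.Icc (0:ℝ) 1, R.eval x = 0 → (hiWeight (k + 1) * q ^ 2).eval x = 0) := by
  classical
  set Z : Finset ℝ := R.roots.toFinset.filter (fun x => x ∈ Set.Ioo (0:ℝ) 1) with hZ
  set W : ℝ[X] := ∏ z ∈ Z, (X - C z) with hW
  have hWm : W.Monic := monic_prod_of_monic _ _ fun z _ => monic_X_sub_C z
  have hWd : W.natDegree = Z.card := by
    rw [hW, natDegree_prod_of_monic _ _ fun z _ => monic_X_sub_C z]; simp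
  have hWz : ∀ x ∈ Set.Ioo (0:ℝ) 1, R.eval x = 0 → W.eval x = 0 := by
    intro x hx hx0
    rw [hW, eval_prod]
    refine Finset.prod_eq_zero (i := x) ?_ (by simp)
    simp [hZ, hR0, hx0, hx.1, hx.2]
  set U : Finset ℝ := ({0, 1} : Finset ℝ).filter (fun x => R.eval x = 0) with hU
  have hdisj : Disjoint Z U := by
    rw [Finset.disjoint_left]
    intro x hx hxU
    simp only [hZ, hU, Finset.mem_filter, Finset.mem_insert, Finset.mem_singleton] at hx hxU
    rcases hxU.1 with rfl | rfl
    · exact lt_irrefl _ hx.2.1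
    · exact lt_irrefl _ hx.2.2
  let e : ℝ → ℕ := fun z => if z ∈ Z then 2 else 1
  have hdvd : (∏ z ∈ Z ∪ U, (X - C z) ^ e z) ∣ R := by
    refine Finset.prod_dvd_of_coprime ?_ ?_
    · intro a _ b _ hab
      exact IsCoprime.pow (isCoprime_X_sub_C_of_isUnit_sub (sub_ne_zero.2 hab).isUnit)
    · intro z hz
      by_cases hzZ : z ∈ Z
      · simp only [e, if_pos hzZ]
        rw [← le_rootMultiplicity_iff hR0]
        have hz' := hzZ
        simp only [hZ, Finset.mem_filter, Multiset.mem_toFinset, mem_roots hR0] at hz'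
        have : 1 < R.rootMultiplicity z := by
          rw [one_lt_rootMultiplicity_iff_isRoot hR0]
          refine ⟨hz'.1, ?_⟩
          have hmin : IsLocalMin (fun x => R.eval x) z := by
            filter_upwards [Icc_mem_nhds hz'.2.1 hz'.2.2] with x hx
            rw [hz'.1]
            exact hR x hx
          have := hmin.deriv_eq_zero
          rwa [Polynomial.deriv] at this
        exact this
      · simp only [e, if_neg hzZ, pow_one]
        rw [dvd_iff_isRoot]
        have hzU : z ∈ U := (Finset.mem_union.1 hz).resolve_left hzZ
        exact (Finset.mem_filter.1 hzU).2
  have hdeg : 2 * Z.card + U.card ≤ k + 1 := by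
    have h1 := (natDegree_le_of_dvd hdvd hR0).trans hk
    rw [natDegree_prod_of_monic _ _ fun z _ => (monic_X_sub_C z).pow _,
      Finset.sum_union hdisj] at h1
    have h2 : ∑ z ∈ Z, ((X - C z) ^ e z : ℝ[X]).natDegree = 2 * Z.card := by
      rw [Finset.sum_congr rfl (g := fun _ => 2)]
      · simp [mul_comm]
      · intro z hz; simp [e, if_pos hz]
    have h3 : ∑ z ∈ U, ((X - C z) ^ e z : ℝ[X]).natDegree = U.card := by
      rw [Finset.sum_congr rfl (g := fun _ => 1)]
      · simp
      · intro z hz; simp [e, if_neg (Finset.disjoint_right.1 hdisj hz)]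
    omega
  have main : ∀ (T : Finset ℝ) (d : ℕ) (w : ℝ[X]), Z.card + T.card ≤ d →
      (∀ x ∈ U, x ∈ T ∨ w.eval x = 0) →
      ∃ q : ℝ[X], q.Monic ∧ q.natDegree = d ∧
        ∀ x ∈ Set.Icc (0:ℝ) 1, R.eval x = 0 → (w * q ^ 2).eval x = 0 := by
    intro T d w hd hw
    have hTm : (∏ z ∈ T, (X - C z) : ℝ[X]).Monic :=
      monic_prod_of_monic _ _ fun z _ => monic_X_sub_C z
    refine ⟨W * (∏ z ∈ T, (X - C z)) * X ^ (d - (Z.card + T.card)),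
      (hWm.mul hTm).mul (monic_X_pow _), ?_, ?_⟩
    · rw [(hWm.mul hTm).natDegree_mul (monic_X_pow _), hWm.natDegree_mul hTm, hWd,
        natDegree_prod_of_monic _ _ fun z _ => monic_X_sub_C z]
      simp
      omega
    · intro x hx hx0
      by_cases hxI : x ∈ Set.Ioo (0:ℝ) 1
      · simp [hWz x hxI hx0]
      · have hxU : x ∈ U := by
          simp only [hU, Finset.mem_filter, Finset.mem_insert, Finset.mem_singleton]
          refine ⟨?_, hx0⟩
          by_contra hcon
          rw [not_or] at hcon
          exact hxI ⟨lt_of_le_of_ne hx.1 (Ne.symm hcon.1), lt_of_le_of_ne hx.2 hcon.2⟩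
        rcases hw x hxU with h | h
        · have : (∏ z ∈ T, (X - C z) : ℝ[X]).eval x = 0 := by
            rw [eval_prod]
            exact Finset.prod_eq_zero h (by simp)
          simp [this]
        · simp [h]
  have hUsub : U ⊆ {0, 1} := Finset.filter_subset _ _
  have hU01 : ∀ x ∈ U, x = 0 ∨ x = 1 := fun x hx => by simpa using hUsub hx
  have hU2 : U.card ≤ 2 := (Finset.card_le_card hUsub).trans Finset.card_le_two
  rcases Nat.even_or_odd' k with ⟨m, rfl | rfl⟩
  · have hlo : loWeight (2 * m + 1) = X := if_neg (by simp)
    have hhi : hiWeight (2 * m + 1) = 1 - X := if_neg (by simp)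
    rw [hlo, hhi]
    by_cases h1 : (1:ℝ) ∈ U
    · by_cases h0 : (0:ℝ) ∈ U
      · have : U = {0, 1} := by
          refine hUsub.antisymm ?_
          intro x hx
          simp only [Finset.mem_insert, Finset.mem_singleton] at hx
          rcases hx with rfl | rfl <;> assumption
        have hc : U.card = 2 := by rw [this]; simp
        refine Or.inl (main {1} _ _ ?_ ?_)
        · simp; omega
        · intro x hx
          rcases hU01 x hx with rfl | rfl <;> simp
      · refine Or.inr (main ∅ _ _ ?_ ?_)
        · simp; omega
        · intro x hx
          rcases hU01 x hx with rfl | rfl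
          · exact absurd hx h0
          · simp
    · refine Or.inl (main ∅ _ _ ?_ ?_)
      · simp; omega
      · intro x hx
        rcases hU01 x hx with rfl | rfl
        · simp
        · exact absurd hx h1
  · have hev : Even (2 * m + 1 + 1) := ⟨m + 1, by ring⟩
    have hlo : loWeight (2 * m + 1 + 1) = 1 := if_pos hev
    have hhi : hiWeight (2 * m + 1 + 1) = X * (1 - X) := if_pos hev
    rw [hlo, hhi]
    by_cases hc : U.card = 2
    · refine Or.inr (main ∅ _ _ ?_ ?_)
      · simp; omega
      · intro x hx
        rcases hU01 x hx with rfl | rfl <;> simp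
    · refine Or.inl (main U _ _ ?_ ?_)
      · omega
      · intro x hx
        exact Or.inl hx

/-- A probability measure supported on `[0,1]` whose first `n` moments are `s`. -/
structure Represents {n : ℕ} (μ : Measure ℝ) (s : Fin n → ℝ) : Prop where
  isProb : IsProbabilityMeasure μ
  compl_null : μ (Set.Icc (0:ℝ) 1)ᶜ = 0
  moment : ∀ j : Fin n, s j = ∫ x, x ^ ((j : ℕ) + 1) ∂μ

lemma mem_momentSpace_iff_s16 {n : ℕ} {s : Fin n → ℝ} :
    s ∈ momentSpace n ↔ ∃ μ : Measure ℝ, Represents μ s :=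
  ⟨fun ⟨μ, h1, h2, h3⟩ => ⟨μ, h1, h2, h3⟩, fun ⟨μ, h⟩ => ⟨μ, h.1, h.2, h.3⟩⟩

/-- The functional sending a polynomial to its integral, expressed through the moments. -/
noncomputable def momentFunctional (μ : Measure ℝ) : ℝ[X] →ₗ[ℝ] ℝ :=
  Polynomial.lsum fun j => (∫ x, x ^ j ∂μ) • LinearMap.id

lemma momentFunctional_eq_sum (μ : Measure ℝ) {p : ℝ[X]} {k : ℕ} (hp : p.natDegree ≤ k) :
    momentFunctional μ p = ∑ j ∈ Finset.range (k + 1), p.coeff j * ∫ x, x ^ j ∂μ := by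
  unfold momentFunctional
  rw [Polynomial.lsum_apply, sum_over_range' p (by simp) (k + 1) (by omega)]
  simp [mul_comm]

namespace Represents

variable {n : ℕ} {μ : Measure ℝ} {s : Fin n → ℝ}

lemma ae_mem (h : Represents μ s) : ∀ᵐ x ∂μ, x ∈ Set.Icc (0:ℝ) 1 := by
  rw [ae_iff]; exact h.compl_null

lemma integrable (h : Represents μ s) {f : ℝ → ℝ} (hf : Continuous f) : Integrable f μ := by
  have := h.isProb
  obtain ⟨c, hc⟩ := (isCompact_Icc (a := (0:ℝ)) (b := 1)).exists_bound_of_continuousOn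
    hf.continuousOn
  exact Integrable.of_bound hf.aestronglyMeasurable c (h.ae_mem.mono hc)

lemma momentFunctional_apply (h : Represents μ s) (p : ℝ[X]) :
    momentFunctional μ p = ∫ x, p.eval x ∂μ := by
  rw [momentFunctional_eq_sum μ le_rfl]
  simp_rw [eval_eq_sum_range]
  rw [integral_finsetSum _ fun j _ => h.integrable (by fun_prop)]
  simp_rw [integral_const_mul]

lemma momentFunctional_nonneg (h : Represents μ s) {p : ℝ[X]}
    (hp : ∀ x ∈ Set.Icc (0:ℝ) 1, 0 ≤ p.eval x) : 0 ≤ momentFunctional μ p := by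
  rw [h.momentFunctional_apply]
  exact integral_nonneg_of_ae (h.ae_mem.mono hp)

lemma integral_pow_zero (h : Represents μ s) : ∫ x, x ^ 0 ∂μ = (1:ℝ) := by
  have := h.isProb
  simp

lemma momentFunctional_eq (h : Represents μ s) {p : ℝ[X]} (hp : p.natDegree ≤ n) :
    momentFunctional μ p = p.coeff 0 + ∑ j : Fin n, p.coeff (j + 1) * s j := by
  rw [momentFunctional_eq_sum μ hp, Finset.sum_range_succ', h.integral_pow_zero, mul_one, add_comm,
    Finset.sum_range]
  simp_rw [h.moment]

end Represents

lemma represents_dirac (n : ℕ) {x : ℝ} (hx : x ∈ Set.Icc (0:ℝ) 1) :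
    Represents (Measure.dirac x) (fun j : Fin n => x ^ ((j : ℕ) + 1)) where
  isProb := inferInstance
  compl_null := by
    rw [Measure.dirac_apply' _ measurableSet_Icc.compl]
    simpa using hx
  moment j := by simp

lemma pow_mem_momentSpace (n : ℕ) {x : ℝ} (hx : x ∈ Set.Icc (0:ℝ) 1) :
    (fun j : Fin n => x ^ ((j : ℕ) + 1)) ∈ momentSpace n :=
  mem_momentSpace_iff_s16.2 ⟨_, represents_dirac n hx⟩

lemma convex_momentSpace (n : ℕ) : Convex ℝ (momentSpace n) := by
  intro s hs t ht a b ha hb hab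
  obtain ⟨μ, hμ⟩ := mem_momentSpace_iff_s16.1 hs
  obtain ⟨ν, hν⟩ := mem_momentSpace_iff_s16.1 ht
  have := hμ.isProb
  have := hν.isProb
  refine mem_momentSpace_iff_s16.2 ⟨ENNReal.ofReal a • μ + ENNReal.ofReal b • ν, ⟨⟨?_⟩, ?_, ?_⟩⟩
  · simp [← ENNReal.ofReal_add ha hb, hab]
  · simp [hμ.compl_null, hν.compl_null]
  · intro j
    have hc : Continuous fun x : ℝ => x ^ ((j : ℕ) + 1) := by fun_prop
    rw [integral_add_measure ((hμ.integrable hc).smul_measure ENNReal.ofReal_ne_top)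
      ((hν.integrable hc).smul_measure ENNReal.ofReal_ne_top), integral_smul_measure,
      integral_smul_measure, ← hμ.moment, ← hν.moment, ENNReal.toReal_ofReal ha,
      ENNReal.toReal_ofReal hb]
    simp

lemma isCompact_momentSpace (n : ℕ) : IsCompact (momentSpace n) := by
  let F : ProbabilityMeasure (Set.Icc (0:ℝ) 1) → Fin n → ℝ :=
    fun ν j => ∫ x, (x : ℝ) ^ ((j : ℕ) + 1) ∂(ν : Measure (Set.Icc (0:ℝ) 1))
  have hF : Continuous F := by
    refine continuous_pi fun j => ?_
    let f : BoundedContinuousFunction (Set.Icc (0:ℝ) 1) ℝ :=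
      BoundedContinuousFunction.mkOfCompact ⟨fun x => (x : ℝ) ^ ((j : ℕ) + 1), by fun_prop⟩
    exact (ProbabilityMeasure.continuous_iff_forall_continuous_integral.1 continuous_id) f
  have : momentSpace n = Set.range F := by
    ext s
    rw [mem_momentSpace_iff_s16]
    constructor
    · rintro ⟨μ, hμ⟩
      have := hμ.isProb
      have hp : IsProbabilityMeasure (μ.comap ((↑) : Set.Icc (0:ℝ) 1 → ℝ)) := by
        constructor
        rw [Measure.comap_apply _ Subtype.val_injective
          (fun s hs => measurableSet_Icc.subtype_image hs) _ MeasurableSet.univ]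
        simp only [Set.image_univ, Subtype.range_coe_subtype]
        exact (prob_compl_eq_zero_iff measurableSet_Icc).1 hμ.compl_null
      refine ⟨⟨μ.comap (↑), hp⟩, ?_⟩
      funext j
      rw [hμ.moment]
      simp only [F, ProbabilityMeasure.coe_mk]
      rw [integral_subtype_comap measurableSet_Icc (fun x : ℝ => x ^ ((j : ℕ) + 1)),
        Measure.restrict_eq_self_of_ae_mem hμ.ae_mem]
    · rintro ⟨ν, rfl⟩
      have hm : AEMeasurable ((↑) : Set.Icc (0:ℝ) 1 → ℝ) (ν : Measure (Set.Icc (0:ℝ) 1)) :=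
        measurable_subtype_coe.aemeasurable
      refine ⟨(ν : Measure (Set.Icc (0:ℝ) 1)).map (↑), Measure.isProbabilityMeasure_map hm, ?_, ?_⟩
      · rw [Measure.map_apply_of_aemeasurable hm measurableSet_Icc.compl]
        convert measure_empty (μ := (ν : Measure (Set.Icc (0:ℝ) 1)))
        ext x
        simp
      · intro j
        rw [integral_map hm (by fun_prop)]
  rw [this]
  exact isCompact_range hF

/-- The polynomial `∑ c_j x^(j+1)` of a linear functional on moment vectors. -/
noncomputable def linPoly {n : ℕ} (c : Fin n → ℝ) : ℝ[X] :=
  ∑ j : Fin n, C (c j) * X ^ ((j : ℕ) + 1)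

section linPoly

variable {n : ℕ} (c : Fin n → ℝ)

lemma coeff_linPoly_succ (i : Fin n) : (linPoly c).coeff ((i : ℕ) + 1) = c i := by
  simp only [linPoly, finsetSum_coeff, coeff_C_mul, coeff_X_pow]
  rw [Finset.sum_eq_single i] <;> simp +contextual [Fin.ext_iff, eq_comm]

lemma coeff_linPoly_zero : (linPoly c).coeff 0 = 0 := by
  simp [linPoly]

lemma natDegree_linPoly_le : (linPoly c).natDegree ≤ n :=
  natDegree_sum_le_of_forall_le _ _ fun j _ =>
    (natDegree_C_mul_X_pow_le _ _).trans (by omega)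

lemma eval_linPoly (x : ℝ) : (linPoly c).eval x = ∑ j : Fin n, c j * x ^ ((j : ℕ) + 1) := by
  simp [linPoly, eval_finsetSum]

end linPoly

lemma linearMap_eq_sum {n : ℕ} (f : (Fin n → ℝ) →ₗ[ℝ] ℝ) (y : Fin n → ℝ) :
    f y = ∑ j, f (Pi.single j 1) * y j := by
  conv_lhs => rw [pi_eq_sum_univ' y]
  simp [mul_comm]

lemma interior_momentSpace_nonempty (n : ℕ) : (interior (momentSpace n)).Nonempty := by
  rw [(convex_momentSpace n).interior_nonempty_iff_affineSpan_eq_top]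
  have h0 : (0 : Fin n → ℝ) ∈ momentSpace n := by
    convert pow_mem_momentSpace n (x := 0) (by simp) using 1
    funext j; simp
  have hspan : Submodule.span ℝ (momentSpace n) = ⊤ := by
    by_contra hne
    obtain ⟨f, hf0, hf⟩ := Submodule.exists_le_ker_of_lt_top _ (lt_top_iff_ne_top.2 hne)
    apply hf0
    have hz : linPoly (fun j => f (Pi.single j 1)) = 0 := by
      refine eq_zero_of_infinite_isRoot _ ((Set.Icc_infinite (zero_lt_one (α := ℝ))).mono ?_)
      intro x hx
      have : f _ = 0 := hf (Submodule.subset_span (pow_mem_momentSpace n hx))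
      rw [linearMap_eq_sum] at this
      simp only [Set.mem_ofPred_eq, IsRoot, eval_linPoly]
      exact this
    ext j
    have := coeff_linPoly_succ (fun j => f (Pi.single j 1)) j
    rw [hz] at this
    simpa using this.symm
  rw [← Set.insert_eq_of_mem h0]
  apply SetLike.coe_injective
  rw [affineSpan_insert_zero, hspan]
  simp

/-- Interior points of the moment space give strictly positive functionals. -/
lemma Represents.posUpTo {n : ℕ} {μ : Measure ℝ} {s : Fin n → ℝ} (h : Represents μ s)
    (hs : s ∈ interior (momentSpace n)) : PosUpTo (momentFunctional μ) n := by
  intro p hp0 hp hpn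
  refine lt_of_le_of_ne (h.momentFunctional_nonneg hp) fun heq => hp0 ?_
  rw [h.momentFunctional_eq hpn] at heq
  have hnn : ∀ y ∈ momentSpace n, 0 ≤ p.coeff 0 + ∑ j : Fin n, p.coeff (j + 1) * y j := by
    intro y hy
    obtain ⟨ν, hν⟩ := mem_momentSpace_iff_s16.1 hy
    rw [← hν.momentFunctional_eq hpn]
    exact hν.momentFunctional_nonneg hp
  have hc : ∀ i : Fin n, p.coeff (i + 1) = 0 := by
    intro i
    have hcont : Filter.Tendsto (fun ε : ℝ => s + ε • (Pi.single i 1 : Fin n → ℝ)) (nhds 0)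
        (nhds s) := by
      have : Continuous (fun ε : ℝ => s + ε • (Pi.single i 1 : Fin n → ℝ)) := by fun_prop
      simpa using this.tendsto 0
    have hev := hcont.eventually (mem_interior_iff_mem_nhds.1 hs)
    have key : ∀ ε : ℝ, (s + ε • (Pi.single i 1 : Fin n → ℝ)) ∈ momentSpace n →
        0 ≤ ε * p.coeff (i + 1) := by
      intro ε hε
      have := hnn _ hε
      simp only [Pi.add_apply, Pi.smul_apply, smul_eq_mul, mul_add, Finset.sum_add_distrib] at this
      rw [← add_assoc, ← heq, zero_add, Finset.sum_eq_single i] at this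
      · simpa [mul_comm] using this
      · intro j _ hj; simp [hj]
      · simp
    have hev' : ∀ᶠ ε : ℝ in nhds 0, 0 ≤ ε * p.coeff (i + 1) := hev.mono key
    obtain ⟨δ, hδ, hball⟩ := Metric.eventually_nhds_iff.1 hev'
    have h1 := hball (y := δ / 2) (by simp [abs_of_pos hδ]; linarith)
    have h2 := hball (y := -(δ / 2)) (by simp [abs_of_pos hδ]; linarith)
    nlinarith
  ext j
  rcases j with _ | j
  · simp [hc] at heq
    simpa using heq.symm
  · by_cases hj : j < n
    · simpa using hc ⟨j, hj⟩
    · rw [coeff_eq_zero_of_natDegree_lt (by omega), coeff_zero]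

/-- At a boundary point of the moment space some nonzero nonnegative polynomial vanishes almost
everywhere. -/
lemma exists_vanishing_of_notMem_interior {n : ℕ} {μ : Measure ℝ} {s : Fin n → ℝ}
    (h : Represents μ s) (hs : s ∉ interior (momentSpace n)) :
    ∃ R : ℝ[X], R ≠ 0 ∧ (∀ x ∈ Set.Icc (0:ℝ) 1, 0 ≤ R.eval x) ∧ R.natDegree ≤ n ∧
      ∀ᵐ x ∂μ, R.eval x = 0 := by
  obtain ⟨f, hf⟩ := geometric_hahn_banach_open_point (convex_momentSpace n).interior
    isOpen_interior hs
  have hle : ∀ y ∈ momentSpace n, f y ≤ f s := by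
    intro y hy
    have hcl : y ∈ closure (interior (momentSpace n)) := by
      rw [(convex_momentSpace n).closure_interior_eq_closure_of_nonempty_interior
        (interior_momentSpace_nonempty n)]
      exact subset_closure hy
    exact closure_minimal (fun z hz => (hf z hz).le)
      (isClosed_le f.continuous continuous_const) hcl
  set c : Fin n → ℝ := fun j => f (Pi.single j 1) with hc
  have hfc : ∀ y, f y = ∑ j, c j * y j := fun y => linearMap_eq_sum f.toLinearMap y
  have hev : ∀ x, (C (f s) - linPoly c).eval x = f s - f (fun j => x ^ ((j : ℕ) + 1)) := by
    intro x
    rw [eval_sub, eval_C, eval_linPoly, hfc fun j : Fin n => x ^ ((j : ℕ) + 1)]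
  have hnn : ∀ x ∈ Set.Icc (0:ℝ) 1, 0 ≤ (C (f s) - linPoly c).eval x := by
    intro x hx
    rw [hev]
    exact sub_nonneg.2 (hle _ (pow_mem_momentSpace n hx))
  have hdeg : (C (f s) - linPoly c).natDegree ≤ n :=
    (natDegree_sub_le _ _).trans (by simpa using natDegree_linPoly_le c)
  refine ⟨C (f s) - linPoly c, ?_, hnn, hdeg, ?_⟩
  · intro h0
    have hc0 : c = 0 := by
      funext j
      have := congrArg (fun p => p.coeff ((j : ℕ) + 1)) h0
      simpa [coeff_linPoly_succ, coeff_C] using this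
    obtain ⟨z, hz⟩ := interior_momentSpace_nonempty n
    have := hf z hz
    rw [hfc z, hfc s, hc0] at this
    simp at this
  · have h_int : ∫ x, (C (f s) - linPoly c).eval x ∂μ = 0 := by
      rw [← h.momentFunctional_apply, h.momentFunctional_eq hdeg]
      simp [coeff_linPoly_succ, coeff_linPoly_zero, coeff_C, hfc s]
    have := (integral_eq_zero_iff_of_nonneg_ae (h.ae_mem.mono hnn)
      (h.integrable (Polynomial.continuous _))).1 h_int
    exact this

/-- The first `k` coordinates of a vector. -/
def truncVec {n k : ℕ} (hk : k ≤ n) (s : Fin n → ℝ) : Fin k → ℝ := fun j => s (Fin.castLE hk j)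

lemma continuous_truncVec {n k : ℕ} (hk : k ≤ n) : Continuous (truncVec hk) := by
  unfold truncVec; fun_prop

lemma Represents.truncVec {n k : ℕ} (hk : k ≤ n) {μ : Measure ℝ} {s : Fin n → ℝ}
    (h : Represents μ s) : Represents μ (truncVec hk s) :=
  ⟨h.isProb, h.compl_null, fun j => h.moment (Fin.castLE hk j)⟩

lemma truncVec_mem_momentSpace {n k : ℕ} (hk : k ≤ n) {s : Fin n → ℝ} (hs : s ∈ momentSpace n) :
    truncVec hk s ∈ momentSpace k := by
  obtain ⟨μ, hμ⟩ := mem_momentSpace_iff_s16.1 hs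
  exact mem_momentSpace_iff_s16.2 ⟨μ, hμ.truncVec hk⟩

lemma isOpenMap_truncVec {n k : ℕ} (hk : k ≤ n) : IsOpenMap (truncVec hk) :=
  LinearMap.isOpenMap_of_finiteDimensional (LinearMap.funLeft ℝ ℝ (Fin.castLE hk))
    (LinearMap.funLeft_surjective_of_injective _ _ _ (Fin.castLE_injective hk))

lemma truncVec_mem_interior {n k : ℕ} (hk : k ≤ n) {s : Fin n → ℝ}
    (hs : s ∈ interior (momentSpace n)) : truncVec hk s ∈ interior (momentSpace k) := by
  refine interior_maximal ?_ (isOpenMap_truncVec hk _ isOpen_interior) ⟨s, hs, rfl⟩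
  rintro _ ⟨z, hz, rfl⟩
  exact truncVec_mem_momentSpace hk (interior_subset hz)

/-- The possible next moments after `s`. -/
def momentFiber {n : ℕ} (s : Fin n → ℝ) : Set ℝ :=
  {t | Fin.snoc (α := fun _ => ℝ) s t ∈ momentSpace (n + 1)}

lemma represents_snoc_iff {n : ℕ} {μ : Measure ℝ} {s : Fin n → ℝ} {t : ℝ} :
    Represents μ (Fin.snoc (α := fun _ => ℝ) s t) ↔
      Represents μ s ∧ ∫ x, x ^ (n + 1) ∂μ = t := by
  constructor
  · intro h
    refine ⟨⟨h.isProb, h.compl_null, fun j => ?_⟩, ?_⟩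
    · simpa using h.moment j.castSucc
    · simpa using (h.moment (Fin.last n)).symm
  · rintro ⟨h, ht⟩
    refine ⟨h.isProb, h.compl_null, fun j => ?_⟩
    refine Fin.lastCases ?_ (fun j => ?_) j
    · simpa using ht.symm
    · simpa using h.moment j

lemma mem_momentFiber_iff {n : ℕ} {s : Fin n → ℝ} {t : ℝ} :
    t ∈ momentFiber s ↔ ∃ μ : Measure ℝ, Represents μ s ∧ ∫ x, x ^ (n + 1) ∂μ = t := by
  simp only [momentFiber, Set.mem_ofPred_eq, mem_momentSpace_iff_s16, represents_snoc_iff]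

lemma kthMomentSet_toSeq {n k : ℕ} (hk : k ≤ n) (s : Fin n → ℝ) :
    kthMomentSet (k + 1) (toSeq n s) = momentFiber (truncVec hk s) := by
  ext t
  rw [mem_momentFiber_iff]
  constructor
  · rintro ⟨μ, h1, h2, h3, h4⟩
    refine ⟨μ, ⟨h1, h2, fun j => ?_⟩, h4⟩
    rw [h3 (j + 1) (by omega) (by omega)]
    have : 1 ≤ (j : ℕ) + 1 ∧ (j : ℕ) + 1 ≤ n := by omega
    simp only [toSeq, dif_pos this, truncVec]
    rfl
  · rintro ⟨μ, h, h4⟩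
    refine ⟨μ, h.isProb, h.compl_null, fun j hj1 hjk => ?_, h4⟩
    have hm := h.moment ⟨j - 1, by omega⟩
    have : 1 ≤ j ∧ j ≤ n := by omega
    simp only [toSeq, dif_pos this]
    simp only [truncVec, Nat.sub_add_cancel hj1] at hm
    exact hm.symm

lemma momentFiber_subset_Icc {n : ℕ} (s : Fin n → ℝ) : momentFiber s ⊆ Set.Icc 0 1 := by
  intro t ht
  obtain ⟨μ, h, rfl⟩ := mem_momentFiber_iff.1 ht
  have := h.isProb
  constructor
  · exact integral_nonneg_of_ae (h.ae_mem.mono fun x hx => pow_nonneg hx.1 _)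
  · have : ∫ x, x ^ (n + 1) ∂μ ≤ ∫ x, 1 ∂μ :=
      integral_mono_ae (h.integrable (by fun_prop)) (h.integrable (by fun_prop))
        (h.ae_mem.mono fun x hx => pow_le_one₀ hx.1 hx.2)
    simpa using this

lemma continuous_snoc {n : ℕ} :
    Continuous fun p : (Fin n → ℝ) × ℝ =>
      (Fin.snoc (α := fun _ => ℝ) p.1 p.2 : Fin (n + 1) → ℝ) := by
  refine continuous_pi fun j => ?_
  refine Fin.lastCases ?_ (fun j => ?_) j
  · simpa using continuous_snd
  · simp; fun_prop

lemma continuous_snoc_right {n : ℕ} (s : Fin n → ℝ) :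
    Continuous fun t : ℝ => (Fin.snoc (α := fun _ => ℝ) s t : Fin (n + 1) → ℝ) :=
  continuous_snoc.comp (by fun_prop : Continuous fun t : ℝ => (s, t))

lemma isCompact_momentFiber {n : ℕ} (s : Fin n → ℝ) : IsCompact (momentFiber s) :=
  isCompact_Icc.of_isClosed_subset
    ((isCompact_momentSpace (n + 1)).isClosed.preimage (continuous_snoc_right s))
    (momentFiber_subset_Icc s)

lemma momentFiber_nonempty {n : ℕ} {s : Fin n → ℝ} (hs : s ∈ momentSpace n) :
    (momentFiber s).Nonempty := by
  obtain ⟨μ, hμ⟩ := mem_momentSpace_iff_s16.1 hs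
  exact ⟨_, mem_momentFiber_iff.2 ⟨μ, hμ, rfl⟩⟩

lemma snoc_combo {n : ℕ} (s s' : Fin n → ℝ) (t t' a b : ℝ) :
    (Fin.snoc (α := fun _ => ℝ) (a • s + b • s') (a * t + b * t') : Fin (n + 1) → ℝ) =
      a • (Fin.snoc (α := fun _ => ℝ) s t : Fin (n + 1) → ℝ) +
        b • (Fin.snoc (α := fun _ => ℝ) s' t' : Fin (n + 1) → ℝ) := by
  funext j
  refine Fin.lastCases ?_ (fun j => ?_) j <;> simp

lemma combo_mem_momentFiber {n : ℕ} {s s' : Fin n → ℝ} {t t' : ℝ} (ht : t ∈ momentFiber s)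
    (ht' : t' ∈ momentFiber s') {a b : ℝ} (ha : 0 ≤ a) (hb : 0 ≤ b) (hab : a + b = 1) :
    a * t + b * t' ∈ momentFiber (a • s + b • s') := by
  change (Fin.snoc (α := fun _ => ℝ) (a • s + b • s') (a * t + b * t') : Fin (n + 1) → ℝ) ∈
    momentSpace (n + 1)
  rw [snoc_combo]
  exact convex_momentSpace (n + 1) ht ht' ha hb hab

lemma convex_momentFiber {n : ℕ} (s : Fin n → ℝ) : Convex ℝ (momentFiber s) := by
  intro t ht t' ht' a b ha hb hab
  have := combo_mem_momentFiber ht ht' ha hb hab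
  rwa [← add_smul, hab, one_smul] at this

lemma truncVec_snoc {n : ℕ} (s : Fin n → ℝ) (t : ℝ) :
    truncVec (Nat.le_succ n) (Fin.snoc (α := fun _ => ℝ) s t) = s := by
  funext j
  exact Fin.snoc_castSucc (α := fun _ => ℝ) t s j

lemma snoc_truncVec {n : ℕ} (z : Fin (n + 1) → ℝ) :
    Fin.snoc (α := fun _ => ℝ) (truncVec (Nat.le_succ n) z) (z (Fin.last n)) = z :=
  Fin.snoc_init_self z

lemma exists_snoc_mem_interior {n : ℕ} {s : Fin n → ℝ} (hs : s ∈ interior (momentSpace n)) :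
    ∃ t, Fin.snoc (α := fun _ => ℝ) s t ∈ interior (momentSpace (n + 1)) := by
  set V := truncVec (Nat.le_succ n) '' interior (momentSpace (n + 1)) with hV
  have hVo : IsOpen V := isOpenMap_truncVec _ _ isOpen_interior
  have hVc : Convex ℝ V := (convex_momentSpace (n + 1)).interior.linear_image
    (LinearMap.funLeft ℝ ℝ (Fin.castLE (Nat.le_succ n)))
  have hVn : V.Nonempty := (interior_momentSpace_nonempty (n + 1)).image _
  have hsub : momentSpace n ⊆ closure V := by
    intro y hy
    obtain ⟨t, ht⟩ := momentFiber_nonempty hy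
    have hcl : Fin.snoc (α := fun _ => ℝ) y t ∈ closure (interior (momentSpace (n + 1))) := by
      rw [(convex_momentSpace _).closure_interior_eq_closure_of_nonempty_interior
        (interior_momentSpace_nonempty _)]
      exact subset_closure ht
    have := image_closure_subset_closure_image (continuous_truncVec (Nat.le_succ n))
      (Set.mem_image_of_mem _ hcl)
    rwa [truncVec_snoc] at this
  have hsV : s ∈ V := by
    have := interior_mono hsub hs
    rwa [hVc.interior_closure_eq_interior_of_nonempty_interior (by rwa [hVo.interior_eq]),
      hVo.interior_eq] at this
  obtain ⟨z, hz, rfl⟩ := hsV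
  exact ⟨z (Fin.last n), by rwa [snoc_truncVec]⟩

lemma momentFiber_mem_nhds {n : ℕ} {s : Fin n → ℝ} {t : ℝ}
    (h : Fin.snoc (α := fun _ => ℝ) s t ∈ interior (momentSpace (n + 1))) :
    momentFiber s ∈ nhds t :=
  (continuous_snoc_right s).continuousAt.preimage_mem_nhds (mem_interior_iff_mem_nhds.1 h)

lemma exists_lt_mem_of_mem_nhds {T : Set ℝ} {t : ℝ} (h : T ∈ nhds t) :
    (∃ a ∈ T, a < t) ∧ ∃ b ∈ T, t < b := by
  obtain ⟨ε, hε, hb⟩ := Metric.mem_nhds_iff.1 h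
  refine ⟨⟨t - ε / 2, hb ?_, by linarith⟩, ⟨t + ε / 2, hb ?_, by linarith⟩⟩ <;>
  · simp [abs_of_pos hε, hε]

lemma sInf_lt_sSup_momentFiber {n : ℕ} {s : Fin n → ℝ} (hs : s ∈ interior (momentSpace n)) :
    sInf (momentFiber s) < sSup (momentFiber s) := by
  obtain ⟨t, ht⟩ := exists_snoc_mem_interior hs
  obtain ⟨⟨a, haT, hat⟩, -⟩ := exists_lt_mem_of_mem_nhds (momentFiber_mem_nhds ht)
  have h1 := csInf_le (isCompact_momentFiber s).bddBelow haT
  have h2 := le_csSup (isCompact_momentFiber s).bddAbove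
    (mem_of_mem_nhds (momentFiber_mem_nhds ht))
  linarith

lemma mem_Ioo_of_snoc_mem_interior {n : ℕ} {s : Fin n → ℝ} {t : ℝ}
    (h : Fin.snoc (α := fun _ => ℝ) s t ∈ interior (momentSpace (n + 1))) :
    t ∈ Set.Ioo (sInf (momentFiber s)) (sSup (momentFiber s)) := by
  obtain ⟨⟨a, haT, hat⟩, b, hbT, htb⟩ := exists_lt_mem_of_mem_nhds (momentFiber_mem_nhds h)
  exact ⟨(csInf_le (isCompact_momentFiber s).bddBelow haT).trans_lt hat,
    htb.trans_le (le_csSup (isCompact_momentFiber s).bddAbove hbT)⟩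

lemma momentFiber_eq_Icc {n : ℕ} {s : Fin n → ℝ} (hs : s ∈ momentSpace n) :
    momentFiber s = Set.Icc (sInf (momentFiber s)) (sSup (momentFiber s)) :=
  eq_Icc_of_connected_compact
    ((convex_momentFiber s).isConnected (momentFiber_nonempty hs)) (isCompact_momentFiber s)

namespace Represents

variable {n : ℕ} {μ ν : Measure ℝ} {s : Fin n → ℝ}

lemma momentFunctional_congr (hμ : Represents μ s) (hν : Represents ν s) {p : ℝ[X]}
    (hp : p.natDegree ≤ n) : momentFunctional ν p = momentFunctional μ p := by
  rw [hμ.momentFunctional_eq hp, hν.momentFunctional_eq hp]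

lemma momentFunctional_sub (hμ : Represents μ s) (hν : Represents ν s) {p : ℝ[X]}
    (hp : p.natDegree ≤ n + 1) : momentFunctional ν p = momentFunctional μ p +
      p.coeff (n + 1) * (∫ x, x ^ (n + 1) ∂ν - ∫ x, x ^ (n + 1) ∂μ) := by
  have hμ' := (represents_snoc_iff.2 ⟨hμ, rfl⟩).momentFunctional_eq hp
  have hν' := (represents_snoc_iff.2 ⟨hν, rfl⟩).momentFunctional_eq hp
  rw [hμ', hν']
  simp only [Fin.sum_univ_castSucc, Fin.snoc_castSucc, Fin.snoc_last, Fin.val_last]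
  ring

lemma momentFunctional_weighted_le (hμ : Represents μ s) (hν : Represents ν s) {w A q : ℝ[X]}
    {m : ℕ} (hA : IsMonicOrth (momentFunctional μ) w A m)
    (hw : ∀ x ∈ Set.Icc (0:ℝ) 1, 0 ≤ w.eval x) (hm : w.natDegree + 2 * m = n + 1)
    (hq : q.Monic) (hqm : q.natDegree = m) :
    momentFunctional ν (w * A ^ 2) ≤ momentFunctional ν (w * q ^ 2) := by
  have hr : (q - A).degree < m := by
    have hqd : q.degree = m := by rw [degree_eq_natDegree hq.ne_zero, hqm]
    rw [← hqd]
    refine degree_sub_lt_left ?_ hq.ne_zero (by rw [hq.leadingCoeff, hA.monic.leadingCoeff])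
    rw [hqd, degree_eq_natDegree hA.monic.ne_zero, hA.natDegree_eq]
  have h0 : momentFunctional ν (w * A * (q - A)) = 0 := by
    rw [hμ.momentFunctional_congr hν, hA.orth _ hr]
    by_cases hz : q - A = 0
    · simp [hz]
    · have h1 := (natDegree_lt_iff_degree_lt hz).2 hr
      have h2 := natDegree_mul_le (p := w * A) (q := q - A)
      have h3 := natDegree_mul_le (p := w) (q := A)
      rw [hA.natDegree_eq] at h3
      omega
  have h1 : 0 ≤ momentFunctional ν (w * (q - A) ^ 2) :=
    hν.momentFunctional_nonneg fun x hx => by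
      simpa using mul_nonneg (hw x hx) (sq_nonneg ((q - A).eval x))
  have h2 : w * q ^ 2 = w * A ^ 2 + (2:ℝ) • (w * A * (q - A)) + w * (q - A) ^ 2 := by
    rw [smul_eq_C_mul, show (C (2:ℝ) : ℝ[X]) = 2 from rfl]; ring
  rw [h2, map_add, map_add, map_smul, h0, smul_zero]
  linarith

/-- The ends of the range of the next moment, through orthogonal polynomials. -/
lemma sInf_sSup_momentFiber (hμ : Represents μ s) (hs : s ∈ interior (momentSpace n))
    {A D : ℝ[X]}
    (hA : IsMonicOrth (momentFunctional μ) (loWeight (n + 1)) A ((n + 1) / 2))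
    (hD : IsMonicOrth (momentFunctional μ) (hiWeight (n + 1)) D (n / 2)) :
    sInf (momentFiber s) =
        ∫ x, x ^ (n + 1) ∂μ - momentFunctional μ (loWeight (n + 1) * A ^ 2) ∧
      sSup (momentFiber s) =
        ∫ x, x ^ (n + 1) ∂μ + momentFunctional μ (hiWeight (n + 1) * D ^ 2) := by
  set M := ∫ x, x ^ (n + 1) ∂μ
  set a := momentFunctional μ (loWeight (n + 1) * A ^ 2)
  set d := momentFunctional μ (hiWeight (n + 1) * D ^ 2)
  have hlod := natDegree_loWeight (n + 1)
  have hhid := natDegree_hiWeight n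
  have hlom : (loWeight (n + 1) * A ^ 2).Monic := (loWeight_monic _).mul (hA.monic.pow 2)
  have hloN : (loWeight (n + 1) * A ^ 2).natDegree = n + 1 := by
    rw [(loWeight_monic _).natDegree_mul (hA.monic.pow 2), hA.monic.natDegree_pow,
      hA.natDegree_eq]
    exact hlod
  have hhim : (-hiWeight (n + 1) * D ^ 2).Monic := (neg_hiWeight_monic _).mul (hD.monic.pow 2)
  have hhiN : (-hiWeight (n + 1) * D ^ 2).natDegree = n + 1 := by
    rw [(neg_hiWeight_monic _).natDegree_mul (hD.monic.pow 2), hD.monic.natDegree_pow,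
      hD.natDegree_eq, natDegree_neg]
    exact hhid
  have hloc : (loWeight (n + 1) * A ^ 2).coeff (n + 1) = 1 := by
    have := hlom.coeff_natDegree
    rwa [hloN] at this
  have hhic : (hiWeight (n + 1) * D ^ 2).coeff (n + 1) = -1 := by
    have h1 : (-hiWeight (n + 1) * D ^ 2).coeff (n + 1) = 1 := by
      have := hhim.coeff_natDegree
      rwa [hhiN] at this
    rw [neg_mul, coeff_neg] at h1
    linarith
  have hhiN' : (hiWeight (n + 1) * D ^ 2).natDegree ≤ n + 1 := by
    rw [neg_mul, natDegree_neg] at hhiN; exact hhiN.le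
  have hlo : ∀ ν, Represents ν s → momentFunctional ν (loWeight (n + 1) * A ^ 2) =
      a + (∫ x, x ^ (n + 1) ∂ν - M) := fun ν hν => by
    rw [hμ.momentFunctional_sub hν hloN.le, hloc, one_mul]
  have hhi : ∀ ν, Represents ν s → momentFunctional ν (hiWeight (n + 1) * D ^ 2) =
      d - (∫ x, x ^ (n + 1) ∂ν - M) := fun ν hν => by
    rw [hμ.momentFunctional_sub hν hhiN', hhic]; ring
  have hsq : ∀ (ν : Measure ℝ), Represents ν s → ∀ w q : ℝ[X],
      (∀ x ∈ Set.Icc (0:ℝ) 1, 0 ≤ w.eval x) → 0 ≤ momentFunctional ν (w * q ^ 2) :=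
    fun ν hν w q hw => hν.momentFunctional_nonneg fun x hx => by
      simpa using mul_nonneg (hw x hx) (sq_nonneg (q.eval x))
  have hrange : ∀ t ∈ momentFiber s, M - a ≤ t ∧ t ≤ M + d := by
    intro t ht
    obtain ⟨ν, hν, rfl⟩ := mem_momentFiber_iff.1 ht
    have h1 := hsq ν hν _ A (loWeight_nonneg (n + 1))
    have h2 := hsq ν hν _ D (hiWeight_nonneg (n + 1))
    rw [hlo ν hν] at h1
    rw [hhi ν hν] at h2
    constructor <;> linarith
  have hend : ∀ t ∈ momentFiber s,
      Fin.snoc (α := fun _ => ℝ) s t ∉ interior (momentSpace (n + 1)) → t = M - a ∨ t = M + d := by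
    intro t ht h_int
    have hr := hrange t ht
    obtain ⟨ν, hν, rfl⟩ := mem_momentFiber_iff.1 ht
    obtain ⟨R, hR0, hR, hRd, hRae⟩ :=
      exists_vanishing_of_notMem_interior (represents_snoc_iff.2 ⟨hν, rfl⟩) h_int
    have hvan : ∀ p : ℝ[X], (∀ x ∈ Set.Icc (0:ℝ) 1, R.eval x = 0 → p.eval x = 0) →
        momentFunctional ν p = 0 := by
      intro p hp
      rw [hν.momentFunctional_apply]
      refine integral_eq_zero_of_ae ?_
      filter_upwards [hν.ae_mem, hRae] with x hx hx0 using hp x hx hx0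
    rcases exists_weighted_square_of_nonneg hR0 hR hRd with ⟨q, hq, hqd, hqv⟩ | ⟨q, hq, hqd, hqv⟩
    · left
      have := hμ.momentFunctional_weighted_le hν hA (loWeight_nonneg _) hlod hq hqd
      rw [hvan _ hqv, hlo ν hν] at this
      linarith [hr.1]
    · right
      have := hμ.momentFunctional_weighted_le hν hD (hiWeight_nonneg _) hhid hq hqd
      rw [hvan _ hqv, hhi ν hν] at this
      linarith [hr.2]
  have hne := momentFiber_nonempty (interior_subset hs)
  have hInf := (isCompact_momentFiber s).sInf_mem hne
  have hSup := (isCompact_momentFiber s).sSup_mem hne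
  have e1 := hend _ hInf fun h => lt_irrefl _ (mem_Ioo_of_snoc_mem_interior h).1
  have e2 := hend _ hSup fun h => lt_irrefl _ (mem_Ioo_of_snoc_mem_interior h).2
  have hlt := sInf_lt_sSup_momentFiber hs
  have r1 := hrange _ hInf
  have r2 := hrange _ hSup
  rcases e1 with e1 | e1 <;> rcases e2 with e2 | e2 <;> first | exact ⟨e1, e2⟩ | linarith

end Represents

lemma exists_lo_orth {L : ℝ[X] →ₗ[ℝ] ℝ} {n k : ℕ} (hL : PosUpTo L n) (hk : k ≤ n + 2) :
    ∃ A, IsMonicOrth L (loWeight k) A (k / 2) :=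
  exists_isMonicOrth hL (loWeight_monic _).ne_zero (loWeight_nonneg _) _
    (by have := natDegree_loWeight k; omega)

lemma exists_hi_orth {L : ℝ[X] →ₗ[ℝ] ℝ} {n k : ℕ} (hL : PosUpTo L n) (hk : k ≤ n + 1) :
    ∃ A, IsMonicOrth L (hiWeight (k + 1)) A (k / 2) :=
  exists_isMonicOrth hL (hiWeight_ne_zero _) (hiWeight_nonneg _) _
    (by have := natDegree_hiWeight k; omega)

/-- The width of the range of the next moment. -/
noncomputable def fiberWidth {n : ℕ} (s : Fin n → ℝ) : ℝ :=
  sSup (momentFiber s) - sInf (momentFiber s)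

lemma fiberWidth_pos {n : ℕ} {s : Fin n → ℝ} (hs : s ∈ interior (momentSpace n)) :
    0 < fiberWidth s := sub_pos.2 (sInf_lt_sSup_momentFiber hs)

lemma momentSpace_zero : momentSpace 0 = Set.univ := by
  refine Set.eq_univ_of_forall fun z => ?_
  convert pow_mem_momentSpace 0 (x := 0) (by simp) using 1

lemma fiberWidth_zero (s : Fin 0 → ℝ) : fiberWidth s = 1 := by
  have hs : s ∈ interior (momentSpace 0) := by simp [momentSpace_zero]
  obtain ⟨μ, hμ⟩ := mem_momentSpace_iff_s16.1 (interior_subset hs)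
  have h1 : loWeight (0 + 1) = X := if_neg (by simp)
  have h2 : hiWeight (0 + 1) = 1 - X := if_neg (by simp)
  have hone : ∀ w, IsMonicOrth (momentFunctional μ) w 1 0 := fun w =>
    ⟨monic_one, natDegree_one, fun q hq => by
      have : q = 0 := by simpa using hq
      simp [this]⟩
  obtain ⟨e1, e2⟩ := hμ.sInf_sSup_momentFiber hs (hone _) (hone _)
  rw [fiberWidth, e1, e2, h1, h2]
  have := hμ.momentFunctional_eq (p := 1) (by simp)
  simp only [one_pow, mul_one, map_sub]
  simp only [coeff_one_zero, Finset.univ_eq_empty, Finset.sum_empty, add_zero] at this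
  rw [this]; ring

lemma fiberWidth_snoc {n : ℕ} {s : Fin n → ℝ} {t : ℝ}
    (h : Fin.snoc (α := fun _ => ℝ) s t ∈ interior (momentSpace (n + 1))) :
    fiberWidth (Fin.snoc (α := fun _ => ℝ) s t : Fin (n + 1) → ℝ) * fiberWidth s =
      (t - sInf (momentFiber s)) * (sSup (momentFiber s) - t) := by
  obtain ⟨μ, hμ⟩ := mem_momentSpace_iff_s16.1 (interior_subset h)
  have hs : s ∈ interior (momentSpace n) := by
    have := truncVec_mem_interior (Nat.le_succ n) h
    rwa [truncVec_snoc] at this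
  obtain ⟨hμs, ht⟩ := represents_snoc_iff.1 hμ
  have hL := hμ.posUpTo h
  obtain ⟨A, hA⟩ := exists_lo_orth (k := n + 1) hL (by omega)
  obtain ⟨D, hD⟩ := exists_hi_orth (k := n) hL (by omega)
  obtain ⟨B, hB⟩ := exists_lo_orth (k := n + 2) hL (by omega)
  obtain ⟨E, hE⟩ := exists_hi_orth (k := n + 1) hL (by omega)
  have hid := weight_identity hA hD hB hE
  obtain ⟨e1, e2⟩ := hμs.sInf_sSup_momentFiber hs hA hD
  obtain ⟨e3, e4⟩ := hμ.sInf_sSup_momentFiber h hB hE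
  rw [ht] at e1 e2
  simp only [fiberWidth]
  rw [e1, e2, e3, e4]
  linear_combination hid

end PolynomialTools

/-- The position of a possible next moment within its range. -/
noncomputable def canCoord {n : ℕ} (s : Fin n → ℝ) (t : ℝ) : ℝ :=
  (t - sInf (momentFiber s)) / fiberWidth s

lemma canMap_apply {n : ℕ} (s : Fin n → ℝ) (k : Fin n) :
    canMap n s k = canCoord (truncVec k.is_lt.le s) (s k) := by
  simp [canMap, sMin, sMax, kthMomentSet_toSeq k.is_lt.le, canCoord, fiberWidth]

lemma canMap_snoc {n : ℕ} (s : Fin n → ℝ) (t : ℝ) :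
    canMap (n + 1) (Fin.snoc (α := fun _ => ℝ) s t) =
      Fin.snoc (α := fun _ => ℝ) (canMap n s) (canCoord s t) := by
  funext j
  refine Fin.lastCases ?_ (fun j => ?_) j
  · rw [canMap_apply, Fin.snoc_last, Fin.snoc_last]
    congr 1
    exact truncVec_snoc s t
  · rw [canMap_apply, Fin.snoc_castSucc, Fin.snoc_castSucc, canMap_apply]
    congr 1
    funext i
    exact Fin.snoc_castSucc (α := fun _ => ℝ) t s (Fin.castLE j.is_lt.le i)

lemma fiberWidth_eq_prod {n : ℕ} {s : Fin n → ℝ} (hs : s ∈ interior (momentSpace n)) :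
    (∀ k, 0 ≤ canMap n s k * (1 - canMap n s k)) ∧
      fiberWidth s = ∏ k, canMap n s k * (1 - canMap n s k) := by
  induction n with
  | zero => exact ⟨fun k => k.elim0, by simp [fiberWidth_zero]⟩
  | succ n ih =>
    obtain ⟨y, t, rfl⟩ : ∃ (y : Fin n → ℝ) (t : ℝ), s = Fin.snoc (α := fun _ => ℝ) y t :=
      ⟨_, _, (snoc_truncVec s).symm⟩
    have hy : y ∈ interior (momentSpace n) := by
      have := truncVec_mem_interior (Nat.le_succ n) hs
      rwa [truncVec_snoc] at this
    obtain ⟨ih1, ih2⟩ := ih hy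
    have hw := fiberWidth_pos hy
    have ht := mem_Ioo_of_snoc_mem_interior hs
    have hlast : canCoord y t * (1 - canCoord y t) * fiberWidth y ^ 2 =
        (t - sInf (momentFiber y)) * (sSup (momentFiber y) - t) := by
      unfold canCoord
      field_simp
      simp only [fiberWidth]
      ring
    have hpos : 0 ≤ canCoord y t * (1 - canCoord y t) := by
      refine nonneg_of_mul_nonneg_left ?_ (pow_pos hw 2)
      rw [hlast]
      exact mul_nonneg (sub_nonneg.2 ht.1.le) (sub_nonneg.2 ht.2.le)
    rw [canMap_snoc]
    constructor
    · intro k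
      refine Fin.lastCases ?_ (fun k => ?_) k
      · simpa using hpos
      · simpa using ih1 k
    · have h := fiberWidth_snoc hs
      rw [← hlast] at h
      simp only [Fin.prod_univ_castSucc, Fin.snoc_castSucc, Fin.snoc_last]
      rw [← ih2]
      refine mul_right_cancel₀ hw.ne' ?_
      rw [h]; ring

lemma convexOn_sInf_momentFiber (n : ℕ) :
    ConvexOn ℝ (momentSpace n) fun s => sInf (momentFiber s) := by
  refine ⟨convex_momentSpace n, fun s hs s' hs' a b ha hb hab => ?_⟩
  exact csInf_le (isCompact_momentFiber _).bddBelow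
    (combo_mem_momentFiber ((isCompact_momentFiber s).sInf_mem (momentFiber_nonempty hs))
      ((isCompact_momentFiber s').sInf_mem (momentFiber_nonempty hs')) ha hb hab)

lemma concaveOn_sSup_momentFiber (n : ℕ) :
    ConcaveOn ℝ (momentSpace n) fun s => sSup (momentFiber s) := by
  refine ⟨convex_momentSpace n, fun s hs s' hs' a b ha hb hab => ?_⟩
  exact le_csSup (isCompact_momentFiber _).bddAbove
    (combo_mem_momentFiber ((isCompact_momentFiber s).sSup_mem (momentFiber_nonempty hs))
      ((isCompact_momentFiber s').sSup_mem (momentFiber_nonempty hs')) ha hb hab)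

lemma continuousOn_canMap (n : ℕ) : ContinuousOn (canMap n) (interior (momentSpace n)) := by
  refine continuousOn_pi.2 fun k => ?_
  simp only [canMap_apply, canCoord, fiberWidth]
  have hmaps : Set.MapsTo (truncVec k.is_lt.le) (interior (momentSpace n))
      (interior (momentSpace k)) := fun s hs => truncVec_mem_interior _ hs
  have hc := (continuous_truncVec k.is_lt.le).continuousOn (s := interior (momentSpace n))
  have h1 := (convexOn_sInf_momentFiber k).continuousOn_interior.comp hc hmaps
  have h2 := (concaveOn_sSup_momentFiber k).continuousOn_interior.comp hc hmaps
  exact ((continuous_apply k).continuousOn.sub h1).div (h2.sub h1)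
    fun s hs => (fiberWidth_pos (hmaps hs)).ne'

lemma restrict_momentSpace (n : ℕ) :
    volume.restrict (momentSpace n) = volume.restrict (interior (momentSpace n)) :=
  (Measure.restrict_congr_set (interior_ae_eq_of_null_frontier
    ((convex_momentSpace n).addHaar_frontier volume))).symm

lemma aemeasurable_canMap (n : ℕ) :
    AEMeasurable (canMap n) (volume.restrict (momentSpace n)) := by
  rw [restrict_momentSpace]
  exact (continuousOn_canMap n).aemeasurable isOpen_interior.measurableSet

lemma lintegral_Icc_affine {a b : ℝ} (hab : a < b) (f : ℝ → ENNReal) :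
    ∫⁻ t in Set.Icc a b, f ((t - a) / (b - a)) =
      ENNReal.ofReal (b - a) * ∫⁻ u in Set.Ioo 0 1, f u := by
  have hw : 0 < b - a := sub_pos.2 hab
  have himg : (fun u => (b - a) * u + a) '' Set.Ioo 0 1 = Set.Ioo a b := by
    rw [Set.image_affine_Ioo hw]; simp
  have hd : ∀ x ∈ Set.Ioo (0:ℝ) 1,
      HasDerivWithinAt (fun u => (b - a) * u + a) (b - a) (Set.Ioo 0 1) x := fun x _ => by
    simpa using (((hasDerivAt_id x).const_mul (b - a)).add_const a).hasDerivWithinAt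
  have hinj : Set.InjOn (fun u => (b - a) * u + a) (Set.Ioo 0 1) := fun x _ y _ h => by
    simpa [hw.ne'] using h
  rw [setLIntegral_congr Ioo_ae_eq_Icc.symm, ← himg,
    lintegral_image_eq_lintegral_abs_deriv_mul measurableSet_Ioo hd hinj, abs_of_pos hw,
    lintegral_const_mul' _ _ ENNReal.ofReal_ne_top]
  simp [hw.ne']

lemma lintegral_snoc {n : ℕ} {F : (Fin (n + 1) → ℝ) → ENNReal} (hF : AEMeasurable F) :
    ∫⁻ z, F z = ∫⁻ s : Fin n → ℝ, ∫⁻ t, F (Fin.snoc (α := fun _ => ℝ) s t) := by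
  have hmp := (volume_preserving_piFinSuccAbove (fun _ : Fin (n + 1) => ℝ) (Fin.last n)).symm
  have he : ∀ p : ℝ × (Fin n → ℝ),
      (MeasurableEquiv.piFinSuccAbove (fun _ : Fin (n + 1) => ℝ) (Fin.last n)).symm p =
        Fin.snoc (α := fun _ => ℝ) p.2 p.1 := fun p => by
    simp [MeasurableEquiv.piFinSuccAbove_symm_apply, Fin.insertNthEquiv]
  have hF' : AEMeasurable (fun p : ℝ × (Fin n → ℝ) =>
      F ((MeasurableEquiv.piFinSuccAbove (fun _ : Fin (n + 1) => ℝ) (Fin.last n)).symm p)) :=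
    hF.comp_quasiMeasurePreserving hmp.quasiMeasurePreserving
  rw [← hmp.lintegral_comp_emb (MeasurableEquiv.measurableEmbedding _),
    Measure.volume_eq_prod, lintegral_prod_symm _ hF']
  simp_rw [he]

lemma setLIntegral_prod_canMap {n : ℕ} {f : Fin n → ℝ → ENNReal} (hf : ∀ k, Measurable (f k)) :
    ∫⁻ s in momentSpace n, ∏ k, f k (canMap n s k) =
      ∏ k : Fin n, ∫⁻ u in Set.Ioo (0:ℝ) 1,
        f k u * ENNReal.ofReal (u * (1 - u)) ^ (n - (k + 1)) := by
  induction n with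
  | zero =>
    simp [momentSpace_zero, volume_pi]
  | succ n ih =>
    set b : ℝ → ENNReal := fun u => ENNReal.ofReal (u * (1 - u)) with hb
    have hbm : Measurable b := by fun_prop
    have hmeas : ∀ m, MeasurableSet (momentSpace m) := fun m =>
      (isCompact_momentSpace m).isClosed.measurableSet
    have hF : ∀ {m : ℕ} {g : Fin m → ℝ → ENNReal}, (∀ k, Measurable (g k)) →
        AEMeasurable (fun s => ∏ k, g k (canMap m s k)) (volume.restrict (momentSpace m)) :=
      fun {m g} hg => (by fun_prop :
        Measurable fun u : Fin m → ℝ => ∏ k, g k (u k)).comp_aemeasurable (aemeasurable_canMap m)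
    have hfiber : ∀ s ∈ interior (momentSpace n),
        (∫⁻ t in momentFiber s, ∏ k, f k (canMap (n + 1) (Fin.snoc (α := fun _ => ℝ) s t) k)) =
          (∏ k : Fin n, f k.castSucc (canMap n s k) * b (canMap n s k)) *
            ∫⁻ u in Set.Ioo (0:ℝ) 1, f (Fin.last n) u := by
      intro s hs
      have h_int : ∫⁻ t in momentFiber s, f (Fin.last n) (canCoord s t) =
          ENNReal.ofReal (fiberWidth s) * ∫⁻ u in Set.Ioo (0:ℝ) 1, f (Fin.last n) u := by
        rw [momentFiber_eq_Icc (interior_subset hs)]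
        exact lintegral_Icc_affine (sInf_lt_sSup_momentFiber hs) _
      obtain ⟨h0, hw⟩ := fiberWidth_eq_prod hs
      simp only [canMap_snoc, Fin.prod_univ_castSucc, Fin.snoc_castSucc, Fin.snoc_last]
      rw [lintegral_const_mul, h_int, hw, ENNReal.ofReal_prod_of_nonneg fun k _ => h0 k,
        Finset.prod_mul_distrib, mul_assoc]
      exact (hf _).comp (by unfold canCoord; fun_prop)
    rw [← lintegral_indicator (hmeas _),
      lintegral_snoc ((aemeasurable_indicator_iff (hmeas _)).2 (hF hf))]
    have hsplit : ∀ s : Fin n → ℝ,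
        (∫⁻ t, (momentSpace (n + 1)).indicator (fun z => ∏ k, f k (canMap (n + 1) z k))
          (Fin.snoc (α := fun _ => ℝ) s t)) =
        (momentSpace n).indicator (fun s => ∫⁻ t in momentFiber s,
          ∏ k, f k (canMap (n + 1) (Fin.snoc (α := fun _ => ℝ) s t) k)) s := by
      intro s
      by_cases hs : s ∈ momentSpace n
      · rw [Set.indicator_of_mem hs,
          ← lintegral_indicator (isCompact_momentFiber s).isClosed.measurableSet]
        rfl
      · rw [Set.indicator_of_notMem hs]
        have : ∀ t, Fin.snoc (α := fun _ => ℝ) s t ∉ momentSpace (n + 1) := fun t ht => by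
          have := truncVec_mem_momentSpace (Nat.le_succ n) ht
          rw [truncVec_snoc] at this
          exact hs this
        simp [Set.indicator_of_notMem (this _)]
    simp_rw [hsplit]
    rw [lintegral_indicator (hmeas n), restrict_momentSpace,
      setLIntegral_congr_fun isOpen_interior.measurableSet hfiber, ← restrict_momentSpace]
    have hg : ∀ k : Fin n, Measurable fun u => f k.castSucc u * b u := fun k => (hf _).mul hbm
    rw [lintegral_mul_const'' _ (hF hg), ih hg, Fin.prod_univ_castSucc]
    congr 1
    · refine Finset.prod_congr rfl fun k _ => lintegral_congr fun u => ?_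
      rw [mul_assoc, ← pow_succ', Fin.val_castSucc]
      congr 2
      omega
    · simp

/-- The normalizing constant of the density of the symmetric Beta distribution. -/
noncomputable def betaConst (a : ℝ) : ℝ := Real.Gamma (a + a) / (Real.Gamma a * Real.Gamma a)

lemma betaConst_pos {a : ℝ} (ha : 0 < a) : 0 < betaConst a := by
  have := Real.Gamma_pos_of_pos ha
  have := Real.Gamma_pos_of_pos (add_pos ha ha)
  unfold betaConst
  positivity

lemma betaMeas_apply (m : ℕ) {S : Set ℝ} (hS : MeasurableSet S) :
    betaMeas (m + 1) (m + 1) S = ENNReal.ofReal (betaConst (m + 1)) *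
      ∫⁻ u in Set.Ioo (0:ℝ) 1, S.indicator 1 u * ENNReal.ofReal (u * (1 - u)) ^ m := by
  rw [betaMeas, withDensity_apply _ hS, ← lintegral_const_mul' _ _ ENNReal.ofReal_ne_top,
    ← lintegral_indicator hS, ← lintegral_indicator measurableSet_Ioo]
  refine lintegral_congr fun u => ?_
  by_cases hu : u ∈ Set.Ioo (0:ℝ) 1 <;> by_cases hs : u ∈ S <;> simp [hu, hs]
  have h1 : 0 ≤ u * (1 - u) := mul_nonneg hu.1.le (sub_nonneg.2 hu.2.le)
  rw [← ENNReal.ofReal_pow h1, ← ENNReal.ofReal_mul (betaConst_pos (by positivity)).le, mul_pow,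
    mul_comm]
  rfl

lemma isProbabilityMeasure_betaMeas {a : ℝ} (ha : 0 < a) :
    IsProbabilityMeasure (betaMeas a a) := by
  constructor
  rw [betaMeas, withDensity_apply _ MeasurableSet.univ, Measure.restrict_univ,
    ← ProbabilityTheory.lintegral_betaPDF_eq_one ha ha]
  refine lintegral_congr fun u => ?_
  rw [ProbabilityTheory.betaPDF_eq]
  congr 1
  by_cases hu : u ∈ Set.Ioo (0:ℝ) 1
  · rw [Set.indicator_of_mem hu, if_pos (show 0 < u ∧ u < 1 from hu),
      ProbabilityTheory.beta, one_div_div]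
    ring
  · rw [Set.indicator_of_notMem hu, if_neg (show ¬(0 < u ∧ u < 1) from hu)]

/-- If `(s₁,…,s_n)` is uniformly distributed on the moment space `M_n`, then the
canonical moments `u₁,…,u_n` are independent with `u_k ~ Beta(n-k+1, n-k+1)`:
the image of the uniform distribution under the canonical-moment map is the
product of these Beta distributions. -/
theorem canonical_moments_of_uniform_independent_beta (n : ℕ) :
    Measure.map (canMap n)
        ((volume (momentSpace n))⁻¹ • volume.restrict (momentSpace n)) =
      Measure.pi fun k : Fin n =>
        betaMeas ((n : ℝ) - (k : ℕ)) ((n : ℝ) - (k : ℕ)) := by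
  have hpos : ∀ k : Fin n, 0 < (n : ℝ) - (k : ℕ) := fun k => sub_pos.2 (by exact_mod_cast k.is_lt)
  have hparam : ∀ k : Fin n, (n : ℝ) - (k : ℕ) = ((n - (k + 1) : ℕ) : ℝ) + 1 := fun k => by
    rw [Nat.cast_sub k.is_lt]; push_cast; ring
  have := fun k : Fin n => isProbabilityMeasure_betaMeas (hpos k)
  let c : Fin n → ENNReal := fun k => ENNReal.ofReal (betaConst ((n : ℝ) - (k : ℕ)))
  have hc0 : ∀ k, c k ≠ 0 := fun k => (ENNReal.ofReal_pos.2 (betaConst_pos (hpos k))).ne'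
  have hct : ∀ k, c k ≠ ⊤ := fun k => ENNReal.ofReal_ne_top
  have hbeta : ∀ (k : Fin n) {S : Set ℝ}, MeasurableSet S →
      betaMeas ((n : ℝ) - (k : ℕ)) ((n : ℝ) - (k : ℕ)) S =
        c k * ∫⁻ u in Set.Ioo (0:ℝ) 1,
          S.indicator 1 u * ENNReal.ofReal (u * (1 - u)) ^ (n - (k + 1)) := fun k S hS => by
    simp only [c, hparam]
    exact betaMeas_apply _ hS
  have hprod : ∀ {S : Fin n → Set ℝ}, (∀ k, MeasurableSet (S k)) →
      volume.restrict (momentSpace n) (canMap n ⁻¹' Set.univ.pi S) =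
        ∏ k, (c k)⁻¹ * betaMeas ((n : ℝ) - (k : ℕ)) ((n : ℝ) - (k : ℕ)) (S k) := fun {S} hS => by
    have hind : ∀ k, Measurable ((S k).indicator (1 : ℝ → ENNReal)) := fun k =>
      measurable_one.indicator (hS k)
    have h := setLIntegral_prod_canMap hind
    have hnull : NullMeasurableSet (canMap n ⁻¹' Set.univ.pi S)
        (volume.restrict (momentSpace n)) :=
      (aemeasurable_canMap n).nullMeasurableSet_preimage (MeasurableSet.univ_pi hS)
    rw [← lintegral_indicator_one₀ hnull]
    convert h using 1
    · refine lintegral_congr fun s => ?_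
      by_cases hs : s ∈ canMap n ⁻¹' Set.univ.pi S
      · rw [Set.indicator_of_mem hs, Finset.prod_eq_one fun k _ =>
          Set.indicator_of_mem (hs k trivial) _]
        rfl
      · rw [Set.indicator_of_notMem hs]
        obtain ⟨k, hk⟩ : ∃ k, canMap n s k ∉ S k := by simpa using hs
        exact (Finset.prod_eq_zero (Finset.mem_univ k) (Set.indicator_of_notMem hk _)).symm
    · refine Finset.prod_congr rfl fun k _ => ?_
      rw [hbeta k (hS k), ← mul_assoc, ENNReal.inv_mul_cancel (hc0 k) (hct k), one_mul]
  have hvol : volume (momentSpace n) = ∏ k, (c k)⁻¹ := by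
    simpa using hprod (S := fun _ => Set.univ) fun _ => MeasurableSet.univ
  refine (Measure.pi_eq fun S hS => ?_).symm
  rw [Measure.map_apply_of_aemeasurable ((aemeasurable_canMap n).smul_measure _)
    (MeasurableSet.univ_pi hS), Measure.smul_apply, hprod hS, Finset.prod_mul_distrib, ← hvol,
    smul_eq_mul, ← mul_assoc, ENNReal.inv_mul_cancel, one_mul]
  · rw [hvol]
    exact Finset.prod_ne_zero_iff.2 fun k _ => ENNReal.inv_ne_zero.2 (hct k)
  · exact (isCompact_momentSpace n).measure_ne_top
end
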